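/- arXiv:1207.6141 — 2 statements merged into one kernel-verified Lean document; each statement's English description precedes it below -/
import Mathlib

section
/- The complete bipartite graph K_{3,3} is weakly rooted-contractible: every graph G that contains a K_{3,3}-scheme contains K_{3,3} as a minor. -/
open SimpleGraph

/-- An `H`-scheme in `G`, where the embedding `f` identifies the vertices of `H`
with vertices of `G`.  It is a collection of paths `P_{uv}` in `G`, one for each
edge `uv` of `H`, such that `P_{uv}` is a `u,v`-path meeting `V(H)` exactly in
`{u, v}`, and any collection of edges of `H` whose paths share a common vertex
of `G` must have a common endpoint in `H`. -/
structure HScheme {α β : Type} (H : SimpleGraph α) (G : SimpleGraph β) (f : α ↪ β) where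
  path : ∀ u v, H.Adj u v → G.Walk (f u) (f v)
  path_symm : ∀ u v (h : H.Adj u v), path v u h.symm = (path u v h).reverse
  path_isPath : ∀ u v (h : H.Adj u v), (path u v h).IsPath
  root_mem : ∀ u v (h : H.Adj u v) (w : α), f w ∈ (path u v h).support → w = u ∨ w = v
  common_endpoint : ∀ x : β,
    (∃ u v, ∃ h : H.Adj u v, x ∈ (path u v h).support) →
    ∃ z : α, ∀ u v (h : H.Adj u v), x ∈ (path u v h).support → z = u ∨ z = v

/-- `G` contains `H` as a rooted minor: pairwise disjoint connected branch sets
`C v ⊆ V(G)`, one for each vertex `v` of `H`, with `f v ∈ C v`, such that for every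
edge `uv` of `H` there is an edge of `G` between `C u` and `C v`. -/
def RootedMinor {α β : Type} (H : SimpleGraph α) (G : SimpleGraph β) (f : α ↪ β) : Prop :=
  ∃ C : α → Set β,
    (∀ v, f v ∈ C v) ∧
    (∀ v, (G.induce (C v)).Connected) ∧
    (Pairwise fun u v => Disjoint (C u) (C v)) ∧
    (∀ u v, H.Adj u v → ∃ x ∈ C u, ∃ y ∈ C v, G.Adj x y)

/-- `G` contains `H` as a minor: pairwise disjoint connected branch sets, one for each
vertex of `H`, such that for every edge `uv` of `H` there is an edge of `G` between the
corresponding branch sets. -/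
def HasMinor {β α : Type} (G : SimpleGraph β) (H : SimpleGraph α) : Prop :=
  ∃ C : α → Set β,
    (∀ v, (G.induce (C v)).Connected) ∧
    (Pairwise fun u v => Disjoint (C u) (C v)) ∧
    (∀ u v, H.Adj u v → ∃ x ∈ C u, ∃ y ∈ C v, G.Adj x y)

/-- `H` is rooted-contractible: every (finite) graph `G` containing an `H`-scheme
contains `H` as a rooted minor. -/
def IsRootedContractible {α : Type} (H : SimpleGraph α) : Prop :=
  ∀ (β : Type) [Fintype β] (G : SimpleGraph β) (f : α ↪ β),
    Nonempty (HScheme H G f) → RootedMinor H G f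

/-- `H` is weakly rooted-contractible: every (finite) graph `G` containing an
`H`-scheme contains `H` as a minor. -/
def IsWeaklyRootedContractible {α : Type} (H : SimpleGraph α) : Prop :=
  ∀ (β : Type) [Fintype β] (G : SimpleGraph β) (f : α ↪ β),
    Nonempty (HScheme H G f) → HasMinor G H

namespace K33Scheme

variable {V W : Type}

/-- `s` is a nonempty set of vertices that induces a connected subgraph of `G`, expressed
through edge cuts. -/
def CutConn (G : SimpleGraph V) (s : Set V) : Prop :=
  s.Nonempty ∧ ∀ T ⊆ s, T.Nonempty → (∀ x ∈ T, ∀ y ∈ s, G.Adj x y → y ∈ T) → s ⊆ T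

theorem CutConn.singleton (G : SimpleGraph V) (a : V) : CutConn G {a} := by
  refine ⟨⟨a, rfl⟩, ?_⟩
  rintro T hT ⟨t, ht⟩ - x rfl
  have : t = x := hT ht
  exact this ▸ ht

theorem CutConn.union_of_adj {G : SimpleGraph V} {s t : Set V} (hs : CutConn G s)
    (ht : CutConn G t) {a b : V} (ha : a ∈ s) (hb : b ∈ t) (hab : G.Adj a b) :
    CutConn G (s ∪ t) := by
  refine ⟨⟨a, Or.inl ha⟩, fun T hT hne hcl => ?_⟩
  have h1 : (T ∩ s).Nonempty → s ⊆ T := fun h =>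
    (hs.2 (T ∩ s) Set.inter_subset_right h
      fun x hx y hy hxy => ⟨hcl x hx.1 y (Or.inl hy) hxy, hy⟩).trans Set.inter_subset_left
  have h2 : (T ∩ t).Nonempty → t ⊆ T := fun h =>
    (ht.2 (T ∩ t) Set.inter_subset_right h
      fun x hx y hy hxy => ⟨hcl x hx.1 y (Or.inr hy) hxy, hy⟩).trans Set.inter_subset_left
  obtain ⟨x, hx⟩ := hne
  rcases hT hx with h | h
  · have hsT := h1 ⟨x, hx, h⟩
    exact Set.union_subset hsT (h2 ⟨b, hcl a (hsT ha) b (Or.inr hb) hab, hb⟩)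
  · have htT := h2 ⟨x, hx, h⟩
    exact Set.union_subset (h1 ⟨a, hcl b (htT hb) a (Or.inl ha) hab.symm, ha⟩) htT

theorem CutConn.sUnion {G : SimpleGraph V} {S : Set (Set V)} {a : V} (hne : S.Nonempty)
    (h : ∀ s ∈ S, CutConn G s ∧ a ∈ s) : CutConn G (⋃₀ S) := by
  have hsub : ∀ T ⊆ ⋃₀ S, (∀ x ∈ T, ∀ y ∈ ⋃₀ S, G.Adj x y → y ∈ T) →
      ∀ s ∈ S, (T ∩ s).Nonempty → s ⊆ T := fun T hT hcl s hs hn =>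
    ((h s hs).1.2 (T ∩ s) Set.inter_subset_right hn fun x hx y hy hxy =>
      ⟨hcl x hx.1 y ⟨s, hs, hy⟩ hxy, hy⟩).trans Set.inter_subset_left
  obtain ⟨s₀, hs₀⟩ := hne
  refine ⟨⟨a, s₀, hs₀, (h s₀ hs₀).2⟩, fun T hT ⟨x, hx⟩ hcl => ?_⟩
  obtain ⟨s, hs, hxs⟩ := hT hx
  have ha : a ∈ T := hsub T hT hcl s hs ⟨x, hx, hxs⟩ (h s hs).2
  exact Set.sUnion_subset fun t ht => hsub T hT hcl t ht ⟨a, ha, (h t ht).2⟩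

theorem CutConn.union_of_mem {G : SimpleGraph V} {s t : Set V} (hs : CutConn G s)
    (ht : CutConn G t) {a : V} (ha : a ∈ s) (hb : a ∈ t) : CutConn G (s ∪ t) := by
  rw [← Set.sUnion_pair]
  exact CutConn.sUnion (a := a) ⟨s, by simp⟩ (by rintro _ (rfl | rfl) <;> simp_all)

theorem CutConn.insert_of_adj {G : SimpleGraph V} {s : Set V} (hs : CutConn G s) {a b : V}
    (ha : a ∈ s) (hab : G.Adj a b) : CutConn G (insert b s) := by
  rw [Set.insert_eq, Set.union_comm]
  exact hs.union_of_adj (CutConn.singleton G b) ha rfl hab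

theorem CutConn.exists_adj {G : SimpleGraph V} {s t : Set V} (hs : CutConn G s)
    (hts : t ⊆ s) (ht : t.Nonempty) {b : V} (hb : b ∈ s) (hbt : b ∉ t) :
    ∃ x ∈ t, ∃ y ∈ s, y ∉ t ∧ G.Adj x y := by
  by_contra! hcon
  exact hbt (hs.2 t hts ht (fun x hx y hy hxy => by_contra fun h => hcon x hx y hy h hxy) hb)

theorem CutConn.induce_connected {G : SimpleGraph V} {s : Set V} (hs : CutConn G s) :
    (G.induce s).Connected := by
  obtain ⟨⟨a, ha⟩, h⟩ := hs
  rw [connected_iff_exists_forall_reachable]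
  refine ⟨⟨a, ha⟩, fun ⟨b, hb⟩ => ?_⟩
  have := h {x | ∃ hx : x ∈ s, (G.induce s).Reachable ⟨a, ha⟩ ⟨x, hx⟩}
    (fun x hx => hx.1) ⟨a, ha, Reachable.refl _⟩ ?_ hb
  · exact this.2
  · rintro x ⟨hx, hr⟩ y hy hxy
    refine ⟨hy, hr.trans (Adj.reachable ?_)⟩
    simpa using hxy

/-- The connected component of `a` inside `s`. -/
def comp (G : SimpleGraph V) (s : Set V) (a : V) : Set V :=
  ⋃₀ {t | t ⊆ s ∧ CutConn G t ∧ a ∈ t}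

theorem comp_subset {G : SimpleGraph V} {s : Set V} {a : V} : comp G s a ⊆ s :=
  Set.sUnion_subset fun _ ht => ht.1

theorem subset_comp {G : SimpleGraph V} {s t : Set V} {a : V} (hts : t ⊆ s)
    (ht : CutConn G t) (ha : a ∈ t) : t ⊆ comp G s a :=
  Set.subset_sUnion_of_mem (⟨hts, ht, ha⟩ : t ∈ {t | t ⊆ s ∧ CutConn G t ∧ a ∈ t})

theorem mem_comp {G : SimpleGraph V} {s : Set V} {a : V} (ha : a ∈ s) : a ∈ comp G s a :=
  subset_comp (Set.singleton_subset_iff.2 ha) (CutConn.singleton G a) rfl rfl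

theorem cutConn_comp {G : SimpleGraph V} {s : Set V} {a : V} (ha : a ∈ s) :
    CutConn G (comp G s a) :=
  CutConn.sUnion (a := a)
    ⟨{a}, Set.singleton_subset_iff.2 ha, CutConn.singleton G a, rfl⟩ fun _ ht => ht.2

theorem mem_comp_of_adj {G : SimpleGraph V} {s : Set V} {a x y : V} (ha : a ∈ s)
    (hx : x ∈ comp G s a) (hy : y ∈ s) (hxy : G.Adj x y) : y ∈ comp G s a :=
  subset_comp (Set.insert_subset hy comp_subset) ((cutConn_comp ha).insert_of_adj hx hxy)
    (Set.mem_insert_of_mem _ (mem_comp ha)) (Set.mem_insert _ _)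

/-- `G` has a `K_{3,3}` minor, with branch sets that are connected in the sense of
`CutConn`. -/
def K33Minor (G : SimpleGraph V) : Prop :=
  ∃ C : Fin 3 ⊕ Fin 3 → Set V, (∀ r, CutConn G (C r)) ∧
    (Pairwise fun r s => Disjoint (C r) (C s)) ∧
    ∀ i j, ∃ x ∈ C (Sum.inl i), ∃ y ∈ C (Sum.inr j), G.Adj x y

theorem K33Minor.hasMinor {G : SimpleGraph V} (h : K33Minor G) :
    HasMinor G (completeBipartiteGraph (Fin 3) (Fin 3)) := by
  obtain ⟨C, hc, hd, ha⟩ := h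
  refine ⟨C, fun r => (hc r).induce_connected, hd, ?_⟩
  rintro (i | i) (j | j) hij
  · simp at hij
  · exact ha i j
  · obtain ⟨x, hx, y, hy, hxy⟩ := ha j i
    exact ⟨y, hy, x, hx, hxy.symm⟩
  · simp at hij

theorem CutConn.biUnion {G : SimpleGraph V} {G' : SimpleGraph W} {B : W → Set V}
    (hB : ∀ w, CutConn G (B w))
    (hadj : ∀ x y, G'.Adj x y → ∃ a ∈ B x, ∃ b ∈ B y, G.Adj a b)
    {s : Set W} (hs : CutConn G' s) : CutConn G (⋃ w ∈ s, B w) := by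
  obtain ⟨⟨w₀, hw₀⟩, hs⟩ := hs
  obtain ⟨b₀, hb₀⟩ := (hB w₀).1
  refine ⟨⟨b₀, Set.mem_biUnion hw₀ hb₀⟩, fun T hT ⟨t, ht⟩ hcl => ?_⟩
  have key : ∀ w ∈ s, (T ∩ B w).Nonempty → B w ⊆ T := fun w hw hn =>
    ((hB w).2 (T ∩ B w) Set.inter_subset_right hn fun x hx y hy hxy =>
      ⟨hcl x hx.1 y (Set.mem_biUnion hw hy) hxy, hy⟩).trans Set.inter_subset_left
  have hsub : s ⊆ {w | w ∈ s ∧ B w ⊆ T} := by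
    refine hs _ (fun w hw => hw.1) ?_ ?_
    · obtain ⟨w, hw, htw⟩ := Set.mem_iUnion₂.1 (hT ht)
      exact ⟨w, hw, key w hw ⟨t, ht, htw⟩⟩
    · rintro x ⟨hx, hxT⟩ y hy hxy
      obtain ⟨a, ha, b, hb, hab⟩ := hadj x y hxy
      exact ⟨hy, key y hy ⟨b, hcl a (hxT ha) b (Set.mem_biUnion hy hb) hab, hb⟩⟩
  exact Set.iUnion₂_subset fun w hw => (hsub hw).2

theorem K33Minor.lift {G : SimpleGraph V} {G' : SimpleGraph W} {B : W → Set V}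
    (hB : ∀ w, CutConn G (B w)) (hd : Pairwise fun w w' => Disjoint (B w) (B w'))
    (hadj : ∀ x y, G'.Adj x y → ∃ a ∈ B x, ∃ b ∈ B y, G.Adj a b)
    (h : K33Minor G') : K33Minor G := by
  obtain ⟨C, hc, hCd, ha⟩ := h
  refine ⟨fun r => ⋃ w ∈ C r, B w, fun r => CutConn.biUnion hB hadj (hc r), ?_, ?_⟩
  · intro r s hrs
    simp only [Set.disjoint_iUnion_left, Set.disjoint_iUnion_right]
    intro w hw w' hw'
    refine hd ?_
    rintro rfl
    exact Set.disjoint_left.1 (hCd hrs) hw' hw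
  · intro i j
    obtain ⟨x, hx, y, hy, hxy⟩ := ha i j
    obtain ⟨a, ha, b, hb, hab⟩ := hadj x y hxy
    exact ⟨a, Set.mem_biUnion hx ha, b, Set.mem_biUnion hy hb, hab⟩

/-- Removing at most two vertices leaves `G` connected. -/
def Conn3 (G : SimpleGraph V) : Prop :=
  ∀ (p q : V) (C : Set V), C.Nonempty → p ∉ C → q ∉ C →
    (∀ x ∈ C, ∀ y, G.Adj x y → y ∈ C ∨ y = p ∨ y = q) → ∀ y, y ∈ C ∨ y = p ∨ y = q

/-- There is no vertex whose removal together with `u` and `v` disconnects `G`. -/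
def NoFrag (G : SimpleGraph V) (u v : V) : Prop :=
  ∀ (w : V) (C : Set V), C.Nonempty → u ∉ C → v ∉ C → w ∉ C →
    (∀ x ∈ C, ∀ y, G.Adj x y → y ∈ C ∨ y = u ∨ y = v ∨ y = w) →
    ∀ y, y ∈ C ∨ y = u ∨ y = v ∨ y = w

theorem Conn3.exists_noFrag [Finite V] {G : SimpleGraph V} (hG : Conn3 G) {a b : V}
    (hab : G.Adj a b) : ∃ u v, G.Adj u v ∧ NoFrag G u v := by
  by_contra! hcon
  let S : Set (Set V) := {C | ∃ x y z, G.Adj x y ∧ C.Nonempty ∧ x ∉ C ∧ y ∉ C ∧ z ∉ C ∧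
    (∀ s ∈ C, ∀ t, G.Adj s t → t ∈ C ∨ t = x ∨ t = y ∨ t = z) ∧
    ∃ w, w ∉ C ∧ w ≠ x ∧ w ≠ y ∧ w ≠ z}
  have hfrag : ∀ x y, G.Adj x y → ∃ (z : V) (C : Set V), C.Nonempty ∧ x ∉ C ∧ y ∉ C ∧ z ∉ C ∧
      (∀ s ∈ C, ∀ t, G.Adj s t → t ∈ C ∨ t = x ∨ t = y ∨ t = z) ∧
      ∃ w, w ∉ C ∧ w ≠ x ∧ w ≠ y ∧ w ≠ z := by
    intro x y hxy
    have := hcon x y hxy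
    unfold NoFrag at this
    push Not at this
    exact this
  have hne : S.Nonempty := by
    obtain ⟨z, C, h⟩ := hfrag a b hab
    exact ⟨C, a, b, z, hab, h⟩
  obtain ⟨C, ⟨x, y, z, hxy, hCne, hxC, hyC, hzC, hN, w, hwC, hwx, hwy, hwz⟩, hmin⟩ :=
    (Set.toFinite S).exists_minimal hne
  obtain ⟨v, hvC, hzv⟩ : ∃ v ∈ C, G.Adj z v := by
    by_contra! hno
    rcases hG x y C hCne hxC hyC (fun s hs t hst => by
      rcases hN s hs t hst with h | h | h | rfl
      · exact Or.inl h
      · exact Or.inr (Or.inl h)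
      · exact Or.inr (Or.inr h)
      · exact absurd hst.symm (hno s hs)) w with h | h | h
    exacts [hwC h, hwx h, hwy h]
  have hzx : z ≠ x := by
    rintro rfl
    rcases hG z y C hCne hxC hyC (fun s hs t hst => by
      have := hN s hs t hst; tauto) w with h | h | h
    exacts [hwC h, hwx h, hwy h]
  have hzy : z ≠ y := by
    rintro rfl
    rcases hG x z C hCne hxC hyC (fun s hs t hst => by
      have := hN s hs t hst; tauto) w with h | h | h
    exacts [hwC h, hwx h, hwy h]
  obtain ⟨r, D, hDne, hxD, hyD, hzD, hvD, hrD, hND⟩ : ∃ (r : V) (D : Set V), D.Nonempty ∧ x ∉ D ∧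
      y ∉ D ∧ z ∉ D ∧ v ∉ D ∧ r ∉ D ∧
      ∀ s ∈ D, ∀ t, G.Adj s t → t ∈ D ∨ t = z ∨ t = v ∨ t = r := by
    obtain ⟨r, D, hD, hz, hv, hr, hN', w', hw⟩ := hfrag z v hzv
    by_cases h : x ∈ D ∨ y ∈ D
    · refine ⟨r, {t | t ∉ D ∧ t ≠ z ∧ t ≠ v ∧ t ≠ r}, ⟨w', hw⟩, ?_, ?_, by simp, by simp,
        by simp, ?_⟩
      · rintro ⟨h1, h2, h3, h4⟩
        have := hN' y (h.resolve_left h1) x hxy.symm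
        tauto
      · rintro ⟨h1, h2, h3, h4⟩
        have := hN' x (h.resolve_right h1) y hxy
        tauto
      · rintro s ⟨h1, h2, h3, h4⟩ t hst
        have := fun ht => hN' t ht s hst.symm
        simp only [Set.mem_ofPred_eq]
        tauto
    · exact ⟨r, D, hD, fun hh => h (Or.inl hh), fun hh => h (Or.inr hh), hz, hv, hr, hN'⟩
  obtain ⟨d, hdD, hvd⟩ : ∃ d ∈ D, G.Adj v d := by
    by_contra! hno
    have key := hG z r D hDne hzD hrD fun s hs t hst => by
      rcases hND s hs t hst with h | h | rfl | h
      · exact Or.inl h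
      · exact Or.inr (Or.inl h)
      · exact absurd hst.symm (hno s hs)
      · exact Or.inr (Or.inr h)
    have h1 := key x
    have h2 := key y
    have h3 := hxy.ne
    grind
  have hdC : d ∈ C := by
    rcases hN v hvC d hvd with h | rfl | rfl | rfl
    · exact h
    all_goals contradiction
  have hvx : v ≠ x := fun h => hxC (h ▸ hvC)
  have hvy : v ≠ y := fun h => hyC (h ▸ hvC)
  refine hvD (hmin (y := D ∩ C) ⟨z, v, r, hzv, ⟨d, hdD, hdC⟩, fun h => hzD h.1,
    fun h => hvD h.1, fun h => hrD h.1, ?_, ?_⟩ Set.inter_subset_right hvC).1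
  · rintro s ⟨hsD, hsC⟩ t hst
    have h1 := hN s hsC t hst
    have h2 := hND s hsD t hst
    simp only [Set.mem_inter_iff]
    grind
  · by_cases hxr : x = r
    · refine ⟨y, fun h => hyC h.2, hzy.symm, hvy.symm, fun h => hxy.ne (hxr.trans h.symm)⟩
    · exact ⟨x, fun h => hxC h.2, hzx.symm, hvx.symm, hxr⟩

/-- `π` identifies the vertices `u` and `v`, and no others. -/
structure IsMerge (π : V → W) (u v : V) : Prop where
  surj : Function.Surjective π
  eq : π u = π v
  inj : ∀ a b, π a = π b → a = b ∨ (a = u ∧ b = v) ∨ (a = v ∧ b = u)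

open Classical in
theorem exists_isMerge [Fintype V] {u v : V} (huv : u ≠ v) :
    ∃ π : V → {x // x ≠ u}, IsMerge π u v := by
  refine ⟨fun x => if h : x = u then ⟨v, huv.symm⟩ else ⟨x, h⟩, ?_, ?_, ?_⟩
  · rintro ⟨x, hx⟩
    exact ⟨x, by simp [hx]⟩
  · simp [huv.symm]
  · intro a b hab
    by_cases ha : a = u <;> by_cases hb : b = u <;> simp [ha, hb] at hab ⊢
    · exact Or.inr hab.symm
    · exact hab
    · exact hab

/-- The image of `G` under a map of vertices, without the loops. -/
def imageGraph (G : SimpleGraph V) (π : V → W) : SimpleGraph W where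
  Adj x y := x ≠ y ∧ ∃ a b, π a = x ∧ π b = y ∧ G.Adj a b
  symm := ⟨fun _ _ ⟨hne, a, b, ha, hb, h⟩ => ⟨hne.symm, b, a, hb, ha, h.symm⟩⟩
  loopless := ⟨fun _ h => h.1 rfl⟩

theorem IsMerge.fiber_cases {π : V → W} {u v : V} (h : IsMerge π u v) (w : W) :
    (∃ a, π ⁻¹' {w} = {a}) ∨ π ⁻¹' {w} = {u, v} := by
  by_cases hw : π u = w
  · right
    ext a
    simp only [Set.mem_preimage, Set.mem_singleton_iff, Set.mem_insert_iff]
    constructor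
    · intro ha
      have := h.inj a u (ha.trans hw.symm)
      tauto
    · rintro (rfl | rfl)
      · exact hw
      · exact h.eq.symm.trans hw
  · left
    obtain ⟨a, rfl⟩ := h.surj w
    refine ⟨a, ?_⟩
    ext b
    simp only [Set.mem_preimage, Set.mem_singleton_iff]
    constructor
    · intro hb
      rcases h.inj b a hb with rfl | ⟨rfl, rfl⟩ | ⟨rfl, rfl⟩
      · rfl
      · exact absurd hb hw
      · exact absurd rfl hw
    · rintro rfl
      rfl

theorem K33Minor.of_contract {G : SimpleGraph V} {π : V → W} {u v : V} (h : IsMerge π u v)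
    (huv : G.Adj u v) (hm : K33Minor (imageGraph G π)) : K33Minor G := by
  refine hm.lift (B := fun w => π ⁻¹' {w}) ?_ ?_ ?_
  · intro w
    rcases h.fiber_cases w with ⟨a, ha⟩ | h'
    · simp only [ha]
      exact CutConn.singleton G a
    · simp only [h']
      exact (CutConn.singleton G v).insert_of_adj rfl huv.symm
  · intro w w' hww
    exact Set.disjoint_left.2 fun a ha ha' => hww (ha.symm.trans ha')
  · rintro x y ⟨-, a, b, ha, hb, hab⟩
    exact ⟨a, ha, b, hb, hab⟩

theorem K33Minor.of_delete {G : SimpleGraph V} {π : V → W} {u v : V} (h : IsMerge π u v)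
    (huv : u ≠ v) (hu : ∀ x, ¬ G.Adj u x) (hm : K33Minor (imageGraph G π)) : K33Minor G := by
  refine hm.lift (B := fun w => π ⁻¹' {w} \ {u}) ?_ ?_ ?_
  · intro w
    have : ∃ a, π ⁻¹' {w} \ {u} = {a} := by
      by_cases hw : π u = w
      · refine ⟨v, ?_⟩
        ext a
        simp only [Set.mem_sdiff, Set.mem_preimage, Set.mem_singleton_iff]
        constructor
        · rintro ⟨ha, hau⟩
          have := h.inj a u (ha.trans hw.symm)
          tauto
        · rintro rfl
          exact ⟨h.eq.symm.trans hw, huv.symm⟩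
      · rcases h.fiber_cases w with ⟨a, ha⟩ | h'
        · refine ⟨a, ?_⟩
          rw [ha, sdiff_eq_left, Set.disjoint_singleton]
          rintro rfl
          exact hw (by simpa using ha.ge (Set.mem_singleton a))
        · exact absurd (by simpa using h'.ge (Set.mem_insert u _)) hw
    obtain ⟨a, ha⟩ := this
    simp only [ha]
    exact CutConn.singleton G a
  · intro w w' hww
    exact Set.disjoint_left.2 fun a ha ha' => hww (ha.1.symm.trans ha'.1)
  · rintro x y ⟨-, a, b, ha, hb, hab⟩
    refine ⟨a, ⟨ha, ?_⟩, b, ⟨hb, ?_⟩, hab⟩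
    · rintro rfl
      exact hu _ hab
    · rintro rfl
      exact hu _ hab.symm

theorem Conn3.contract {G : SimpleGraph V} (hG : Conn3 G) {π : V → W} {u v : V}
    (h : IsMerge π u v) (hf : NoFrag G u v) : Conn3 (imageGraph G π) := by
  intro p' q' C hC hp hq hN
  have hCne : (π ⁻¹' C).Nonempty := by
    obtain ⟨c, hc⟩ := hC
    obtain ⟨a, rfl⟩ := h.surj c
    exact ⟨a, hc⟩
  have hN' : ∀ x ∈ π ⁻¹' C, ∀ y, G.Adj x y → π y ∈ C ∨ π y = p' ∨ π y = q' := by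
    intro x hx y hxy
    by_cases hπ : π x = π y
    · exact Or.inl (hπ ▸ hx)
    · exact hN _ hx _ ⟨hπ, x, y, rfl, rfl, hxy⟩
  have key : ∀ w w' : W, (∀ x ∈ π ⁻¹' C, ∀ y, G.Adj x y → π y ∈ C ∨ π y = w ∨ π y = w') →
      w ∉ C → w' ∉ C → w = π u → ∀ y, y ∈ C ∨ y = w ∨ y = w' := by
    rintro w w' hN hw hw' rfl y
    obtain ⟨r, rfl⟩ := h.surj w'
    obtain ⟨y, rfl⟩ := h.surj y
    have := hf r (π ⁻¹' C) hCne hw (by simpa [h.eq] using hw) hw' (fun x hx y hxy => by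
      rcases hN x hx y hxy with hh | hh | hh
      · exact Or.inl hh
      · have := h.inj _ _ hh
        tauto
      · have := h.inj _ _ hh
        tauto) y
    have e := h.eq
    rcases this with hh | rfl | rfl | rfl
    · exact Or.inl hh
    · simp
    · simp [e]
    · simp
  by_cases hpu : p' = π u
  · exact key p' q' hN' hp hq hpu
  by_cases hqu : q' = π u
  · intro y
    have := key q' p' (fun x hx y hxy => by have := hN' x hx y hxy; tauto) hq hp hqu y
    tauto
  obtain ⟨p, rfl⟩ := h.surj p'
  obtain ⟨q, rfl⟩ := h.surj q'
  intro y
  obtain ⟨y, rfl⟩ := h.surj y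
  have e := h.eq
  have := hG p q (π ⁻¹' C) hCne hp hq (fun x hx y hxy => by
    rcases hN' x hx y hxy with hh | hh | hh
    · exact Or.inl hh
    · rcases h.inj _ _ hh with h1 | ⟨rfl, rfl⟩ | ⟨rfl, rfl⟩
      · tauto
      · exact absurd hh.symm hpu
      · exact absurd rfl hpu
    · rcases h.inj _ _ hh with h1 | ⟨rfl, rfl⟩ | ⟨rfl, rfl⟩
      · tauto
      · exact absurd hh.symm hqu
      · exact absurd rfl hqu) y
  rcases this with hh | rfl | rfl
  · exact Or.inl hh
  · simp
  · simp

theorem K33Minor.of_sets {G : SimpleGraph V} {A B : Fin 3 → Set V}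
    (hA : ∀ i, CutConn G (A i)) (hB : ∀ i, CutConn G (B i))
    (hAA : ∀ i j, i < j → Disjoint (A i) (A j)) (hBB : ∀ i j, i < j → Disjoint (B i) (B j))
    (hAB : ∀ i j, Disjoint (A i) (B j))
    (h : ∀ i j, ∃ x ∈ A i, ∃ y ∈ B j, G.Adj x y) : K33Minor G := by
  refine ⟨Sum.elim A B, ?_, ?_, h⟩
  · rintro (i | i)
    exacts [hA i, hB i]
  · rintro (i | i) (j | j) hij
    · rcases lt_or_gt_of_ne (fun h => hij (congrArg Sum.inl h) : i ≠ j) with h | h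
      exacts [hAA i j h, (hAA j i h).symm]
    · exact hAB i j
    · exact (hAB j i).symm
    · rcases lt_or_gt_of_ne (fun h => hij (congrArg Sum.inr h) : i ≠ j) with h | h
      exacts [hBB i j h, (hBB j i h).symm]

theorem NoFrag.exists_two {G : SimpleGraph V} {u v : V} (hf : NoFrag G u v) {C B : Set V} {y : V}
    (hC : C.Nonempty) (hu : u ∉ C) (hv : v ∉ C) (hCB : ∀ b ∈ B, b ∉ C)
    (hN : ∀ x ∈ C, ∀ z, G.Adj x z → z ∈ C ∨ z = u ∨ z = v ∨ z ∈ B)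
    (hyC : y ∉ C) (hyu : y ≠ u) (hyv : y ≠ v) (hyB : y ∉ B) :
    ∃ w₁ ∈ B, ∃ w₂ ∈ B, w₁ ≠ w₂ ∧ (∃ x ∈ C, G.Adj x w₁) ∧ (∃ x ∈ C, G.Adj x w₂) := by
  by_contra! hcon
  by_cases hex : ∃ b ∈ B, ∃ x ∈ C, G.Adj x b
  · obtain ⟨b, hb, hxb⟩ := hex
    have := hf b C hC hu hv (hCB b hb) (fun x hx z hz => by
      rcases hN x hx z hz with h | h | h | h
      · exact Or.inl h
      · exact Or.inr (Or.inl h)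
      · exact Or.inr (Or.inr (Or.inl h))
      · by_contra hh
        exact hcon b hb z h (fun e => hh (by simp [e])) hxb x hx hz) y
    grind
  · push Not at hex
    have := hf u C hC hu hv hu (fun x hx z hz => by
      rcases hN x hx z hz with h | h | h | h
      · exact Or.inl h
      · exact Or.inr (Or.inl h)
      · exact Or.inr (Or.inr (Or.inl h))
      · exact absurd hz (hex z h x hx)) y
    grind

theorem comp_ne_exists_adj {G : SimpleGraph V} {s : Set V} (hs : CutConn G s) {a b : V}
    (ha : a ∈ s) (hb : b ∈ s) (hab : a ≠ b) : ∃ x ∈ comp G (s \ {b}) a, G.Adj x b := by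
  have ha' : a ∈ s \ {b} := ⟨ha, hab⟩
  obtain ⟨x, hx, y, hy, hyn, hxy⟩ := hs.exists_adj (comp_subset.trans Set.sdiff_subset)
    ⟨a, mem_comp ha'⟩ hb fun h => (comp_subset h).2 rfl
  by_cases hyb : y = b
  · exact ⟨x, hx, hyb ▸ hxy⟩
  · exact absurd (mem_comp_of_adj ha' hx ⟨hy, hyb⟩ hxy) hyn

theorem exists_maximal_avoiding [Finite V] {G : SimpleGraph V} {S : Set V} {x₁ x₂ y : V}
    (hy : y ∈ S) (hl : ∃ A, A ⊆ S \ {y} ∧ CutConn G A ∧ x₁ ∈ A ∧ x₂ ∈ A) :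
    ∃ K W, K ⊆ S ∧ CutConn G K ∧ y ∈ K ∧ W ⊆ S ∧ (∀ w ∈ W, w ∉ K) ∧ CutConn G W ∧ x₁ ∈ W ∧
      x₂ ∈ W ∧
      (∀ b ∈ S, b ∉ K → ∀ k ∈ K, G.Adj k b → ∀ A ⊆ W, CutConn G A → x₁ ∈ A → x₂ ∈ A → b ∈ A) ∧
      ∀ r ∈ S, r ∉ K → r ∉ W → ∀ z ∈ K ∪ W, ¬ G.Adj r z := by
  let F : Set (Set V) := {K | K ⊆ S ∧ CutConn G K ∧ y ∈ K ∧
    ∃ A, A ⊆ S \ K ∧ CutConn G A ∧ x₁ ∈ A ∧ x₂ ∈ A}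
  have hne : F.Nonempty :=
    ⟨{y}, Set.singleton_subset_iff.2 hy, CutConn.singleton G y, rfl, hl⟩
  obtain ⟨K, ⟨hKS, hK, hyK, A, hA, hAc, h1, h2⟩, hmax⟩ := (Set.toFinite F).exists_maximal hne
  have hx : x₁ ∈ S \ K := hA h1
  have hprop : ∀ b ∈ S, b ∉ K → ∀ k ∈ K, G.Adj k b → ∀ A ⊆ comp G (S \ K) x₁, CutConn G A →
      x₁ ∈ A → x₂ ∈ A → b ∈ A := by
    intro b hb hbK k hk hkb A' hA' hA'c h1' h2'
    by_contra hbA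
    refine hbK (hmax (y := insert b K) ⟨Set.insert_subset hb hKS, hK.insert_of_adj hk hkb,
      Set.mem_insert_of_mem _ hyK, A', fun a ha => ⟨(comp_subset (hA' ha)).1, ?_⟩, hA'c, h1', h2'⟩
      (Set.subset_insert _ _) (Set.mem_insert _ _))
    rintro (rfl | h)
    · exact hbA ha
    · exact (comp_subset (hA' ha)).2 h
  have hAcomp : A ⊆ comp G (S \ K) x₁ := subset_comp hA hAc h1
  refine ⟨K, comp G (S \ K) x₁, hKS, hK, hyK, comp_subset.trans Set.sdiff_subset,
    fun w hw => (comp_subset hw).2, cutConn_comp hx, mem_comp hx, hAcomp h2, hprop, ?_⟩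
  rintro r hr hrK hrW z (hz | hz) hrz
  · exact hrW (hAcomp (hprop r hr hrK z hz hrz.symm A hAcomp hAc h1 h2))
  · exact hrW (mem_comp_of_adj hx hz ⟨hr, hrK⟩ hrz.symm)

theorem NoFrag.adj_of_unavoidable {G : SimpleGraph V} {u v : V} (hf : NoFrag G u v)
    {K W : Set V} {x₁ x₂ y : V} (hyK : y ∈ K) (hyu : y ≠ u) (hyv : y ≠ v)
    (hKW : ∀ z, z ∈ K ∨ z ∈ W ∨ z = u ∨ z = v)
    (hWu : u ∉ W) (hWv : v ∉ W) (hWK : ∀ w ∈ W, w ∉ K) (hW : CutConn G W)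
    (h1 : x₁ ∈ W) (h2 : x₂ ∈ W)
    (hun : ∀ b ∈ W, ∀ k ∈ K, G.Adj k b → ∀ A ⊆ W, CutConn G A → x₁ ∈ A → x₂ ∈ A → b ∈ A) :
    ∃ k ∈ K, G.Adj k x₁ := by
  by_contra! hno
  let B : Set V := {b | b ∈ W ∧ ∃ k ∈ K, G.Adj k b}
  have hx : x₁ ∈ W \ B := ⟨h1, fun ⟨_, k, hk, hkx⟩ => hno k hk hkx⟩
  set U := comp G (W \ B) x₁ with hU
  have hUc : CutConn G U := cutConn_comp hx
  have hxU : x₁ ∈ U := mem_comp hx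
  have hUW : U ⊆ W := comp_subset.trans Set.sdiff_subset
  have hUB : ∀ b ∈ B, b ∉ U := fun b hb h => (comp_subset h).2 hb
  obtain ⟨w₁, hw₁, w₂, hw₂, hne, ⟨a₁, ha₁, haw₁⟩, ⟨a₂, ha₂, haw₂⟩⟩ :=
    hf.exists_two (C := U) (B := B) (y := y) ⟨x₁, hxU⟩ (fun h => hWu (hUW h))
      (fun h => hWv (hUW h)) hUB (fun x hx' z hxz => by
        by_cases hzB : z ∈ B
        · simp [hzB]
        rcases hKW z with h | h | h | h
        · exact absurd ⟨hUW hx', z, h, hxz.symm⟩ fun h => hUB x h hx'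
        · exact Or.inl (mem_comp_of_adj hx hx' ⟨h, hzB⟩ hxz)
        · simp [h]
        · simp [h]) (fun h => hWK y (hUW h) hyK) hyu hyv (fun h => hWK y h.1 hyK)
  wlog hwx : w₁ ≠ x₂ generalizing w₁ w₂ a₁ a₂
  · push Not at hwx
    exact this w₂ hw₂ w₁ hw₁ hne.symm a₂ ha₂ haw₂ a₁ ha₁ haw₁ (hwx ▸ hne.symm)
  have hx2 : x₂ ∈ W \ {w₁} := ⟨h2, hwx.symm⟩
  set X := comp G (W \ {w₁}) x₂
  have hX : CutConn G X := cutConn_comp hx2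
  have hXW : X ⊆ W := comp_subset.trans Set.sdiff_subset
  have hxX : x₂ ∈ X := mem_comp hx2
  have hw₁X : w₁ ∉ X := fun h => (comp_subset h).2 rfl
  by_cases hw : w₂ ∈ X
  · obtain ⟨k, hk, hkw⟩ := hw₁.2
    rcases hun w₁ hw₁.1 k hk hkw (U ∪ X) (Set.union_subset hUW hXW)
      (hUc.union_of_adj hX ha₂ hw haw₂) (Or.inl hxU) (Or.inr hxX) with h | h
    · exact hUB w₁ hw₁ h
    · exact hw₁X h
  · obtain ⟨k, hk, hkw⟩ := hw₂.2
    obtain ⟨c, hc, hcw⟩ := comp_ne_exists_adj hW h2 hw₁.1 hwx.symm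
    rcases hun w₂ hw₂.1 k hk hkw (insert w₁ U ∪ X)
      (Set.union_subset (Set.insert_subset hw₁.1 hUW) hXW)
      ((hUc.insert_of_adj ha₁ haw₁).union_of_adj hX (Set.mem_insert _ _) hc hcw.symm)
      (Or.inl (Or.inr hxU)) (Or.inr hxX) with (h | h) | h
    · exact hne h.symm
    · exact hUB w₂ hw₂ h
    · exact hw h

theorem exists_split {G : SimpleGraph V} {W Y : Set V} {x₁ x₂ b₁ b₂ : V} (hW : CutConn G W)
    (h1 : x₁ ∈ W) (h2 : x₂ ∈ W) (hx : x₁ ≠ x₂) (hb₁ : b₁ ∈ W) (hb₂ : b₂ ∈ W) (hb : b₁ ≠ b₂)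
    (hY₁ : ∃ y ∈ Y, G.Adj y b₁) (hY₂ : ∃ y ∈ Y, G.Adj y b₂)
    (hun : ∀ b ∈ W, ∀ k ∈ Y, G.Adj k b → ∀ A ⊆ W, CutConn G A → x₁ ∈ A → x₂ ∈ A → b ∈ A) :
    ∃ X₁ X₂, X₁ ⊆ W ∧ X₂ ⊆ W ∧ Disjoint X₁ X₂ ∧ CutConn G X₁ ∧ CutConn G X₂ ∧ x₁ ∈ X₁ ∧
      x₂ ∈ X₂ ∧ (∃ y ∈ Y, ∃ x ∈ X₁, G.Adj y x) ∧ (∃ y ∈ Y, ∃ x ∈ X₂, G.Adj y x) := by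
  by_cases hcase : ∃ b c, (b = b₁ ∧ c = b₂ ∨ b = b₂ ∧ c = b₁) ∧ b ≠ x₁ ∧ b ≠ x₂
  swap
  · have hset : (b₁ = x₁ ∧ b₂ = x₂) ∨ (b₁ = x₂ ∧ b₂ = x₁) := by
      have e1 : ¬ (b₁ ≠ x₁ ∧ b₁ ≠ x₂) := fun h => hcase ⟨b₁, b₂, by simp, h⟩
      have e2 : ¬ (b₂ ≠ x₁ ∧ b₂ ≠ x₂) := fun h => hcase ⟨b₂, b₁, by simp, h⟩
      grind
    refine ⟨{x₁}, {x₂}, by simpa, by simpa, by simpa, CutConn.singleton _ _,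
      CutConn.singleton _ _, rfl, rfl, ?_⟩
    rcases hset with ⟨rfl, rfl⟩ | ⟨rfl, rfl⟩ <;> simp [hY₁, hY₂]
  obtain ⟨b, c, hbc, hbx1, hbx2⟩ := hcase
  obtain ⟨hb, hc, hne, ⟨y, hy, hyb⟩, ⟨y', hy', hyc⟩⟩ : b ∈ W ∧ c ∈ W ∧ b ≠ c ∧
      (∃ y ∈ Y, G.Adj y b) ∧ ∃ y ∈ Y, G.Adj y c := by
    rcases hbc with ⟨rfl, rfl⟩ | ⟨rfl, rfl⟩
    · exact ⟨hb₁, hb₂, hb, hY₁, hY₂⟩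
    · exact ⟨hb₂, hb₁, hb.symm, hY₂, hY₁⟩
  have m1 : x₁ ∈ W \ {b} := ⟨h1, hbx1.symm⟩
  have m2 : x₂ ∈ W \ {b} := ⟨h2, hbx2.symm⟩
  obtain ⟨c1, hc1, hcb1⟩ := comp_ne_exists_adj hW h1 hb hbx1.symm
  obtain ⟨c2, hc2, hcb2⟩ := comp_ne_exists_adj hW h2 hb hbx2.symm
  have hC1 := cutConn_comp (G := G) m1
  have hC2 := cutConn_comp (G := G) m2
  have hx1 := mem_comp (G := G) m1
  have hx2 := mem_comp (G := G) m2
  have s1 : comp G (W \ {b}) x₁ ⊆ W \ {b} := comp_subset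
  have s2 : comp G (W \ {b}) x₂ ⊆ W \ {b} := comp_subset
  have hdisj : Disjoint (comp G (W \ {b}) x₁) (comp G (W \ {b}) x₂) := by
    refine Set.disjoint_left.2 fun z hz1 hz2 => ?_
    rcases hun b hb y hy hyb _ (Set.union_subset (s1.trans Set.sdiff_subset)
      (s2.trans Set.sdiff_subset)) (hC1.union_of_mem hC2 hz1 hz2) (Or.inl hx1) (Or.inr hx2)
      with h | h
    · exact (s1 h).2 rfl
    · exact (s2 h).2 rfl
  generalize comp G (W \ {b}) x₁ = X₁ at *
  generalize comp G (W \ {b}) x₂ = X₂ at *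
  have t1 : X₁ ⊆ W := s1.trans Set.sdiff_subset
  have t2 : X₂ ⊆ W := s2.trans Set.sdiff_subset
  by_cases hcX1 : c ∈ X₁
  · refine ⟨X₁, insert b X₂, t1, Set.insert_subset hb t2, ?_, hC1, hC2.insert_of_adj hc2 hcb2, hx1,
      Set.mem_insert_of_mem _ hx2, ⟨y', hy', c, hcX1, hyc⟩, ⟨y, hy, b, Set.mem_insert _ _, hyb⟩⟩
    exact Set.disjoint_insert_right.2 ⟨fun h => (s1 h).2 rfl, hdisj⟩
  by_cases hcX2 : c ∈ X₂
  · refine ⟨insert b X₁, X₂, Set.insert_subset hb t1, t2, ?_, hC1.insert_of_adj hc1 hcb1, hC2,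
      Set.mem_insert_of_mem _ hx1, hx2, ⟨y, hy, b, Set.mem_insert _ _, hyb⟩, ⟨y', hy', c, hcX2, hyc⟩⟩
    exact Set.disjoint_insert_left.2 ⟨fun h => (s2 h).2 rfl, hdisj⟩
  rcases hun c hc y' hy' hyc (insert b X₁ ∪ X₂) (Set.union_subset (Set.insert_subset hb t1) t2)
    ((hC1.insert_of_adj hc1 hcb1).union_of_adj hC2 (Set.mem_insert _ _) hc2 hcb2.symm)
    (Or.inl (Or.inr hx1)) (Or.inr hx2) with (h | h) | h
  · exact absurd h.symm hne
  · exact absurd h hcX1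
  · exact absurd h hcX2

theorem K33Minor.of_rooted_cycle {G : SimpleGraph V} {u v x₁ x₂ y₁ y₂ : V}
    {X₁ X₂ Y₁ Y₂ : Set V} (huv : G.Adj u v) (hX₁ : CutConn G X₁) (hX₂ : CutConn G X₂)
    (hY₁ : CutConn G Y₁) (hY₂ : CutConn G Y₂)
    (hu : u ∉ X₁ ∪ X₂ ∪ (Y₁ ∪ Y₂)) (hv : v ∉ X₁ ∪ X₂ ∪ (Y₁ ∪ Y₂))
    (hX : Disjoint X₁ X₂) (hY : Disjoint Y₁ Y₂) (hXY : Disjoint (X₁ ∪ X₂) (Y₁ ∪ Y₂))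
    (hx₁ : x₁ ∈ X₁) (hx₂ : x₂ ∈ X₂) (hy₁ : y₁ ∈ Y₁) (hy₂ : y₂ ∈ Y₂)
    (hux₁ : G.Adj u x₁) (hux₂ : G.Adj u x₂) (hvy₁ : G.Adj v y₁) (hvy₂ : G.Adj v y₂)
    (h11 : ∃ y ∈ Y₁, ∃ x ∈ X₁, G.Adj y x) (h12 : ∃ y ∈ Y₁, ∃ x ∈ X₂, G.Adj y x)
    (h21 : ∃ y ∈ Y₂, ∃ x ∈ X₁, G.Adj y x) (h22 : ∃ y ∈ Y₂, ∃ x ∈ X₂, G.Adj y x) :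
    K33Minor G := by
  simp only [Set.mem_union, not_or] at hu hv
  simp only [Set.disjoint_union_left, Set.disjoint_union_right] at hXY
  have hne := huv.ne
  refine K33Minor.of_sets (A := ![{u}, Y₁, Y₂]) (B := ![{v}, X₁, X₂]) ?_ ?_ ?_ ?_ ?_ ?_
  · intro i; fin_cases i
    exacts [CutConn.singleton _ _, hY₁, hY₂]
  · intro i; fin_cases i
    exacts [CutConn.singleton _ _, hX₁, hX₂]
  · intro i j hij
    fin_cases i <;> fin_cases j <;> simp_all
  · intro i j hij
    fin_cases i <;> fin_cases j <;> simp_all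
  · intro i j
    fin_cases i <;> fin_cases j <;> simp_all [disjoint_comm]
  · intro i j
    fin_cases i <;> fin_cases j
    · exact ⟨u, rfl, v, rfl, huv⟩
    · exact ⟨u, rfl, x₁, hx₁, hux₁⟩
    · exact ⟨u, rfl, x₂, hx₂, hux₂⟩
    · exact ⟨y₁, hy₁, v, rfl, hvy₁.symm⟩
    · exact h11
    · exact h12
    · exact ⟨y₂, hy₂, v, rfl, hvy₂.symm⟩
    · exact h21
    · exact h22

theorem NoFrag.exists_linkage [Finite V] {G : SimpleGraph V} {u v : V} (hf : NoFrag G u v)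
    (huv : G.Adj u v) (hm : ¬ K33Minor G) {x₁ x₂ y₁ y₂ : V}
    (hux₁ : G.Adj u x₁) (hux₂ : G.Adj u x₂) (hvy₁ : G.Adj v y₁) (hvy₂ : G.Adj v y₂)
    (hx₁v : x₁ ≠ v) (hx₂v : x₂ ≠ v) (hy₁u : y₁ ≠ u) (hy₂u : y₂ ≠ u) (hx : x₁ ≠ x₂)
    (h11 : x₁ ≠ y₁) (h12 : x₁ ≠ y₂) (h21 : x₂ ≠ y₁) (h22 : x₂ ≠ y₂) :
    ∃ A B, CutConn G A ∧ CutConn G B ∧ x₁ ∈ A ∧ x₂ ∈ A ∧ y₁ ∈ B ∧ y₂ ∈ B ∧ Disjoint A B ∧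
      u ∉ A ∧ v ∉ A ∧ u ∉ B ∧ v ∉ B := by
  have hx₁u := hux₁.ne'
  have hx₂u := hux₂.ne'
  have hy₁v := hvy₁.ne'
  have hy₂v := hvy₂.ne'
  let H : Set V := {z | z ≠ u ∧ z ≠ v}
  have hy₁H : y₁ ∈ H := ⟨hy₁u, hy₁v⟩
  have hx₁H : x₁ ∈ H \ {y₁} := ⟨⟨hx₁u, hx₁v⟩, h11⟩
  obtain ⟨K, W, hKH, hK, hyK, hWH, hWK, hW, hx₁W, hx₂W, hun, hR⟩ :=
    exists_maximal_avoiding (G := G) (x₁ := x₁) (x₂ := x₂) hy₁H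
      ⟨comp G (H \ {y₁}) x₁, comp_subset, cutConn_comp hx₁H, mem_comp hx₁H, by
        have := hf y₁ (comp G (H \ {y₁}) x₁) ⟨x₁, mem_comp hx₁H⟩
          (fun h => (comp_subset h).1.1 rfl) (fun h => (comp_subset h).1.2 rfl)
          (fun h => (comp_subset h).2 rfl) (fun x hx' y hxy => by
            by_cases h : y ∈ H \ {y₁}
            · exact Or.inl (mem_comp_of_adj hx₁H hx' h hxy)
            · have : ¬ ((y ≠ u ∧ y ≠ v) ∧ y ≠ y₁) := h
              tauto) x₂
        tauto⟩
  have hcover : ∀ z, z ∈ K ∨ z ∈ W ∨ z = u ∨ z = v := by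
    intro z
    by_contra! hz
    have := hf u {z | z ∈ H ∧ z ∉ K ∧ z ∉ W} ⟨z, ⟨hz.2.2.1, hz.2.2.2⟩, hz.1, hz.2.1⟩
      (fun h => h.1.1 rfl) (fun h => h.1.2 rfl) (fun h => h.1.1 rfl) (fun a ha b hab => by
        by_contra! hb
        have hbH : b ∈ H := ⟨hb.2.1, hb.2.2.1⟩
        have : b ∈ K ∪ W := by
          by_contra h
          exact hb.1 ⟨hbH, fun h' => h (Or.inl h'), fun h' => h (Or.inr h')⟩
        exact hR a ha.1 ha.2.1 ha.2.2 b this hab) x₁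
    rcases this with h | h | h | h
    · exact h.2.2 hx₁W
    all_goals contradiction
  have hWu : u ∉ W := fun h => (hWH h).1 rfl
  have hWv : v ∉ W := fun h => (hWH h).2 rfl
  have hKu : u ∉ K := fun h => (hKH h).1 rfl
  have hKv : v ∉ K := fun h => (hKH h).2 rfl
  by_cases hy₂K : y₂ ∈ K
  · exact ⟨W, K, hW, hK, hx₁W, hx₂W, hyK, hy₂K, Set.disjoint_left.2 hWK, hWu, hWv, hKu, hKv⟩
  have hy₂W : y₂ ∈ W := by
    have := hcover y₂
    tauto
  have hunW : ∀ b ∈ W, ∀ k ∈ K, G.Adj k b → ∀ A ⊆ W, CutConn G A → x₁ ∈ A → x₂ ∈ A → b ∈ A :=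
    fun b hb => hun b (hWH hb) (hWK b hb)
  obtain ⟨k₁, hk₁, hkx₁⟩ := hf.adj_of_unavoidable hyK hy₁u hy₁v hcover hWu hWv hWK hW hx₁W hx₂W hunW
  obtain ⟨k₂, hk₂, hkx₂⟩ := hf.adj_of_unavoidable hyK hy₁u hy₁v hcover hWu hWv hWK hW hx₂W hx₁W
    fun b hb k hk hkb A hA hAc h h' => hunW b hb k hk hkb A hA hAc h' h
  have m1 : x₁ ∈ W \ {y₂} := ⟨hx₁W, h12⟩
  have m2 : x₂ ∈ W \ {y₂} := ⟨hx₂W, h22⟩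
  have hfinal : ∀ {X₁ X₂ Y₂ : Set V}, X₁ ⊆ W → X₂ ⊆ W → Y₂ ⊆ W → CutConn G X₁ → CutConn G X₂ →
      CutConn G Y₂ → Disjoint X₁ X₂ → Disjoint X₁ Y₂ → Disjoint X₂ Y₂ → x₁ ∈ X₁ → x₂ ∈ X₂ →
      y₂ ∈ Y₂ → (∃ y ∈ Y₂, ∃ x ∈ X₁, G.Adj y x) → (∃ y ∈ Y₂, ∃ x ∈ X₂, G.Adj y x) → False := by
    intro X₁ X₂ Y₂ s1 s2 s3 c1 c2 c3 d12 d1 d2 mx1 mx2 my a1 a2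
    have hdK : ∀ {X : Set V}, X ⊆ W → Disjoint X K := fun h =>
      Set.disjoint_left.2 fun z hz => hWK z (h hz)
    refine hm (K33Minor.of_rooted_cycle huv c1 c2 hK c3 ?_ ?_ d12 (hdK s3).symm ?_ mx1 mx2 hyK my
      hux₁ hux₂ hvy₁ hvy₂ ⟨k₁, hk₁, x₁, mx1, hkx₁⟩ ⟨k₂, hk₂, x₂, mx2, hkx₂⟩ a1 a2)
    · rintro ((h | h) | h | h)
      exacts [hWu (s1 h), hWu (s2 h), hKu h, hWu (s3 h)]
    · rintro ((h | h) | h | h)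
      exacts [hWv (s1 h), hWv (s2 h), hKv h, hWv (s3 h)]
    · simp only [Set.disjoint_union_left, Set.disjoint_union_right]
      exact ⟨⟨hdK s1, hdK s2⟩, d1, d2⟩
  by_cases hx₂X : x₂ ∈ comp G (W \ {y₂}) x₁
  swap
  · exfalso
    obtain ⟨c1, hc1, hcb1⟩ := comp_ne_exists_adj hW hx₁W hy₂W h12
    obtain ⟨c2, hc2, hcb2⟩ := comp_ne_exists_adj hW hx₂W hy₂W h22
    refine hfinal (X₁ := comp G (W \ {y₂}) x₁) (X₂ := comp G (W \ {y₂}) x₂) (Y₂ := {y₂})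
      (comp_subset.trans Set.sdiff_subset) (comp_subset.trans Set.sdiff_subset) (by simpa)
      (cutConn_comp m1) (cutConn_comp m2) (CutConn.singleton _ _) ?_ ?_ ?_ (mem_comp m1)
      (mem_comp m2) rfl ⟨y₂, rfl, c1, hc1, hcb1.symm⟩ ⟨y₂, rfl, c2, hc2, hcb2.symm⟩
    · refine Set.disjoint_left.2 fun z hz hz' => hx₂X ?_
      exact subset_comp (Set.union_subset comp_subset comp_subset)
        ((cutConn_comp m1).union_of_mem (cutConn_comp m2) hz hz') (Or.inl (mem_comp m1))
        (Or.inr (mem_comp m2))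
    · exact Set.disjoint_singleton_right.2 fun h => (comp_subset h).2 rfl
    · exact Set.disjoint_singleton_right.2 fun h => (comp_subset h).2 rfl
  obtain ⟨Y, W', hYW, hY, hy₂Y, hW'W, hW'Y, hW', hx₁W', hx₂W', hun', hR'⟩ :=
    exists_maximal_avoiding (G := G) (x₁ := x₁) (x₂ := x₂) hy₂W
      ⟨comp G (W \ {y₂}) x₁, comp_subset, cutConn_comp m1, mem_comp m1, hx₂X⟩
  by_cases hYK : ∃ y ∈ Y, ∃ k ∈ K, G.Adj y k
  · obtain ⟨y, hy, k, hk, hyk⟩ := hYK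
    refine ⟨W', Y ∪ K, hW', hY.union_of_adj hK hy hk hyk, hx₁W', hx₂W', Or.inr hyK, Or.inl hy₂Y,
      Set.disjoint_left.2 ?_, fun h => hWu (hW'W h), fun h => hWv (hW'W h), ?_, ?_⟩
    · rintro z hz (h | h)
      exacts [hW'Y z hz h, hWK z (hW'W hz) h]
    · rintro (h | h)
      exacts [hWu (hYW h), hKu h]
    · rintro (h | h)
      exacts [hWv (hYW h), hKv h]
  push Not at hYK
  exfalso
  have hcover' : ∀ z ∈ W, z ∈ Y ∨ z ∈ W' := by
    intro z hzW
    by_contra! hz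
    have := hf u {z | z ∈ W ∧ z ∉ Y ∧ z ∉ W'} ⟨z, hzW, hz.1, hz.2⟩
      (fun h => hWu h.1) (fun h => hWv h.1) (fun h => hWu h.1) (fun a ha b hab => by
        rcases hcover b with hb | hb | hb | hb
        · exact absurd (hunW a ha.1 b hb hab.symm W' hW'W hW' hx₁W' hx₂W') ha.2.2
        · left
          refine ⟨hb, fun h => ?_, fun h => ?_⟩
          · exact hR' a ha.1 ha.2.1 ha.2.2 b (Or.inl h) hab
          · exact hR' a ha.1 ha.2.1 ha.2.2 b (Or.inr h) hab
        · simp [hb]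
        · simp [hb]) x₁
    rcases this with h | h | h | h
    · exact h.2.2 hx₁W'
    all_goals contradiction
  obtain ⟨b₁, hb₁, b₂, hb₂, hb, hYb₁, hYb₂⟩ :=
    hf.exists_two (C := Y) (B := W') (y := y₁) hY.1 (fun h => hWu (hYW h)) (fun h => hWv (hYW h))
      hW'Y (fun x hx' z hxz => by
        rcases hcover z with hz | hz | hz | hz
        · exact absurd hxz (hYK x hx' z hz)
        · have := hcover' z hz
          tauto
        · simp [hz]
        · simp [hz]) (fun h => hWK y₁ (hYW h) hyK) hy₁u hy₁v (fun h => hWK y₁ (hW'W h) hyK)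
  obtain ⟨X₁, X₂, s1, s2, d12, c1, c2, mx1, mx2, a1, a2⟩ :=
    exists_split hW' hx₁W' hx₂W' hx hb₁ hb₂ hb hYb₁ hYb₂
      fun b hb => hun' b (hW'W hb) (hW'Y b hb)
  exact hfinal (s1.trans hW'W) (s2.trans hW'W) hYW c1 c2 hY d12
    (Set.disjoint_left.2 fun z hz => hW'Y z (s1 hz))
    (Set.disjoint_left.2 fun z hz => hW'Y z (s2 hz)) mx1 mx2 hy₂Y a1 a2

/-- `F` is a set of edges of `G`, as a symmetric function with values in `ZMod 2`. -/
structure EdgeChain (G : SimpleGraph V) (F : V → V → ZMod 2) : Prop where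
  symm : ∀ a b, F a b = F b a
  adj : ∀ a b, F a b ≠ 0 → G.Adj a b

/-- The boundary of a set of edges. -/
def bd [Fintype V] (F : V → V → ZMod 2) (a : V) : ZMod 2 := ∑ b, F a b

theorem EdgeChain.self {G : SimpleGraph V} {F : V → V → ZMod 2} (h : EdgeChain G F) (a : V) :
    F a a = 0 := by
  by_contra hne
  exact (h.adj a a hne).ne rfl

theorem EdgeChain.add {G : SimpleGraph V} {F F' : V → V → ZMod 2} (h : EdgeChain G F)
    (h' : EdgeChain G F') : EdgeChain G (F + F') := by
  refine ⟨fun a b => by simp [h.symm a b, h'.symm a b], fun a b hab => ?_⟩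
  by_contra hn
  refine hab ?_
  rw [Pi.add_apply, Pi.add_apply, not_not.1 (mt (h.adj a b) hn), not_not.1 (mt (h'.adj a b) hn),
    add_zero]

theorem bd_add [Fintype V] (F F' : V → V → ZMod 2) (a : V) : bd (F + F') a = bd F a + bd F' a := by
  simp [bd, Finset.sum_add_distrib]

open Classical in
/-- The single vertex `x`. -/
noncomputable def ptFn (x : V) (a : V) : ZMod 2 := if a = x then 1 else 0

theorem ptFn_self (x : V) : ptFn x x = 1 := if_pos rfl

theorem ptFn_of_ne {x a : V} (h : a ≠ x) : ptFn x a = 0 := if_neg h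

theorem eq_of_ptFn {x a : V} (h : ptFn x a ≠ 0) : a = x := by
  by_contra hne
  exact h (ptFn_of_ne hne)

/-- The single edge `xy`. -/
noncomputable def edgeFn (x y : V) (a b : V) : ZMod 2 :=
  ptFn x a * ptFn y b + ptFn y a * ptFn x b

theorem edgeFn_ne_zero {x y a b : V} (h : edgeFn x y a b ≠ 0) :
    (a = x ∧ b = y) ∨ (a = y ∧ b = x) := by
  by_cases h1 : ptFn x a * ptFn y b = 0
  · have h2 : ptFn y a * ptFn x b ≠ 0 := fun h2 => h (by rw [edgeFn, h1, h2, add_zero])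
    exact Or.inr ⟨eq_of_ptFn (left_ne_zero_of_mul h2), eq_of_ptFn (right_ne_zero_of_mul h2)⟩
  · exact Or.inl ⟨eq_of_ptFn (left_ne_zero_of_mul h1), eq_of_ptFn (right_ne_zero_of_mul h1)⟩

theorem edgeFn_chain {G : SimpleGraph V} {x y : V} (h : G.Adj x y) :
    EdgeChain G (edgeFn x y) := by
  refine ⟨fun a b => ?_, fun a b hab => ?_⟩
  · unfold edgeFn
    ring
  · rcases edgeFn_ne_zero hab with ⟨rfl, rfl⟩ | ⟨rfl, rfl⟩
    exacts [h, h.symm]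

theorem sum_ptFn [Fintype V] (x : V) : ∑ a, ptFn x a = 1 := by
  classical
  simp [ptFn]

theorem bd_edgeFn [Fintype V] (x y a : V) : bd (edgeFn x y) a = ptFn x a + ptFn y a := by
  simp only [bd, edgeFn, Finset.sum_add_distrib, ← Finset.mul_sum, sum_ptFn, mul_one]

theorem CutConn.exists_chain [Fintype V] {G : SimpleGraph V} {A : Set V} (hA : CutConn G A)
    {x y : V} (hx : x ∈ A) (hy : y ∈ A) : ∃ F, EdgeChain G F ∧
      (∀ a b, F a b ≠ 0 → a ∈ A ∧ b ∈ A) ∧ ∀ a, bd F a = ptFn x a + ptFn y a := by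
  refine (hA.2 {z | z ∈ A ∧ ∃ F, EdgeChain G F ∧ (∀ a b, F a b ≠ 0 → a ∈ A ∧ b ∈ A) ∧
    ∀ a, bd F a = ptFn x a + ptFn z a} (fun z hz => hz.1) ⟨x, hx, 0, ⟨?_, ?_⟩, ?_, ?_⟩ ?_ hy).2
  · simp
  · simp
  · simp
  · intro a
    rw [CharTwo.add_self_eq_zero]
    simp [bd]
  · rintro z ⟨hz, F, hF, hFA, hb⟩ w hw hzw
    refine ⟨hw, F + edgeFn z w, hF.add (edgeFn_chain hzw), fun a b hab => ?_, fun a => ?_⟩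
    · by_cases h : F a b = 0
      · rw [Pi.add_apply, Pi.add_apply, h, zero_add] at hab
        rcases edgeFn_ne_zero hab with ⟨rfl, rfl⟩ | ⟨rfl, rfl⟩
        exacts [⟨hz, hw⟩, ⟨hw, hz⟩]
      · exact hFA a b h
    · rw [bd_add, hb, bd_edgeFn, add_assoc, ← add_assoc (ptFn z a),
        CharTwo.add_self_eq_zero, zero_add]

/-- A symmetric combination of pairs of disjoint edges of `G` that is a cycle in each
variable: a two-dimensional cycle of the deleted product of `G`. -/
structure IsZ [Fintype V] (G : SimpleGraph V) (Z : V → V → V → V → ZMod 2) : Prop where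
  symm : ∀ a b c d, Z a b c d = Z b a c d
  swap : ∀ a b c d, Z a b c d = Z c d a b
  adj : ∀ a b c d, Z a b c d ≠ 0 → G.Adj a b
  ne : ∀ a b c d, Z a b c d ≠ 0 → a ≠ c
  sum : ∀ a b c, ∑ d, Z a b c d = 0

theorem IsZ.symm' [Fintype V] {G : SimpleGraph V} {Z : V → V → V → V → ZMod 2} (h : IsZ G Z)
    (a b c d : V) : Z a b c d = Z a b d c := by
  rw [h.swap, h.symm, h.swap]

theorem IsZ.facts [Fintype V] {G : SimpleGraph V} {Z : V → V → V → V → ZMod 2} (h : IsZ G Z)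
    {a b c d : V} (hne : Z a b c d ≠ 0) : G.Adj a b ∧ G.Adj c d ∧ a ≠ c ∧ a ≠ d ∧ b ≠ c ∧
      b ≠ d := by
  have h1 : Z b a c d ≠ 0 := by rwa [← h.symm]
  refine ⟨h.adj _ _ _ _ hne, h.adj c d a b (by rwa [← h.swap]), h.ne _ _ _ _ hne,
    h.ne a b d c (by rwa [← h.symm']), h.ne _ _ _ _ h1, h.ne b a d c (by rwa [← h.symm'])⟩

theorem IsZ.add [Fintype V] {G : SimpleGraph V} {Z Z' : V → V → V → V → ZMod 2} (h : IsZ G Z)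
    (h' : IsZ G Z') : IsZ G (Z + Z') := by
  have hor : ∀ a b c d, (Z + Z') a b c d ≠ 0 → Z a b c d ≠ 0 ∨ Z' a b c d ≠ 0 := by
    intro a b c d hne
    by_contra! hh
    exact hne (by simp [hh])
  refine ⟨fun a b c d => ?_, fun a b c d => ?_, fun a b c d hne => ?_, fun a b c d hne => ?_,
    fun a b c => ?_⟩
  · simp [h.symm a b, h'.symm a b]
  · simp [h.swap a b, h'.swap a b]
  · exact (hor a b c d hne).elim (h.adj a b c d) (h'.adj a b c d)
  · exact (hor a b c d hne).elim (h.ne a b c d) (h'.ne a b c d)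
  · simp [Finset.sum_add_distrib, h.sum, h'.sum]

/-- Indicator of a proposition. -/
noncomputable def ind (p : Prop) : ZMod 2 := by
  classical exact if p then 1 else 0

theorem ind_true {p : Prop} (h : p) : ind p = 1 := by simp [ind, h]

theorem ind_false {p : Prop} (h : ¬ p) : ind p = 0 := by simp [ind, h]

/-- The two pairs `ab` and `cd` interlace, and occur in the order `a, c, b, d`. -/
noncomputable def cross (pos : V → ℕ) (a b c d : V) : ZMod 2 :=
  ind (pos a < pos c ∧ pos c < pos b ∧ pos b < pos d)

/-- The number of interlacing pairs of edges in `Z`. -/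
noncomputable def cr [Fintype V] (pos : V → ℕ) (Z : V → V → V → V → ZMod 2) : ZMod 2 :=
  ∑ a, ∑ b, ∑ c, ∑ d, cross pos a b c d * Z a b c d

theorem cr_add [Fintype V] (pos : V → ℕ) (Z Z' : V → V → V → V → ZMod 2) :
    cr pos (Z + Z') = cr pos Z + cr pos Z' := by
  simp [cr, mul_add, Finset.sum_add_distrib]

theorem sum_rotate [Fintype V] (f : V → V → V → ZMod 2) :
    ∑ x, ∑ p, ∑ q, f x p q = ∑ p, ∑ q, ∑ x, f x p q := by
  rw [Finset.sum_comm]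
  exact Finset.sum_congr rfl fun _ _ => Finset.sum_comm

theorem sum_swap_pairs [Fintype V] (f : V → V → V → V → ZMod 2) :
    ∑ a, ∑ b, ∑ c, ∑ d, f a b c d = ∑ c, ∑ d, ∑ a, ∑ b, f a b c d := by
  have h1 : ∀ g : V → V → ZMod 2, ∑ a, ∑ b, g a b = ∑ x : V × V, g x.1 x.2 :=
    fun g => (Fintype.sum_prod_type' g).symm
  simp only [h1]
  rw [Finset.sum_comm]

theorem IsZ.cr_eq_split [Fintype V] {G : SimpleGraph V} {Z : V → V → V → V → ZMod 2} (h : IsZ G Z)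
    {pos : V → ℕ} (hpos : ∀ a b c d, Z a b c d ≠ 0 → pos a ≠ pos c) (u : V) :
    cr pos Z = (∑ a, ∑ b, ∑ c, ∑ d, ind (a ≠ u ∧ b ≠ u ∧ c ≠ u ∧ d ≠ u) *
        (cross pos a b c d * Z a b c d)) +
      ∑ p, ∑ q, ∑ x, ind (pos p < pos x ∧ pos x < pos q) * Z p q u x := by
  classical
  have hpos' : ∀ {a b c d}, Z a b c d ≠ 0 →
      pos a ≠ pos c ∧ pos a ≠ pos d ∧ pos b ≠ pos c ∧ pos b ≠ pos d := by
    intro a b c d hne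
    have h1 : Z b a c d ≠ 0 := by rwa [← h.symm]
    exact ⟨hpos _ _ _ _ hne, hpos a b d c (by rwa [← h.symm']), hpos _ _ _ _ h1,
      hpos b a d c (by rwa [← h.symm'])⟩
  have hpt : ∀ a b c d, cross pos a b c d * Z a b c d =
      ind (a ≠ u ∧ b ≠ u ∧ c ≠ u ∧ d ≠ u) * (cross pos a b c d * Z a b c d) +
      ((if u = a then cross pos a b c d * Z a b c d else 0) +
      (if u = b then cross pos a b c d * Z a b c d else 0) +
      (if u = c then cross pos a b c d * Z a b c d else 0) +
      (if u = d then cross pos a b c d * Z a b c d else 0)) := by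
    intro a b c d
    by_cases hZ : Z a b c d = 0
    · simp [hZ]
    obtain ⟨h1, h2, h3, h4, h5, h6⟩ := h.facts hZ
    have h1 := h1.ne
    have h2 := h2.ne
    by_cases ha : u = a
    · subst ha
      simp [ind, h1, h3, h4]
    by_cases hb : u = b
    · subst hb
      simp [ind, h1, h5, h6, ha]
    by_cases hc : u = c
    · subst hc
      simp [ind, h2, h3.symm, h5.symm]
    by_cases hd : u = d
    · subst hd
      simp [ind, h2.symm, h4.symm, h6.symm]
    simp [ind, ha, hb, hc, hd, Ne.symm ha, Ne.symm hb, Ne.symm hc, Ne.symm hd]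
  have hstep : cr pos Z = (∑ a, ∑ b, ∑ c, ∑ d, ind (a ≠ u ∧ b ≠ u ∧ c ≠ u ∧ d ≠ u) *
        (cross pos a b c d * Z a b c d)) +
      ((∑ x, ∑ p, ∑ q, cross pos u x p q * Z u x p q) +
      (∑ x, ∑ p, ∑ q, cross pos x u p q * Z x u p q) +
      (∑ p, ∑ q, ∑ x, cross pos p q u x * Z p q u x) +
      (∑ p, ∑ q, ∑ x, cross pos p q x u * Z p q x u)) := by
    rw [cr]
    refine (Finset.sum_congr rfl fun a _ => Finset.sum_congr rfl fun b _ =>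
      Finset.sum_congr rfl fun c _ => Finset.sum_congr rfl fun d _ => hpt a b c d).trans ?_
    simp only [Finset.sum_add_distrib]
    congr 1
    congr 1
    congr 1
    congr 1
    · simp only [Finset.sum_ite_irrel, Finset.sum_const_zero]
      simp
    · simp only [Finset.sum_ite_irrel, Finset.sum_const_zero]
      simp
    · simp only [Finset.sum_ite_irrel, Finset.sum_const_zero]
      simp
    · simp
  rw [hstep, sum_rotate fun x p q => cross pos u x p q * Z u x p q,
    sum_rotate fun x p q => cross pos x u p q * Z x u p q]
  congr 1
  have hrow : ∑ p, ∑ q, ∑ x, ind (pos p < pos q ∧ pos p < pos u ∧ pos u < pos q) * Z p q u x =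
      0 := by
    simp [← Finset.mul_sum, h.sum]
  rw [← add_zero (∑ p, ∑ q, ∑ x, ind _ * _), ← hrow]
  simp only [← Finset.sum_add_distrib]
  refine Finset.sum_congr rfl fun p _ => Finset.sum_congr rfl fun q _ =>
    Finset.sum_congr rfl fun x _ => ?_
  rw [h.symm x u p q, h.swap u x p q, h.symm' p q x u]
  by_cases hZ : Z p q u x = 0
  · simp [hZ]
  obtain ⟨h1, h2, h3, h4⟩ := hpos' hZ
  rw [← add_mul, ← add_mul, ← add_mul, ← add_mul]
  congr 1
  unfold cross ind
  have h2z : (1 : ZMod 2) + 1 = 0 := rfl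
  split_ifs <;> first | omega | simp [h2z]

theorem IsZ.cr_congr [Fintype V] {G : SimpleGraph V} {Z : V → V → V → V → ZMod 2} (h : IsZ G Z)
    {pos pos' : V → ℕ} (hpos : ∀ a b c d, Z a b c d ≠ 0 → pos a ≠ pos c)
    (hpos' : ∀ a b c d, Z a b c d ≠ 0 → pos' a ≠ pos' c) {u : V}
    (hu : ∀ x, x ≠ u → pos x = pos' x) : cr pos Z = cr pos' Z := by
  rw [h.cr_eq_split hpos u, h.cr_eq_split hpos' u]
  congr 1
  · refine Finset.sum_congr rfl fun a _ => Finset.sum_congr rfl fun b _ =>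
      Finset.sum_congr rfl fun c _ => Finset.sum_congr rfl fun d _ => ?_
    by_cases hh : a ≠ u ∧ b ≠ u ∧ c ≠ u ∧ d ≠ u
    · obtain ⟨ha, hb, hc, hd⟩ := hh
      simp [cross, hu a ha, hu b hb, hu c hc, hu d hd]
    · simp [ind_false hh]
  · refine Finset.sum_congr rfl fun p _ => Finset.sum_congr rfl fun q _ =>
      Finset.sum_congr rfl fun x _ => ?_
    by_cases hZ : Z p q u x = 0
    · simp [hZ]
    obtain ⟨h1, h2, h3, h4, h5, h6⟩ := h.facts hZ
    rw [hu p h3, hu q h5, hu x h2.ne']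

theorem sum_symmetrize [Fintype V] {pos : V → ℕ} (hpos : Function.Injective pos)
    (g : V → V → ZMod 2) (hg : ∀ a, g a a = 0) :
    ∑ a, ∑ b, g a b = ∑ a, ∑ b, ind (pos a < pos b) * (g a b + g b a) := by
  have : ∑ a, ∑ b, ind (pos a < pos b) * g b a = ∑ a, ∑ b, ind (pos b < pos a) * g a b :=
    Finset.sum_comm
  simp only [mul_add, Finset.sum_add_distrib]
  rw [this]
  simp only [← Finset.sum_add_distrib]
  refine Finset.sum_congr rfl fun a _ => Finset.sum_congr rfl fun b _ => ?_
  rcases lt_trichotomy (pos a) (pos b) with h | h | h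
  · simp [ind, h, h.not_gt]
  · rw [hpos h]
    simp [hg]
  · simp [ind, h, h.not_gt]

/-- The symmetrized product of two sets of edges. -/
def torus (F F' : V → V → ZMod 2) (a b c d : V) : ZMod 2 := F a b * F' c d + F' a b * F c d

theorem cr_torus [Fintype V] {G : SimpleGraph V} {F F' : V → V → ZMod 2} (hF : EdgeChain G F)
    (hF' : EdgeChain G F') (hd : ∀ a b c, F a b ≠ 0 → F' a c = 0) {pos : V → ℕ}
    (hpos : Function.Injective pos) :
    cr pos (torus F F') = ∑ a, ∑ c, ind (pos a < pos c) * (bd F a * bd F' c) := by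
  have hR : ∑ a, ∑ c, ind (pos a < pos c) * (bd F a * bd F' c) =
      ∑ a, ∑ b, ∑ c, ∑ d, F a b * F' c d * ind (pos a < pos c) := by
    refine Finset.sum_congr rfl fun a _ => ?_
    rw [Finset.sum_comm]
    refine Finset.sum_congr rfl fun c _ => ?_
    rw [bd, bd, Finset.sum_mul_sum, Finset.mul_sum]
    refine Finset.sum_congr rfl fun b _ => ?_
    rw [Finset.mul_sum]
    refine Finset.sum_congr rfl fun d _ => ?_
    ring
  have hL : cr pos (torus F F') = ∑ a, ∑ b, ∑ c, ∑ d,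
      F a b * F' c d * (cross pos a b c d + cross pos c d a b) := by
    have hs := sum_swap_pairs fun a b c d => cross pos a b c d * (F' a b * F c d)
    simp only [cr, torus, mul_add, Finset.sum_add_distrib, hs]
    congr 1 <;>
    refine Finset.sum_congr rfl fun a _ => Finset.sum_congr rfl fun b _ =>
      Finset.sum_congr rfl fun c _ => Finset.sum_congr rfl fun d _ => ?_
    · ring
    · ring
  rw [hR, hL]
  have hin : ∀ a b, ∑ c, ∑ d, F a b * F' c d * ind (pos a < pos c) = ∑ c, ∑ d,
      ind (pos c < pos d) * (F a b * F' c d * (ind (pos a < pos c) + ind (pos a < pos d))) := by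
    intro a b
    rw [sum_symmetrize hpos _ fun c => by simp [hF'.self]]
    refine Finset.sum_congr rfl fun c _ => Finset.sum_congr rfl fun d _ => ?_
    rw [hF'.symm d c]
    ring
  simp only [hin]
  conv_rhs => rw [sum_symmetrize hpos _ fun a => by simp [hF.self]]
  refine Finset.sum_congr rfl fun a _ => Finset.sum_congr rfl fun b _ => ?_
  rw [← Finset.sum_add_distrib, Finset.mul_sum]
  refine Finset.sum_congr rfl fun c _ => ?_
  rw [← Finset.sum_add_distrib, Finset.mul_sum]
  refine Finset.sum_congr rfl fun d _ => ?_
  rw [hF.symm b a]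
  by_cases h1 : F a b = 0
  · simp [h1]
  by_cases h2 : F' c d = 0
  · simp [h2]
  have hb : F b a ≠ 0 := by rwa [hF.symm]
  have hc : F' d c ≠ 0 := by rwa [hF'.symm]
  have p1 : pos a ≠ pos c := fun h => h2 (hpos h ▸ hd a b d h1)
  have p2 : pos a ≠ pos d := fun h => hc (hpos h ▸ hd a b c h1)
  have p3 : pos b ≠ pos c := fun h => h2 (hpos h ▸ hd b a d hb)
  have p4 : pos b ≠ pos d := fun h => hc (hpos h ▸ hd b a c hb)
  have key : cross pos a b c d + cross pos c d a b = ind (pos a < pos b) * (ind (pos c < pos d) *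
      (ind (pos a < pos c) + ind (pos a < pos d) + (ind (pos b < pos c) + ind (pos b < pos d)))) := by
    unfold cross ind
    have h2z : (1 : ZMod 2) + 1 = 0 := rfl
    split_ifs <;> first | omega | simp [h2z]
  rw [key]
  ring

theorem isZ_torus [Fintype V] {G : SimpleGraph V} {F F' : V → V → ZMod 2} (hF : EdgeChain G F)
    (hF' : EdgeChain G F') (hd : ∀ a b c, F a b ≠ 0 → F' a c = 0) (hb : ∀ a, bd F a = 0)
    (hb' : ∀ a, bd F' a = 0) : IsZ G (torus F F') := by
  have hor : ∀ a b c d, torus F F' a b c d ≠ 0 →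
      (F a b ≠ 0 ∧ F' c d ≠ 0) ∨ (F' a b ≠ 0 ∧ F c d ≠ 0) := by
    intro a b c d h
    by_contra! hh
    refine h ?_
    unfold torus
    by_cases h1 : F a b = 0 <;> by_cases h2 : F' a b = 0 <;> simp_all
  refine ⟨fun a b c d => ?_, fun a b c d => ?_, fun a b c d hne => ?_, fun a b c d hne => ?_,
    fun a b c => ?_⟩
  · simp [torus, hF.symm a b, hF'.symm a b]
  · simp only [torus]
    ring
  · exact (hor a b c d hne).elim (fun h => hF.adj a b h.1) (fun h => hF'.adj a b h.1)
  · rintro rfl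
    rcases hor a b a d hne with h | h
    · exact h.2 (hd _ _ _ h.1)
    · exact h.1 (hd _ _ _ h.2)
  · simp only [torus, Finset.sum_add_distrib, ← Finset.mul_sum]
    have h1 := hb c
    have h2 := hb' c
    unfold bd at h1 h2
    simp [h1, h2]

theorem sum_quad [Fintype V] (f : V → V → V → V → ZMod 2) :
    ∑ a, ∑ b, ∑ c, ∑ d, f a b c d = ∑ q : V × V × V × V, f q.1 q.2.1 q.2.2.1 q.2.2.2 := by
  simp only [Fintype.sum_prod_type]

open Classical in
/-- The image of `Z` under a map of vertices. -/
noncomputable def push [Fintype V] (π : V → W) (Z : V → V → V → V → ZMod 2) (a b c d : W) :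
    ZMod 2 :=
  ∑ q : V × V × V × V,
    if (a, b, c, d) = (π q.1, π q.2.1, π q.2.2.1, π q.2.2.2) then Z q.1 q.2.1 q.2.2.1 q.2.2.2 else 0

theorem cr_push [Fintype V] [Fintype W] (π : V → W) (Z : V → V → V → V → ZMod 2) (pos : W → ℕ) :
    cr pos (push π Z) = cr (pos ∘ π) Z := by
  classical
  rw [cr, cr, sum_quad, sum_quad]
  simp only [push, Finset.mul_sum]
  rw [Finset.sum_comm]
  refine Finset.sum_congr rfl fun q _ => ?_
  rw [Finset.sum_eq_single (π q.1, π q.2.1, π q.2.2.1, π q.2.2.2)]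
  · simp [cross]
  · intro b _ hb
    rw [if_neg hb, mul_zero]
  · simp

theorem push_ne_zero [Fintype V] {π : V → W} {Z : V → V → V → V → ZMod 2} {a b c d : W}
    (h : push π Z a b c d ≠ 0) : ∃ a' b' c' d', Z a' b' c' d' ≠ 0 ∧ a = π a' ∧ b = π b' ∧
      c = π c' ∧ d = π d' := by
  obtain ⟨q, -, hq⟩ := Finset.exists_ne_zero_of_sum_ne_zero h
  split_ifs at hq with hh
  · simp only [Prod.mk.injEq] at hh
    exact ⟨_, _, _, _, hq, hh⟩
  · exact absurd rfl hq

theorem IsZ.push [Fintype V] [Fintype W] {G : SimpleGraph V} {Z : V → V → V → V → ZMod 2}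
    (h : IsZ G Z) {π : V → W} {u v : V} (hπ : IsMerge π u v) (hM : ∀ x y, Z u x v y = 0) :
    IsZ (imageGraph G π) (push π Z) := by
  classical
  refine ⟨fun a b c d => ?_, fun a b c d => ?_, fun a b c d hne => ?_, fun a b c d hne => ?_,
    fun a b c => ?_⟩
  · refine Fintype.sum_equiv
      ⟨fun q => (q.2.1, q.1, q.2.2), fun q => (q.2.1, q.1, q.2.2), fun _ => rfl, fun _ => rfl⟩
      _ _ fun q => ?_
    simp only [Equiv.coe_fn_mk, Prod.mk.injEq, h.symm q.2.1 q.1]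
    congr 1
    apply propext
    tauto
  · refine Fintype.sum_equiv
      ⟨fun q => (q.2.2.1, q.2.2.2, q.1, q.2.1), fun q => (q.2.2.1, q.2.2.2, q.1, q.2.1),
        fun _ => rfl, fun _ => rfl⟩ _ _ fun q => ?_
    simp only [Equiv.coe_fn_mk, Prod.mk.injEq, h.swap q.2.2.1 q.2.2.2]
    congr 1
    apply propext
    tauto
  · have hab : a ≠ b := by
      rintro rfl
      refine hne (Finset.sum_involution (fun q _ => (q.2.1, q.1, q.2.2)) ?_ ?_ ?_ ?_)
      · intro q _
        have : ((a, a, c, d) = (π q.2.1, π q.1, π q.2.2.1, π q.2.2.2)) =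
            ((a, a, c, d) = (π q.1, π q.2.1, π q.2.2.1, π q.2.2.2)) := by
          simp only [Prod.mk.injEq]
          apply propext
          tauto
        simp only [this, h.symm q.2.1 q.1]
        exact CharTwo.add_self_eq_zero _
      · intro q _ hq heq
        split_ifs at hq with hh
        · exact (h.adj _ _ _ _ hq).ne (congrArg Prod.fst heq).symm
        · exact hq rfl
      · simp
      · simp
    obtain ⟨a', b', c', d', hZ, rfl, rfl, rfl, rfl⟩ := push_ne_zero hne
    exact ⟨hab, a', b', rfl, rfl, h.adj _ _ _ _ hZ⟩
  · obtain ⟨a', b', c', d', hZ, rfl, rfl, rfl, rfl⟩ := push_ne_zero hne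
    intro hac
    rcases hπ.inj _ _ hac with rfl | ⟨rfl, rfl⟩ | ⟨rfl, rfl⟩
    · exact h.ne _ _ _ _ hZ rfl
    · exact hZ (hM _ _)
    · exact hZ (by rw [h.swap, hM])
  · simp only [K33Scheme.push]
    rw [Finset.sum_comm]
    have : ∀ q : V × V × V × V, (∑ d, if (a, b, c, d) = (π q.1, π q.2.1, π q.2.2.1, π q.2.2.2) then
        Z q.1 q.2.1 q.2.2.1 q.2.2.2 else 0) =
        ind ((a, b, c) = (π q.1, π q.2.1, π q.2.2.1)) * Z q.1 q.2.1 q.2.2.1 q.2.2.2 := by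
      intro q
      rw [Finset.sum_eq_single (π q.2.2.2)]
      · simp [ind]
      · intro d _ hd
        rw [if_neg]
        simp [hd]
      · simp
    simp only [this]
    rw [← sum_quad fun x y z w => ind ((a, b, c) = (π x, π y, π z)) * Z x y z w]
    simp [← Finset.mul_sum, h.sum]

theorem IsZ.exists_ne [Fintype V] {G : SimpleGraph V} {Z : V → V → V → V → ZMod 2} (h : IsZ G Z)
    {a b c d : V} (hne : Z a b c d ≠ 0) : ∃ e, e ≠ d ∧ Z a b c e ≠ 0 := by
  classical
  by_contra! hcon
  have := h.sum a b c
  rw [Finset.sum_eq_single d (fun e _ he => hcon e he) (by simp)] at this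
  exact hne this

theorem IsZ.exists_fifth [Fintype V] {G : SimpleGraph V} {Z : V → V → V → V → ZMod 2} (h : IsZ G Z)
    {a b c d : V} (hne : Z a b c d ≠ 0) : ∃ e, [a, b, c, d, e].Nodup ∧ Z a b c e ≠ 0 := by
  obtain ⟨e, hed, hZ⟩ := h.exists_ne hne
  obtain ⟨h1, h2, h3, h4, h5, h6⟩ := h.facts hne
  obtain ⟨k1, k2, k3, k4, k5, k6⟩ := h.facts hZ
  refine ⟨e, ?_, hZ⟩
  have := h1.ne
  have := h2.ne
  have := k2.ne
  simp only [List.nodup_cons, List.mem_cons, List.not_mem_nil, not_or, or_false]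
  simp_all [Ne.symm hed]

theorem IsZ.complete_of_card_le [Fintype V] {G : SimpleGraph V} {Z : V → V → V → V → ZMod 2}
    (h : IsZ G Z) {a b c d : V} (hne : Z a b c d ≠ 0) (hV : Fintype.card V ≤ 5) :
    Fintype.card V = 5 ∧ ∀ x y, x ≠ y → G.Adj x y := by
  classical
  have hfive : ∀ {a b c d e : V}, [a, b, c, d, e].Nodup → Fintype.card V = 5 ∧
      ∀ x, x = a ∨ x = b ∨ x = c ∨ x = d ∨ x = e := by
    intro a b c d e hnd
    have hcard := List.toFinset_card_of_nodup hnd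
    have hle := Finset.card_le_univ [a, b, c, d, e].toFinset
    have huniv : [a, b, c, d, e].toFinset = Finset.univ := by
      apply Finset.eq_univ_of_card
      simp only [List.length_cons, List.length_nil] at hcard
      omega
    refine ⟨by simp only [List.length_cons, List.length_nil] at hcard; omega, fun x => ?_⟩
    have := huniv ▸ Finset.mem_univ x
    simpa using this
  have hrule : ∀ {a b c d e : V}, Z a b c d ≠ 0 → [a, b, c, d, e].Nodup → Z a b c e ≠ 0 := by
    intro a b c d e hZ hnd
    obtain ⟨f, hf, hZf⟩ := h.exists_fifth hZ
    have h1 := (hfive hnd).2 f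
    have : f = e := by
      simp only [List.nodup_cons, List.mem_cons, List.not_mem_nil, not_or, or_false] at hf
      grind
    exact this ▸ hZf
  obtain ⟨e, hnd, hZe⟩ := h.exists_fifth hne
  obtain ⟨hc, hall⟩ := hfive hnd
  refine ⟨hc, ?_⟩
  have hnd' := hnd
  simp only [List.nodup_cons, List.mem_cons, List.not_mem_nil, not_or, or_false] at hnd'
  obtain ⟨⟨h1, h2, h3, h4⟩, ⟨h5, h6, h7⟩, ⟨h8, h9⟩, h10, -⟩ := hnd'
  have nd : ∀ {p q r s t : V}, p ≠ q → p ≠ r → p ≠ s → p ≠ t → q ≠ r → q ≠ s → q ≠ t → r ≠ s →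
      r ≠ t → s ≠ t → [p, q, r, s, t].Nodup := by
    intros
    simp_all
  have Zab_ec : Z a b e c ≠ 0 := by rwa [← h.symm']
  have Zab_ed : Z a b e d ≠ 0 := hrule Zab_ec (nd h1 h4 h2 h3 h7 h5 h6 (Ne.symm h9) (Ne.symm h10) h8)
  have Zce_ab : Z c e a b ≠ 0 := by rwa [← h.swap]
  have Zce_ad : Z c e a d ≠ 0 := hrule Zce_ab
    (nd h9 (Ne.symm h2) (Ne.symm h5) h8 (Ne.symm h4) (Ne.symm h7) (Ne.symm h10) h1 h3 h6)
  have Zce_ba : Z c e b a ≠ 0 := by rwa [← h.symm']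
  have Zce_bd : Z c e b d ≠ 0 := hrule Zce_ba
    (nd h9 (Ne.symm h5) (Ne.symm h2) h8 (Ne.symm h7) (Ne.symm h4) (Ne.symm h10) (Ne.symm h1) h6 h3)
  have Zcd_ab : Z c d a b ≠ 0 := by rwa [← h.swap]
  have Zcd_ae : Z c d a e ≠ 0 := hrule Zcd_ab
    (nd h8 (Ne.symm h2) (Ne.symm h5) h9 (Ne.symm h3) (Ne.symm h6) h10 h1 h4 h7)
  have Zcd_ba : Z c d b a ≠ 0 := by rwa [← h.symm']
  have Zcd_be : Z c d b e ≠ 0 := hrule Zcd_ba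
    (nd h8 (Ne.symm h5) (Ne.symm h2) h9 (Ne.symm h6) (Ne.symm h3) h10 (Ne.symm h1) h7 h4)
  have Zed_ab : Z e d a b ≠ 0 := by rwa [← h.swap]
  have Zed_ac : Z e d a c ≠ 0 := hrule Zed_ab
    (nd (Ne.symm h10) (Ne.symm h4) (Ne.symm h7) (Ne.symm h9) (Ne.symm h3) (Ne.symm h6) (Ne.symm h8)
      h1 h2 h5)
  have Zed_ba : Z e d b a ≠ 0 := by rwa [← h.symm']
  have Zed_bc : Z e d b c ≠ 0 := hrule Zed_ba
    (nd (Ne.symm h10) (Ne.symm h7) (Ne.symm h4) (Ne.symm h9) (Ne.symm h6) (Ne.symm h3) (Ne.symm h8)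
      (Ne.symm h1) h5 h2)
  have e1 := (h.facts hne).1
  have e2 := (h.facts hne).2.1
  have e3 := (h.facts hZe).2.1
  have e4 := (h.facts Zab_ed).2.1
  have e5 := (h.facts Zce_ad).2.1
  have e6 := (h.facts Zce_bd).2.1
  have e7 := (h.facts Zcd_ae).2.1
  have e8 := (h.facts Zcd_be).2.1
  have e9 := (h.facts Zed_ac).2.1
  have e10 := (h.facts Zed_bc).2.1
  intro x y hxy
  rcases hall x with rfl | rfl | rfl | rfl | rfl <;> rcases hall y with rfl | rfl | rfl | rfl | rfl <;>
    first | exact absurd rfl hxy | assumption | (apply SimpleGraph.Adj.symm; assumption)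

theorem NoFrag.exists_torus [Fintype V] {G : SimpleGraph V} {u v : V} (hf : NoFrag G u v)
    (huv : G.Adj u v) (hm : ¬ K33Minor G) {x₁ x₂ y₁ y₂ : V}
    (hux₁ : G.Adj u x₁) (hux₂ : G.Adj u x₂) (hvy₁ : G.Adj v y₁) (hvy₂ : G.Adj v y₂)
    (hx₁v : x₁ ≠ v) (hx₂v : x₂ ≠ v) (hy₁u : y₁ ≠ u) (hy₂u : y₂ ≠ u) (hx : x₁ ≠ x₂)
    (h11 : x₁ ≠ y₁) (h12 : x₁ ≠ y₂) (h21 : x₂ ≠ y₁) (h22 : x₂ ≠ y₂) :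
    ∃ T, IsZ G T ∧ (∀ pos : V → ℕ, Function.Injective pos → cr pos T = 0) ∧
      ∀ x y, T u x v y = (ptFn x₁ x + ptFn x₂ x) * (ptFn y₁ y + ptFn y₂ y) := by
  obtain ⟨A, B, hA, hB, m1, m2, m3, m4, hd, huA, hvA, huB, hvB⟩ := hf.exists_linkage huv hm hux₁ hux₂
    hvy₁ hvy₂ hx₁v hx₂v hy₁u hy₂u hx h11 h12 h21 h22
  have loop : ∀ {A : Set V} {u x₁ x₂ : V}, CutConn G A → x₁ ∈ A → x₂ ∈ A → u ∉ A → G.Adj u x₁ →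
      G.Adj u x₂ → ∃ F, EdgeChain G F ∧ (∀ a b, F a b ≠ 0 → a ∈ A ∨ a = u) ∧ (∀ a, bd F a = 0) ∧
      ∀ x, F u x = ptFn x₁ x + ptFn x₂ x := by
    intro A u x₁ x₂ hA h1 h2 hu e1 e2
    obtain ⟨F, hF, hFA, hb⟩ := hA.exists_chain h1 h2
    refine ⟨F + (edgeFn u x₁ + edgeFn u x₂), hF.add ((edgeFn_chain e1).add (edgeFn_chain e2)),
      fun a b hab => ?_, fun a => ?_, fun x => ?_⟩
    · by_contra! hcon
      have z1 : F a b = 0 := by_contra fun h => hcon.1 (hFA a b h).1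
      have z2 : edgeFn u x₁ a b = 0 := by
        by_contra h
        rcases edgeFn_ne_zero h with h | h
        · exact hcon.2 h.1
        · exact hcon.1 (h.1 ▸ h1)
      have z3 : edgeFn u x₂ a b = 0 := by
        by_contra h
        rcases edgeFn_ne_zero h with h | h
        · exact hcon.2 h.1
        · exact hcon.1 (h.1 ▸ h2)
      exact hab (by simp [z1, z2, z3])
    · rw [bd_add, bd_add, bd_edgeFn, bd_edgeFn, hb]
      linear_combination (ptFn x₁ a + ptFn x₂ a + ptFn u a) * (CharTwo.two_eq_zero : (2 : ZMod 2) = 0)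
    · have z1 : F u x = 0 := by_contra fun h => hu (hFA u x h).1
      simp [z1, edgeFn, ptFn_self, ptFn_of_ne e1.ne, ptFn_of_ne e2.ne]
  obtain ⟨F, hF, hFA, hFb, hFu⟩ := loop hA m1 m2 huA hux₁ hux₂
  obtain ⟨F', hF', hFB, hFb', hFv⟩ := loop hB m3 m4 hvB hvy₁ hvy₂
  have hdisj : ∀ a b c, F a b ≠ 0 → F' a c = 0 := by
    intro a b c h1
    by_contra h2
    rcases hFA a b h1 with h | rfl <;> rcases hFB a c h2 with h' | h'
    · exact Set.disjoint_left.1 hd h h'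
    · exact hvA (h' ▸ h)
    · exact huB h'
    · exact huv.ne h'
  refine ⟨torus F F', isZ_torus hF hF' hdisj hFb hFb', fun pos hpos => ?_, fun x y => ?_⟩
  · rw [cr_torus hF hF' hdisj hpos]
    simp [hFb]
  · have : F' u x = 0 := by
      by_contra h
      rcases hFB u x h with h | h
      exacts [huB h, huv.ne h]
    simp [torus, this, hFu, hFv]

/-- The number of pairs `x, y` such that `ux` and `vy` occur together in `Z`. -/
noncomputable def weight [Fintype V] (u v : V) (Z : V → V → V → V → ZMod 2) : ℕ :=
  {p : V × V | Z u p.1 v p.2 ≠ 0}.ncard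

/-- `Z` is a cycle with nonzero crossing number, of least weight at `u, v`. -/
structure IsMin [Fintype V] (G : SimpleGraph V) (pos : V → ℕ) (u v : V)
    (Z : V → V → V → V → ZMod 2) : Prop where
  isZ : IsZ G Z
  cr_ne : cr pos Z ≠ 0
  le : ∀ Z', IsZ G Z' → cr pos Z' ≠ 0 → weight u v Z ≤ weight u v Z'

theorem IsZ.exists_isMin [Fintype V] {G : SimpleGraph V} {Z : V → V → V → V → ZMod 2}
    (h : IsZ G Z) {pos : V → ℕ} (hcr : cr pos Z ≠ 0) (u v : V) : ∃ Z', IsMin G pos u v Z' := by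
  obtain ⟨Z', ⟨h1, h2⟩, h3⟩ := Set.exists_min_image {Z' | IsZ G Z' ∧ cr pos Z' ≠ 0} (weight u v)
    (Set.toFinite _) ⟨Z, h, hcr⟩
  exact ⟨Z', h1, h2, fun Z'' h h' => h3 Z'' ⟨h, h'⟩⟩

theorem IsZ.weight_comm [Fintype V] {G : SimpleGraph V} {Z : V → V → V → V → ZMod 2}
    (h : IsZ G Z) (u v : V) : weight u v Z = weight v u Z := by
  unfold weight
  rw [← Set.ncard_image_of_injective _ Prod.swap_injective]
  congr 1
  ext p
  simp only [Set.image_swap_eq_preimage_swap, Set.mem_preimage, Set.mem_ofPred_eq, Prod.fst_swap,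
    Prod.snd_swap]
  rw [h.swap]

theorem IsMin.swap [Fintype V] {G : SimpleGraph V} {pos : V → ℕ} {u v : V}
    {Z : V → V → V → V → ZMod 2} (h : IsMin G pos u v Z) : IsMin G pos v u Z :=
  ⟨h.isZ, h.cr_ne, fun Z' hZ' hcr => by
    rw [← h.isZ.weight_comm u v, ← hZ'.weight_comm u v]
    exact h.le Z' hZ' hcr⟩

theorem NoFrag.swap {G : SimpleGraph V} {u v : V} (h : NoFrag G u v) : NoFrag G v u := by
  intro w C hC hv hu hw hN y
  have := h w C hC hu hv hw (fun x hx y hxy => by have := hN x hx y hxy; tauto) y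
  tauto

section

variable [Fintype V] {G : SimpleGraph V} {pos : V → ℕ} {u v : V} {Z : V → V → V → V → ZMod 2}

theorem exists_swap (hpos : Function.Injective pos) (hf : NoFrag G u v)
    (huv : G.Adj u v) (hm : ¬ K33Minor G) (hZ : IsZ G Z) {x₁ x₂ y₁ y₂ : V}
    (hux₁ : G.Adj u x₁) (hux₂ : G.Adj u x₂) (hvy₁ : G.Adj v y₁) (hvy₂ : G.Adj v y₂)
    (hx₁v : x₁ ≠ v) (hx₂v : x₂ ≠ v) (hy₁u : y₁ ≠ u) (hy₂u : y₂ ≠ u) (hx : x₁ ≠ x₂) (hy : y₁ ≠ y₂)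
    (h11 : x₁ ≠ y₁) (h12 : x₁ ≠ y₂) (h21 : x₂ ≠ y₁) (h22 : x₂ ≠ y₂) :
    ∃ Z', IsZ G Z' ∧ cr pos Z' = cr pos Z ∧
      (∀ x y, (x ≠ x₁ ∧ x ≠ x₂) ∨ (y ≠ y₁ ∧ y ≠ y₂) → Z' u x v y = Z u x v y) ∧
      ∀ x y, (x = x₁ ∨ x = x₂) → (y = y₁ ∨ y = y₂) → Z' u x v y = Z u x v y + 1 := by
  obtain ⟨T, hT, hcr, hTM⟩ := hf.exists_torus huv hm hux₁ hux₂ hvy₁ hvy₂ hx₁v hx₂v hy₁u hy₂u hx h11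
    h12 h21 h22
  refine ⟨Z + T, hZ.add hT, by rw [cr_add, hcr pos hpos, add_zero], ?_, ?_⟩
  · rintro x y (⟨h1, h2⟩ | ⟨h1, h2⟩) <;> simp [hTM, ptFn_of_ne h1, ptFn_of_ne h2]
  · rintro x y (rfl | rfl) (rfl | rfl) <;>
      simp [hTM, ptFn_self, ptFn_of_ne hx, ptFn_of_ne hx.symm, ptFn_of_ne hy, ptFn_of_ne hy.symm]

theorem zmod_two_eq_one {a : ZMod 2} (h : a ≠ 0) : a = 1 := by
  revert a
  decide

theorem IsMin.eq_of_corner (h : IsMin G pos u v Z) (hpos : Function.Injective pos)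
    (hf : NoFrag G u v) (huv : G.Adj u v) (hm : ¬ K33Minor G) {x₁ x₂ y₁ y₂ : V} (hx : x₁ ≠ x₂)
    (hy : y₁ ≠ y₂) (h11 : Z u x₁ v y₁ ≠ 0) (h21 : Z u x₂ v y₁ ≠ 0) (h12 : Z u x₁ v y₂ ≠ 0) :
    x₂ = y₂ := by
  by_contra h22
  obtain ⟨e1, e2, -, e3, e4, e5⟩ := h.isZ.facts h11
  obtain ⟨f1, -, -, -, f4, f5⟩ := h.isZ.facts h21
  obtain ⟨-, g2, -, g3, -, g5⟩ := h.isZ.facts h12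
  obtain ⟨Z', hZ', hcr, hne, hflip⟩ := exists_swap hpos hf huv hm h.isZ e1 f1 e2 g2 e4 f4
    e3.symm g3.symm hx hy e5 g5 f5 h22
  have hle := h.le Z' hZ' (hcr ▸ h.cr_ne)
  refine absurd hle (not_le.2 ?_)
  have hsub : {p : V × V | Z' u p.1 v p.2 ≠ 0} ⊆ insert (x₂, y₂)
      ({p : V × V | Z u p.1 v p.2 ≠ 0} \ {(x₁, y₁), (x₂, y₁), (x₁, y₂)}) := by
    rintro ⟨x, y⟩ hp
    simp only [Set.mem_ofPred_eq] at hp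
    have h2 : (1 : ZMod 2) + 1 = 0 := rfl
    by_cases hcase : (x ≠ x₁ ∧ x ≠ x₂) ∨ (y ≠ y₁ ∧ y ≠ y₂)
    · rw [hne x y hcase] at hp
      right
      refine ⟨hp, ?_⟩
      simp only [Set.mem_insert_iff, Set.mem_singleton_iff, Prod.mk.injEq]
      grind
    · have hx' : x = x₁ ∨ x = x₂ := by grind
      have hy' : y = y₁ ∨ y = y₂ := by grind
      rw [hflip x y hx' hy'] at hp
      rcases hx' with rfl | rfl <;> rcases hy' with rfl | rfl
      · exact absurd (by rw [zmod_two_eq_one h11, h2]) hp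
      · exact absurd (by rw [zmod_two_eq_one h12, h2]) hp
      · exact absurd (by rw [zmod_two_eq_one h21, h2]) hp
      · exact Set.mem_insert _ _
  have h3 : ({(x₁, y₁), (x₂, y₁), (x₁, y₂)} : Set (V × V)).ncard = 3 := by
    rw [Set.ncard_eq_three]
    exact ⟨_, _, _, by simp [hx], by simp [hy], by simp [hx.symm], rfl⟩
  have hs3 : ({(x₁, y₁), (x₂, y₁), (x₁, y₂)} : Set (V × V)) ⊆ {p : V × V | Z u p.1 v p.2 ≠ 0} := by
    rintro p (rfl | rfl | rfl)
    exacts [h11, h21, h12]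
  have c1 := Set.ncard_le_ncard hsub (Set.toFinite _)
  have c2 := Set.ncard_insert_le (x₂, y₂)
    ({p : V × V | Z u p.1 v p.2 ≠ 0} \ {(x₁, y₁), (x₂, y₁), (x₁, y₂)})
  have c3 := Set.ncard_sdiff hs3 (Set.toFinite _)
  have c4 := Set.ncard_le_ncard hs3 (Set.toFinite _)
  unfold weight
  omega

theorem IsMin.exists_hexagon (h : IsMin G pos u v Z) (hpos : Function.Injective pos)
    (hf : NoFrag G u v) (huv : G.Adj u v) (hm : ¬ K33Minor G) {p q : V} (hpq : Z u p v q ≠ 0) :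
    ∃ z, Z u z v q ≠ 0 ∧ Z u p v z ≠ 0 ∧ Z u z v p ≠ 0 ∧ Z u q v z ≠ 0 ∧
      (∀ x, Z u x v q ≠ 0 → x = p ∨ x = z) ∧ ∀ x, Z u x v z ≠ 0 → x = p ∨ x = q := by
  have hcol : ∀ {x y}, Z u x v y ≠ 0 → ∃ x', x' ≠ x ∧ Z u x' v y ≠ 0 := by
    intro x y hxy
    rw [h.isZ.swap] at hxy
    obtain ⟨e, he, hZ⟩ := h.isZ.exists_ne hxy
    exact ⟨e, he, by rwa [h.isZ.swap]⟩
  have key := fun {x₁ x₂ y₁ y₂ : V} (hx : x₁ ≠ x₂) (hy : y₁ ≠ y₂) (h11 : Z u x₁ v y₁ ≠ 0)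
    h21 h12 => h.eq_of_corner hpos hf huv hm hx hy h11 h21 h12
  obtain ⟨x₂, hx₂, hc⟩ := hcol hpq
  obtain ⟨y₂, hy₂, hr⟩ := h.isZ.exists_ne hpq
  obtain rfl := key hx₂.symm hy₂.symm hpq hc hr
  refine ⟨x₂, hc, hr, ?_, ?_, fun x hx => ?_, fun x hx => ?_⟩
  · obtain ⟨y₃, hy₃, h3⟩ := h.isZ.exists_ne hc
    obtain rfl := key hx₂ hy₃.symm hc hpq h3
    exact h3
  · obtain ⟨x₃, hx₃, h3⟩ := hcol hr
    obtain rfl := key hx₃.symm hy₂ hr h3 hpq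
    exact h3
  · by_contra! hcon
    exact hcon.2 (key hcon.1.symm hy₂.symm hpq hx hr)
  · by_contra! hcon
    exact hcon.2 (key hcon.1.symm hy₂ hr hx hpq)

theorem IsMin.nbr (h : IsMin G pos u v Z) (hpos : Function.Injective pos)
    (hf : NoFrag G u v) (huv : G.Adj u v) (hm : ¬ K33Minor G) {p q z : V} (hpq : Z u p v q ≠ 0)
    (hzq : Z u z v q ≠ 0) (hpz : Z u p v z ≠ 0) (hzp : Z u z v p ≠ 0) (hqz : Z u q v z ≠ 0)
    (hq : ∀ x, Z u x v q ≠ 0 → x = p ∨ x = z) (hz : ∀ x, Z u x v z ≠ 0 → x = p ∨ x = q) {w : V}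
    (hw : G.Adj u w) : w = v ∨ w = p ∨ w = q ∨ w = z := by
  by_contra! hcon
  obtain ⟨hwv, hwp, hwq, hwz⟩ := hcon
  obtain ⟨a1, a2, -, a4, a5, a6⟩ := h.isZ.facts hpq
  obtain ⟨-, b2, -, b4, b5, b6⟩ := h.isZ.facts hpz
  obtain ⟨-, -, -, -, -, c6⟩ := h.isZ.facts hzq
  obtain ⟨Z', hZ', hcr, hne, hflip⟩ := exists_swap hpos hf huv hm h.isZ a1 hw a2 b2 a5 hwv
    a4.symm b4.symm (Ne.symm hwp) c6.symm a6 b6 hwq hwz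
  have h2 : (1 : ZMod 2) + 1 = 0 := rfl
  have hwq0 : Z u w v q = 0 := by
    by_contra hh
    have := hq w hh
    tauto
  have hsub : {p : V × V | Z' u p.1 v p.2 ≠ 0} ⊆ insert (w, q) (insert (w, z)
      ({p : V × V | Z u p.1 v p.2 ≠ 0} \ {(p, q), (p, z)})) := by
    rintro ⟨x, y⟩ hp
    simp only [Set.mem_ofPred_eq] at hp
    by_cases hcase : (x ≠ p ∧ x ≠ w) ∨ (y ≠ q ∧ y ≠ z)
    · rw [hne x y hcase] at hp
      right; right
      refine ⟨hp, ?_⟩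
      simp only [Set.mem_insert_iff, Set.mem_singleton_iff, Prod.mk.injEq]
      grind
    · have hx' : x = p ∨ x = w := by grind
      have hy' : y = q ∨ y = z := by grind
      rw [hflip x y hx' hy'] at hp
      rcases hx' with rfl | rfl <;> rcases hy' with rfl | rfl
      · exact absurd (by rw [zmod_two_eq_one hpq, h2]) hp
      · exact absurd (by rw [zmod_two_eq_one hpz, h2]) hp
      · exact Set.mem_insert _ _
      · exact Set.mem_insert_of_mem _ (Set.mem_insert _ _)
  have hs2 : ({(p, q), (p, z)} : Set (V × V)) ⊆ {p : V × V | Z u p.1 v p.2 ≠ 0} := by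
    rintro p (rfl | rfl)
    exacts [hpq, hpz]
  have c1 := Set.ncard_le_ncard hsub (Set.toFinite _)
  have c2 := Set.ncard_insert_le (w, q) (insert (w, z)
      ({p : V × V | Z u p.1 v p.2 ≠ 0} \ {(p, q), (p, z)}))
  have c2' := Set.ncard_insert_le (w, z) ({p : V × V | Z u p.1 v p.2 ≠ 0} \ {(p, q), (p, z)})
  have c3 := Set.ncard_sdiff hs2 (Set.toFinite _)
  have c4 := Set.ncard_le_ncard hs2 (Set.toFinite _)
  have c5 : ({(p, q), (p, z)} : Set (V × V)).ncard = 2 := Set.ncard_pair (by simp [c6.symm])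
  have hmin' : IsMin G pos u v Z' := by
    refine ⟨hZ', hcr ▸ h.cr_ne, fun Z'' h' hcr' => le_trans ?_ (h.le Z'' h' hcr')⟩
    unfold weight
    omega
  have hzpw : z ≠ p ∧ z ≠ w := ⟨b6.symm, hwz.symm⟩
  refine hwp (hmin'.eq_of_corner hpos hf huv hm (x₁ := z) (y₁ := q) (Ne.symm hwz) a6.symm ?_ ?_ ?_)
  · rwa [hne z q (Or.inl hzpw)]
  · rw [hflip w q (Or.inr rfl) (Or.inl rfl), hwq0]
    simp
  · rwa [hne z p (Or.inl hzpw)]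

end

theorem K33Minor.of_common_nbrs [Fintype V] {G : SimpleGraph V} (hG : Conn3 G) {u v p q z : V}
    (hnd : [u, v, p, q, z].Nodup) (hV : 6 ≤ Fintype.card V)
    (hu : ∀ w, G.Adj u w → w = v ∨ w = p ∨ w = q ∨ w = z)
    (hv : ∀ w, G.Adj v w → w = u ∨ w = p ∨ w = q ∨ w = z)
    (hup : G.Adj u p) (huq : G.Adj u q) (huz : G.Adj u z)
    (hvp : G.Adj v p) (hvq : G.Adj v q) (hvz : G.Adj v z) : K33Minor G := by
  classical
  obtain ⟨k, hk⟩ : ∃ k, k ∉ [u, v, p, q, z].toFinset := by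
    by_contra! hall
    have h1 := List.toFinset_card_of_nodup hnd
    rw [Finset.eq_univ_of_forall hall, Finset.card_univ] at h1
    simp only [List.length_cons, List.length_nil] at h1
    omega
  simp only [List.mem_toFinset] at hk
  let S : Set V := {x | x ∉ [u, v, p, q, z]}
  have hkS : k ∈ S := hk
  let K := comp G S k
  have hK : CutConn G K := cutConn_comp hkS
  have hKS : ∀ x ∈ K, x ∉ [u, v, p, q, z] := fun x hx => comp_subset hx
  have hN : ∀ x ∈ K, ∀ y, G.Adj x y → y ∈ K ∨ y = p ∨ y = q ∨ y = z := by
    intro x hx y hxy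
    have hxS := hKS x hx
    by_cases hy : y ∈ S
    · exact Or.inl (mem_comp_of_adj hkS hx hy hxy)
    · have hy : y ∈ [u, v, p, q, z] := not_not.1 hy
      simp only [List.mem_cons, List.not_mem_nil, or_false] at hy hxS
      rcases hy with rfl | rfl | h
      · have := hu x hxy.symm
        tauto
      · have := hv x hxy.symm
        tauto
      · exact Or.inr h
  simp only [List.mem_cons, List.not_mem_nil, or_false, not_or] at hKS
  simp only [List.nodup_cons, List.mem_cons, List.not_mem_nil, not_or, or_false] at hnd
  obtain ⟨⟨h1, h2, h3, h4⟩, ⟨h5, h6, h7⟩, ⟨h8, h9⟩, h10, -⟩ := hnd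
  have huK : u ∉ K := fun h => (hKS u h).1 rfl
  have hpK : p ∉ K := fun h => (hKS p h).2.2.1 rfl
  have hqK : q ∉ K := fun h => (hKS q h).2.2.2.1 rfl
  have hzK : z ∉ K := fun h => (hKS z h).2.2.2.2 rfl
  have hvK : v ∉ K := fun h => (hKS v h).2.1 rfl
  have hadj : ∀ a b c, a ∉ K → b ∉ K → u ≠ a → u ≠ b →
      (∀ x ∈ K, ∀ y, G.Adj x y → y ∈ K ∨ y = a ∨ y = b ∨ y = c) → ∃ x ∈ K, G.Adj x c := by
    intro a b c ha hb hua hub hN'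
    by_contra! hno
    rcases hG a b K hK.1 ha hb (fun x hx y hxy => by
      rcases hN' x hx y hxy with h | h | h | rfl
      · exact Or.inl h
      · exact Or.inr (Or.inl h)
      · exact Or.inr (Or.inr h)
      · exact absurd hxy (hno x hx)) u with h | h | h
    exacts [huK h, hua h, hub h]
  obtain ⟨kp, hkp, hkp'⟩ := hadj q z p hqK hzK h3 h4 fun x hx y hxy => by
    have := hN x hx y hxy
    tauto
  obtain ⟨kq, hkq, hkq'⟩ := hadj p z q hpK hzK h2 h4 fun x hx y hxy => by
    have := hN x hx y hxy
    tauto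
  obtain ⟨kz, hkz, hkz'⟩ := hadj p q z hpK hqK h2 h3 fun x hx y hxy => by
    have := hN x hx y hxy
    tauto
  refine K33Minor.of_sets (A := ![{u}, {v}, K]) (B := ![{p}, {q}, {z}]) ?_ ?_ ?_ ?_ ?_ ?_
  · intro i
    fin_cases i
    exacts [CutConn.singleton _ _, CutConn.singleton _ _, hK]
  · intro i
    fin_cases i
    exacts [CutConn.singleton _ _, CutConn.singleton _ _, CutConn.singleton _ _]
  · clear hadj hN hG hu hv
    intro i j hij
    fin_cases i <;> fin_cases j <;> simp [huK, hvK, h1] at hij ⊢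
  · clear hadj hN hG hu hv
    intro i j hij
    fin_cases i <;> fin_cases j <;> simp [h8, h9, h10] at hij ⊢
  · clear hadj hN hG hu hv
    intro i j
    fin_cases i <;> fin_cases j <;> simp [h2, h3, h4, h5, h6, h7, hpK, hqK, hzK]
  · intro i j
    fin_cases i <;> fin_cases j
    · exact ⟨u, rfl, p, rfl, hup⟩
    · exact ⟨u, rfl, q, rfl, huq⟩
    · exact ⟨u, rfl, z, rfl, huz⟩
    · exact ⟨v, rfl, p, rfl, hvp⟩
    · exact ⟨v, rfl, q, rfl, hvq⟩
    · exact ⟨v, rfl, z, rfl, hvz⟩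
    · exact ⟨kp, hkp, p, rfl, hkp'⟩
    · exact ⟨kq, hkq, q, rfl, hkq'⟩
    · exact ⟨kz, hkz, z, rfl, hkz'⟩

theorem Conn3.exists_nbr [Fintype V] {G : SimpleGraph V} (hG : Conn3 G) (hV : 4 ≤ Fintype.card V)
    {u p q : V} (hp : u ≠ p) (hq : u ≠ q) : ∃ x, G.Adj u x ∧ x ≠ p ∧ x ≠ q := by
  classical
  by_contra! hcon
  have hall := hG p q {u} ⟨u, rfl⟩ (Ne.symm hp) (Ne.symm hq) (by
    rintro x rfl y hxy
    have := hcon y hxy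
    tauto)
  have h1 : (Finset.univ : Finset V) ⊆ {u, p, q} := fun y _ => by
    simpa using hall y
  have h2 := Finset.card_le_card h1
  have h3 := Finset.card_le_three (a := u) (b := p) (c := q)
  rw [Finset.card_univ] at h2
  omega

theorem K33Minor.of_imageGraph_complete [Fintype V] {G : SimpleGraph V} (hG : Conn3 G) {π : V → W}
    {u v : V} (hπ : IsMerge π u v) (huv : G.Adj u v) (hV : Fintype.card V = 6)
    (hcomp : ∀ x y, x ≠ y → (imageGraph G π).Adj x y) : K33Minor G := by
  classical
  let H : Finset V := Finset.univ \ {u, v}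
  have hH : ∀ x, x ∈ H ↔ x ≠ u ∧ x ≠ v := by simp [H]
  have hHc : H.card = 4 := by
    rw [Finset.card_sdiff_of_subset (Finset.subset_univ _), Finset.card_univ, hV,
      Finset.card_pair huv.ne]
  have hinj : ∀ x ∈ H, ∀ a, π a = π x → a = x := by
    intro x hx a hax
    have := hπ.inj a x hax
    have := (hH x).1 hx
    tauto
  have hHadj : ∀ x ∈ H, ∀ y ∈ H, x ≠ y → G.Adj x y := by
    intro x hx y hy hxy
    obtain ⟨-, a, b, ha, hb, hab⟩ := hcomp (π x) (π y) fun h => hxy (hinj y hy x h)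
    rwa [hinj x hx a ha, hinj y hy b hb] at hab
  have hHuv : ∀ x ∈ H, G.Adj u x ∨ G.Adj v x := by
    intro x hx
    have hne : π u ≠ π x := fun h => ((hH x).1 hx).1 (hinj x hx u h).symm
    obtain ⟨-, a, b, ha, hb, hab⟩ := hcomp (π u) (π x) hne
    rw [hinj x hx b hb] at hab
    rcases hπ.inj a u ha with rfl | ⟨rfl, -⟩ | ⟨rfl, -⟩
    exacts [Or.inl hab, Or.inl hab, Or.inr hab]
  have htwo : ∀ {u v : V}, G.Adj u v → (∀ x, x ∈ H ↔ x ≠ u ∧ x ≠ v) →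
      2 ≤ (H.filter (G.Adj u)).card := by
    intro u v huv hH
    obtain ⟨a, ha, hav, -⟩ := hG.exists_nbr (by omega) huv.ne huv.ne
    obtain ⟨b, hb, hbv, hba⟩ := hG.exists_nbr (by omega) huv.ne ha.ne
    refine (Finset.card_pair hba.symm).symm.le.trans (Finset.card_le_card ?_)
    intro x hx
    simp only [Finset.mem_insert, Finset.mem_singleton] at hx
    rw [Finset.mem_filter, hH]
    rcases hx with rfl | rfl
    exacts [⟨⟨ha.ne', hav⟩, ha⟩, ⟨⟨hb.ne', hbv⟩, hb⟩]
  have hNu := htwo huv hH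
  have hNv := htwo huv.symm fun x => (hH x).trans and_comm
  have hsub : H \ H.filter (G.Adj v) ⊆ H.filter (G.Adj u) := by
    intro x hx
    simp only [Finset.mem_sdiff, Finset.mem_filter] at hx ⊢
    have := hHuv x hx.1
    tauto
  have hc : (H \ H.filter (G.Adj v)).card ≤ 2 := by
    rw [Finset.card_sdiff_of_subset (Finset.filter_subset _ _)]
    omega
  obtain ⟨A, hA1, hA2, hAc⟩ := Finset.exists_subsuperset_card_eq hsub hc hNu
  have hAH : A ⊆ H := hA2.trans (Finset.filter_subset _ _)
  have hBc : (H \ A).card = 2 := by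
    rw [Finset.card_sdiff_of_subset hAH]
    omega
  obtain ⟨a₁, a₂, ha, hAeq⟩ := Finset.card_eq_two.1 hAc
  obtain ⟨b₁, b₂, hb, hBeq⟩ := Finset.card_eq_two.1 hBc
  have fa : ∀ x ∈ A, x ∈ H ∧ G.Adj u x := fun x hx => Finset.mem_filter.1 (hA2 hx)
  have fb : ∀ x ∈ H \ A, x ∈ H ∧ G.Adj v x := by
    intro x hx
    rw [Finset.mem_sdiff] at hx
    refine ⟨hx.1, ?_⟩
    by_contra hh
    exact hx.2 (hA1 (by simp [hx.1, hh]))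
  have fab : ∀ x ∈ A, ∀ y ∈ H \ A, x ≠ y := by
    rintro x hx y hy rfl
    exact (Finset.mem_sdiff.1 hy).2 hx
  have ma₁ : a₁ ∈ A := by simp [hAeq]
  have ma₂ : a₂ ∈ A := by simp [hAeq]
  have mb₁ : b₁ ∈ H \ A := by simp [hBeq]
  have mb₂ : b₂ ∈ H \ A := by simp [hBeq]
  have hun : ∀ x ∈ H, u ≠ x ∧ v ≠ x := fun x hx =>
    ⟨((hH x).1 hx).1.symm, ((hH x).1 hx).2.symm⟩
  have edge : ∀ x ∈ A, ∀ y ∈ H \ A, ∃ s ∈ ({y} : Set V), ∃ t ∈ ({x} : Set V), G.Adj s t :=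
    fun x hx y hy => ⟨y, rfl, x, rfl, hHadj y (fb y hy).1 x (fa x hx).1 (fab x hx y hy).symm⟩
  refine K33Minor.of_rooted_cycle (X₁ := {a₁}) (X₂ := {a₂}) (Y₁ := {b₁}) (Y₂ := {b₂}) huv
    (CutConn.singleton _ _) (CutConn.singleton _ _) (CutConn.singleton _ _) (CutConn.singleton _ _)
    ?_ ?_ (by simpa) (by simpa) ?_ rfl rfl rfl rfl (fa a₁ ma₁).2 (fa a₂ ma₂).2 (fb b₁ mb₁).2
    (fb b₂ mb₂).2 (edge _ ma₁ _ mb₁) (edge _ ma₂ _ mb₁) (edge _ ma₁ _ mb₂) (edge _ ma₂ _ mb₂)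
  · simp [(hun a₁ (hAH ma₁)).1, (hun a₂ (hAH ma₂)).1, (hun b₁ (fb b₁ mb₁).1).1,
      (hun b₂ (fb b₂ mb₂).1).1]
  · simp [(hun a₁ (hAH ma₁)).2, (hun a₂ (hAH ma₂)).2, (hun b₁ (fb b₁ mb₁).1).2,
      (hun b₂ (fb b₂ mb₂).1).2]
  · simp [(fab a₁ ma₁ b₁ mb₁).symm, (fab a₁ ma₁ b₂ mb₂).symm, (fab a₂ ma₂ b₁ mb₁).symm,
      (fab a₂ ma₂ b₂ mb₂).symm]

theorem IsZ.complete_five (n : ℕ) : ∀ (V : Type) [Fintype V] (G : SimpleGraph V),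
    Fintype.card V = n → Conn3 G → ¬ K33Minor G → ∀ Z, IsZ G Z → ∀ pos : V → ℕ,
    Function.Injective pos → cr pos Z ≠ 0 →
    Fintype.card V = 5 ∧ ∀ x y, x ≠ y → G.Adj x y := by
  classical
  induction n with
  | zero =>
    intro V _ G hV _ _ Z _ pos _ hcr
    have := Fintype.card_eq_zero_iff.1 hV
    exact absurd (by simp [cr]) hcr
  | succ n ih =>
    intro V _ G hV hG hm Z hZ pos hpos hcr
    obtain ⟨a, b, c, d, hne⟩ : ∃ a b c d, Z a b c d ≠ 0 := by
      by_contra! h0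
      exact hcr (by simp [cr, h0])
    by_cases hV5 : Fintype.card V ≤ 5
    · exact hZ.complete_of_card_le hne hV5
    exfalso
    obtain ⟨u, v, huv, hf⟩ := hG.exists_noFrag (hZ.adj _ _ _ _ hne)
    obtain ⟨Y, hY⟩ := hZ.exists_isMin hcr u v
    by_cases hM : ∀ x y, Y u x v y = 0
    · obtain ⟨π, hπ⟩ := exists_isMerge huv.ne
      let pos₀ : V → ℕ := Function.update pos u (pos v)
      have hu₀ : pos₀ u = pos v := Function.update_self ..
      have hx₀ : ∀ x, x ≠ u → pos₀ x = pos x := fun x hx => Function.update_of_ne hx ..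
      have hpos₀ : ∀ a b, pos₀ a = pos₀ b → a = b ∨ (a = u ∧ b = v) ∨ (a = v ∧ b = u) := by
        intro a b hab
        by_cases ha : a = u <;> by_cases hb : b = u
        · exact Or.inl (ha.trans hb.symm)
        · rw [ha, hu₀, hx₀ b hb] at hab
          exact Or.inr (Or.inl ⟨ha, (hpos hab).symm⟩)
        · rw [hb, hu₀, hx₀ a ha] at hab
          exact Or.inr (Or.inr ⟨hpos hab, hb⟩)
        · rw [hx₀ a ha, hx₀ b hb] at hab
          exact Or.inl (hpos hab)
      have hconst : ∀ a b, π a = π b → pos₀ a = pos₀ b := by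
        intro a b hab
        rcases hπ.inj a b hab with rfl | ⟨rfl, rfl⟩ | ⟨rfl, rfl⟩
        · rfl
        · rw [hu₀, hx₀ _ huv.ne']
        · rw [hu₀, hx₀ _ huv.ne']
      let s := Function.surjInv hπ.surj
      have hs : ∀ w, π (s w) = w := Function.surjInv_eq hπ.surj
      have hcr' : cr (pos₀ ∘ s) (K33Scheme.push π Y) ≠ 0 := by
        rw [cr_push]
        have : (pos₀ ∘ s) ∘ π = pos₀ := funext fun x => hconst _ _ (hs _)
        rw [this, ← hY.isZ.cr_congr (pos := pos) (u := u) ?_ ?_ fun x hx => (hx₀ x hx).symm]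
        · exact hY.cr_ne
        · exact fun a b c d h => hpos.ne (hY.isZ.ne a b c d h)
        · intro a b c d h heq
          rcases hpos₀ _ _ heq with rfl | ⟨rfl, rfl⟩ | ⟨rfl, rfl⟩
          · exact hY.isZ.ne _ _ _ _ h rfl
          · exact h (hM _ _)
          · exact h (by rw [hY.isZ.swap, hM])
      obtain ⟨h5, hcomp⟩ := ih {x // x ≠ u} (imageGraph G π)
        (by rw [Fintype.card_subtype_compl, Fintype.card_subtype_eq]; omega) (hG.contract hπ hf)
        (fun h => hm (h.of_contract hπ huv)) _ (hY.isZ.push hπ hM) (pos₀ ∘ s) (by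
          intro w w' hww
          rw [← hs w, ← hs w']
          rcases hpos₀ _ _ hww with h | ⟨h, h'⟩ | ⟨h, h'⟩
          · rw [h]
          · rw [h, h', hπ.eq]
          · rw [h, h', hπ.eq]) hcr'
      rw [Fintype.card_subtype_compl, Fintype.card_subtype_eq] at h5
      exact hm (K33Minor.of_imageGraph_complete hG hπ huv (by omega) hcomp)
    · push Not at hM
      obtain ⟨p, q, hpq⟩ := hM
      obtain ⟨z, hzq, hpz, hzp, hqz, hq, hz⟩ := hY.exists_hexagon hpos hf huv hm hpq
      have hqp : Y v q u p ≠ 0 := by rwa [← hY.isZ.swap]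
      obtain ⟨z', hzq', hpz', hzp', hqz', hq', hz'⟩ :=
        hY.swap.exists_hexagon hpos hf.swap huv.symm hm hqp
      have hzz : z = z' := by
        have : z = q ∨ z = z' := hq' z (by rwa [← hY.isZ.swap])
        rcases this with rfl | h
        · exact absurd rfl (hY.isZ.facts hzq).2.2.2.2.2
        · exact h
      subst hzz
      obtain ⟨a1, a2, a3, a4, a5, a6⟩ := hY.isZ.facts hpq
      obtain ⟨b1, b2, b3, b4, b5, b6⟩ := hY.isZ.facts hqz
      obtain ⟨c1, c2, c3, c4, c5, c6⟩ := hY.isZ.facts hzp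
      refine hm (K33Minor.of_common_nbrs hG (u := u) (v := v) (p := p) (q := q) (z := z) ?_
        (by omega) (fun w hw => hY.nbr hpos hf huv hm hpq hzq hpz hzp hqz hq hz hw)
        (fun w hw => ?_) a1 b1 c1 c2 a2 b2)
      · have := huv.ne
        simp only [List.nodup_cons, List.mem_cons, List.not_mem_nil, not_or, or_false]
        simp_all [Ne.symm a5, Ne.symm b5, Ne.symm c5, Ne.symm c6]
      · have := hY.swap.nbr hpos hf.swap huv.symm hm hqp hzq' hpz' hzp' hqz' hq' hz' hw
        tauto

/-- The vertex `r` of `K₃,₃` is an endpoint of the edge `e`. -/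
def Inc (r : Fin 3 ⊕ Fin 3) (e : Fin 3 × Fin 3) : Prop := r = Sum.inl e.1 ∨ r = Sum.inr e.2

/-- Two edges of `K₃,₃` have a common endpoint. -/
def Meet (e f : Fin 3 × Fin 3) : Prop := e.1 = f.1 ∨ e.2 = f.2

instance (r : Fin 3 ⊕ Fin 3) (e : Fin 3 × Fin 3) : Decidable (Inc r e) :=
  inferInstanceAs (Decidable (_ ∨ _))

instance (e f : Fin 3 × Fin 3) : Decidable (Meet e f) := inferInstanceAs (Decidable (_ ∨ _))

theorem Meet.symm {e f : Fin 3 × Fin 3} (h : Meet e f) : Meet f e :=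
  h.imp Eq.symm Eq.symm

theorem Meet.of_inc {r : Fin 3 ⊕ Fin 3} {e f : Fin 3 × Fin 3} (he : Inc r e) (hf : Inc r f) :
    Meet e f := by
  rcases he with rfl | rfl <;> rcases hf with h | h
  exacts [Or.inl (Sum.inl.inj h), (nomatch h), (nomatch h), Or.inr (Sum.inr.inj h)]

theorem inc_of_forall_meet : ∀ (r : Fin 3 ⊕ Fin 3) (f : Fin 3 × Fin 3),
    (∀ e, Inc r e → Meet e f) → Inc r f := by
  decide

theorem eq_of_forall_inc : ∀ r s : Fin 3 ⊕ Fin 3, (∀ e, Inc r e → Inc s e) → r = s := by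
  decide

theorem exists_inc : ∀ r : Fin 3 ⊕ Fin 3, ∃ e, Inc r e := by
  decide

theorem exists_center {L : Fin 3 × Fin 3 → Prop} (hL : ∀ e f, L e → L f → Meet e f) :
    ∃ r, ∀ e, L e → Inc r e := by
  by_cases h : ∃ e, L e
  · obtain ⟨e, he⟩ := h
    by_cases h1 : ∀ f, L f → f.1 = e.1
    · exact ⟨Sum.inl e.1, fun f hf => Or.inl (by rw [h1 f hf])⟩
    · push Not at h1
      obtain ⟨f, hf, hfe⟩ := h1
      refine ⟨Sum.inr e.2, fun g hg => Or.inr ?_⟩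
      have h2 := hL _ _ hf he
      have h3 := hL _ _ hf hg
      have h4 := hL _ _ he hg
      unfold Meet at h2 h3 h4
      grind
  · exact ⟨Sum.inl 0, fun e he => (h ⟨e, he⟩).elim⟩

/-- Either `r` and `t` are adjacent in `K₃,₃`, and some edge at `r` meets no edge at `t` outside
`r`, or no edge joins them. -/
theorem opposite_or_same : ∀ r t : Fin 3 ⊕ Fin 3, r ≠ t →
    (∃ e, Inc r e ∧ ¬ Inc t e ∧ ∀ f, Meet f e → ¬ Inc r f → ¬ Inc t f) ∨
      ∀ e, Inc r e → ¬ Inc t e := by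
  decide

theorem exists_inl_ne : ∀ r t : Fin 3 ⊕ Fin 3, ∃ i, Sum.inl i ≠ r ∧ Sum.inl i ≠ t := by
  decide

theorem exists_inr_ne : ∀ r t : Fin 3 ⊕ Fin 3, ∃ i, Sum.inr i ≠ r ∧ Sum.inr i ≠ t := by
  decide

theorem const_of_avoid {P : Fin 3 ⊕ Fin 3 → Prop} {x y : Fin 3 ⊕ Fin 3}
    (h : ∀ e, ¬ Inc x e → ¬ Inc y e → (P (Sum.inl e.1) ↔ P (Sum.inr e.2))) :
    (∀ r, r ≠ x → r ≠ y → P r) ∨ ∀ r, r ≠ x → r ≠ y → ¬ P r := by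
  obtain ⟨i, hix, hiy⟩ := exists_inl_ne x y
  obtain ⟨j, hjx, hjy⟩ := exists_inr_ne x y
  have key : ∀ k l, Sum.inl k ≠ x → Sum.inl k ≠ y → Sum.inr l ≠ x → Sum.inr l ≠ y →
      (P (Sum.inl k) ↔ P (Sum.inr l)) := fun k l h1 h2 h3 h4 =>
    h (k, l) (fun hh => hh.elim (fun e => h1 e.symm) fun e => h3 e.symm)
      (fun hh => hh.elim (fun e => h2 e.symm) fun e => h4 e.symm)
  have hij := key i j hix hiy hjx hjy
  have hall : ∀ r, r ≠ x → r ≠ y → (P r ↔ P (Sum.inl i)) := by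
    rintro (k | l) hx hy
    · exact (key k j hx hy hjx hjy).trans hij.symm
    · exact (key i l hix hiy hx hy).symm
  by_cases hP : P (Sum.inl i)
  · exact Or.inl fun r hx hy => (hall r hx hy).2 hP
  · exact Or.inr fun r hx hy hr => hP ((hall r hx hy).1 hr)

/-- A relaxation of a `K₃,₃`-scheme with roots `ρ`: the path of each edge `e` is replaced by a set
`F e` of edges of `G` whose boundary consists of the two endpoints of `e`. -/
structure Scheme [Fintype V] (G : SimpleGraph V) (ρ : Fin 3 ⊕ Fin 3 → V)
    (F : Fin 3 × Fin 3 → V → V → ZMod 2) : Prop where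
  inj : Function.Injective ρ
  chain : ∀ e, EdgeChain G (F e)
  boundary : ∀ e a, bd (F e) a = ptFn (ρ (Sum.inl e.1)) a + ptFn (ρ (Sum.inr e.2)) a
  meet : ∀ e f a b c, F e a b ≠ 0 → F f a c ≠ 0 → Meet e f

/-- The set of edges of `K₃,₃` whose chain goes through `a`. -/
def Lab (F : Fin 3 × Fin 3 → V → V → ZMod 2) (a : V) (e : Fin 3 × Fin 3) : Prop :=
  ∃ b, F e a b ≠ 0

theorem Lab.of_bd [Fintype V] {F : Fin 3 × Fin 3 → V → V → ZMod 2} {a : V} {e : Fin 3 × Fin 3}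
    (h : bd (F e) a ≠ 0) : Lab F a e := by
  obtain ⟨b, -, hb⟩ := Finset.exists_ne_zero_of_sum_ne_zero h
  exact ⟨b, hb⟩

theorem Scheme.meet_of_lab [Fintype V] {G : SimpleGraph V} {ρ : Fin 3 ⊕ Fin 3 → V}
    {F : Fin 3 × Fin 3 → V → V → ZMod 2} (h : Scheme G ρ F) {a : V} (e f : Fin 3 × Fin 3)
    (he : Lab F a e) (hf : Lab F a f) : Meet e f := by
  obtain ⟨b, hb⟩ := he
  obtain ⟨c, hc⟩ := hf
  exact h.meet e f a b c hb hc

theorem Scheme.lab_root [Fintype V] {G : SimpleGraph V} {ρ : Fin 3 ⊕ Fin 3 → V}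
    {F : Fin 3 × Fin 3 → V → V → ZMod 2} (h : Scheme G ρ F) {r : Fin 3 ⊕ Fin 3}
    {e : Fin 3 × Fin 3} (hr : Inc r e) : Lab F (ρ r) e := by
  refine Lab.of_bd ?_
  rw [h.boundary]
  rcases hr with rfl | rfl
  · rw [ptFn_self, ptFn_of_ne (h.inj.ne (by simp))]
    simp
  · rw [ptFn_self, ptFn_of_ne (h.inj.ne (by simp))]
    simp

theorem Scheme.inc_of_lab_root [Fintype V] {G : SimpleGraph V} {ρ : Fin 3 ⊕ Fin 3 → V}
    {F : Fin 3 × Fin 3 → V → V → ZMod 2} (h : Scheme G ρ F) {a : V} {r : Fin 3 ⊕ Fin 3}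
    (hr : ∀ e, Inc r e → Lab F a e) {e : Fin 3 × Fin 3} (he : Lab F a e) : Inc r e :=
  inc_of_forall_meet r e fun f hf => h.meet_of_lab f e (hr f hf) he

theorem sum_bd [Fintype V] {G : SimpleGraph V} {F : V → V → ZMod 2} (hF : EdgeChain G F)
    (s : Finset V) : ∑ a ∈ s, ∑ b ∈ s, F a b = 0 := by
  rw [← Finset.sum_product']
  refine Finset.sum_involution (fun x _ => (x.2, x.1)) ?_ ?_ ?_ ?_
  · intro x _
    rw [hF.symm x.2 x.1]
    exact CharTwo.add_self_eq_zero _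
  · rintro ⟨x, y⟩ _ hne heq
    have hyx : y = x := congrArg Prod.fst heq
    exact hne (hyx ▸ hF.self _)
  · intro x hx
    rw [Finset.mem_product] at hx ⊢
    exact hx.symm
  · intro x _
    rfl

open Classical in
/-- The image of a set of edges under a map of vertices, without loops. -/
noncomputable def pushChain [Fintype V] (π : V → W) (F : V → V → ZMod 2) (x y : W) : ZMod 2 :=
  if x = y then 0 else
    ∑ a ∈ Finset.univ.filter (π · = x), ∑ b ∈ Finset.univ.filter (π · = y), F a b

theorem pushChain_ne_zero [Fintype V] {π : V → W} {F : V → V → ZMod 2} {x y : W}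
    (h : pushChain π F x y ≠ 0) : x ≠ y ∧ ∃ a b, π a = x ∧ π b = y ∧ F a b ≠ 0 := by
  classical
  unfold pushChain at h
  split_ifs at h with hxy
  · exact absurd rfl h
  · obtain ⟨a, ha, h⟩ := Finset.exists_ne_zero_of_sum_ne_zero h
    obtain ⟨b, hb, h⟩ := Finset.exists_ne_zero_of_sum_ne_zero h
    exact ⟨hxy, a, b, (Finset.mem_filter.1 ha).2, (Finset.mem_filter.1 hb).2, h⟩

theorem EdgeChain.push [Fintype V] {G : SimpleGraph V} {F : V → V → ZMod 2} (h : EdgeChain G F)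
    (π : V → W) : EdgeChain (imageGraph G π) (pushChain π F) := by
  classical
  refine ⟨fun x y => ?_, fun x y hxy => ?_⟩
  · unfold pushChain
    by_cases hxy : x = y
    · rw [if_pos hxy, if_pos hxy.symm]
    · rw [if_neg hxy, if_neg (Ne.symm hxy), Finset.sum_comm]
      simp only [h.symm]
  · obtain ⟨hne, a, b, ha, hb, hab⟩ := pushChain_ne_zero hxy
    exact ⟨hne, a, b, ha, hb, h.adj a b hab⟩

open Classical in
theorem bd_pushChain [Fintype V] [Fintype W] {G : SimpleGraph V} {F : V → V → ZMod 2}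
    (h : EdgeChain G F) (π : V → W) (x : W) :
    bd (pushChain π F) x = ∑ a ∈ Finset.univ.filter (π · = x), bd F a := by
  have h1 : ∀ y, pushChain π F x y =
      (∑ a ∈ Finset.univ.filter (π · = x), ∑ b ∈ Finset.univ.filter (π · = y), F a b) := by
    intro y
    unfold pushChain
    split_ifs with hxy
    · rw [← hxy, sum_bd h]
    · rfl
  simp only [bd, h1]
  rw [Finset.sum_comm]
  exact Finset.sum_congr rfl fun a _ => Finset.sum_fiberwise Finset.univ π (F a)

theorem Scheme.push [Fintype V] [Fintype W] {G : SimpleGraph V} {ρ : Fin 3 ⊕ Fin 3 → V}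
    {F : Fin 3 × Fin 3 → V → V → ZMod 2} (h : Scheme G ρ F) {π : V → W} {u v : V}
    (hπ : IsMerge π u v) (huv : ∀ e f, Lab F u e → Lab F v f → Meet e f) :
    Scheme (imageGraph G π) (π ∘ ρ) fun e => pushChain π (F e) := by
  classical
  have hne : ∀ r s, ρ r = u → ρ s = v → r = s := by
    rintro r s rfl rfl
    refine eq_of_forall_inc r s fun e he => inc_of_forall_meet s e fun f hf => ?_
    exact (huv e f (h.lab_root he) (h.lab_root hf)).symm
  refine ⟨fun r s hrs => ?_, fun e => (h.chain e).push π, fun e x => ?_,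
    fun e f x y z he hf => ?_⟩
  · rcases hπ.inj _ _ hrs with h1 | ⟨h1, h2⟩ | ⟨h1, h2⟩
    exacts [h.inj h1, hne r s h1 h2, (hne s r h2 h1).symm]
  · rw [bd_pushChain (h.chain e)]
    simp only [h.boundary, Finset.sum_add_distrib, ptFn, Finset.sum_ite_eq', Finset.mem_filter,
      Finset.mem_univ, true_and, Function.comp_apply, eq_comm]
  · obtain ⟨-, a, b, ha, -, hab⟩ := pushChain_ne_zero he
    obtain ⟨-, a', c, ha', -, hac⟩ := pushChain_ne_zero hf
    rcases hπ.inj a a' (ha.trans ha'.symm) with rfl | ⟨rfl, rfl⟩ | ⟨rfl, rfl⟩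
    exacts [h.meet e f a b c hab hac, huv e f ⟨b, hab⟩ ⟨c, hac⟩,
      (huv f e ⟨c, hac⟩ ⟨b, hab⟩).symm]

/-- A scheme in which no edge can be contracted, no vertex can be deleted, and no chain can be
shortened. -/
structure Reduced [Fintype V] (G : SimpleGraph V) (ρ : Fin 3 ⊕ Fin 3 → V)
    (F : Fin 3 × Fin 3 → V → V → ZMod 2) : Prop extends Scheme G ρ F where
  adj_imp : ∀ u v, G.Adj u v → ∃ e f, Lab F u e ∧ Lab F v f ∧ ¬ Meet e f
  exists_lab : ∀ v, ∃ e, Lab F v e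
  minimal : ∀ (ρ' : Fin 3 ⊕ Fin 3 → V) (H : Fin 3 × Fin 3 → V → V → ZMod 2),
    Scheme G ρ' (fun e => F e + H e) → (∀ e a b, H e a b = 0 ∨ H e a b = F e a b) →
    ∀ e a b, H e a b = 0

theorem Scheme.of_sub [Fintype V] {G : SimpleGraph V} {ρ ρ' : Fin 3 ⊕ Fin 3 → V}
    {F H : Fin 3 × Fin 3 → V → V → ZMod 2} (h : Scheme G ρ F) (hρ : Function.Injective ρ')
    (hH : ∀ e, EdgeChain G (H e)) (hF : ∀ e a b, H e a b = 0 ∨ H e a b = F e a b)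
    (hbd : ∀ e a, bd (F e) a + bd (H e) a =
      ptFn (ρ' (Sum.inl e.1)) a + ptFn (ρ' (Sum.inr e.2)) a) :
    Scheme G ρ' fun e => F e + H e := by
  have hne : ∀ e a b, (F e + H e) a b ≠ 0 → F e a b ≠ 0 := by
    intro e a b hne h0
    refine hne ?_
    rw [Pi.add_apply, Pi.add_apply, h0, zero_add]
    exact (hF e a b).elim id fun h1 => h1.trans h0
  exact ⟨hρ, fun e => (h.chain e).add (hH e), fun e a => by rw [bd_add, hbd], fun e f a b c he hf =>
    h.meet e f a b c (hne e a b he) (hne f a c hf)⟩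

open Classical in
/-- The edges of `F` that have an endpoint in `C`. -/
noncomputable def cutChain (C : Set V) (F : V → V → ZMod 2) (a b : V) : ZMod 2 :=
  if a ∈ C ∨ b ∈ C then F a b else 0

theorem cutChain_eq (C : Set V) (F : V → V → ZMod 2) (a b : V) :
    cutChain C F a b = 0 ∨ cutChain C F a b = F a b := by
  unfold cutChain
  split_ifs
  exacts [Or.inr rfl, Or.inl rfl]

theorem cutChain_of_mem {C : Set V} {F : V → V → ZMod 2} {a b : V} (h : a ∈ C) :
    cutChain C F a b = F a b :=
  if_pos (Or.inl h)

theorem cutChain_ne_zero {C : Set V} {F : V → V → ZMod 2} {a b : V} (h : cutChain C F a b ≠ 0) :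
    (a ∈ C ∨ b ∈ C) ∧ F a b ≠ 0 := by
  unfold cutChain at h
  split_ifs at h with hC
  · exact ⟨hC, h⟩
  · exact absurd rfl h

theorem EdgeChain.cut {G : SimpleGraph V} {F : V → V → ZMod 2} (h : EdgeChain G F) (C : Set V) :
    EdgeChain G (cutChain C F) := by
  refine ⟨fun a b => ?_, fun a b hab => h.adj a b (cutChain_ne_zero hab).2⟩
  classical
  simp only [cutChain, h.symm a b]
  exact if_congr or_comm rfl rfl

theorem bd_cutChain_of_mem [Fintype V] {C : Set V} {F : V → V → ZMod 2} {a : V} (h : a ∈ C) :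
    bd (cutChain C F) a = bd F a := by
  simp only [bd, cutChain_of_mem h]

theorem lab_of_bd_cutChain [Fintype V] {C : Set V} {F : Fin 3 × Fin 3 → V → V → ZMod 2}
    {e : Fin 3 × Fin 3} {p : V} (hp : p ∉ C) (h : bd (cutChain C (F e)) p ≠ 0) :
    ∃ c ∈ C, F e p c ≠ 0 := by
  obtain ⟨c, -, hc⟩ := Finset.exists_ne_zero_of_sum_ne_zero h
  obtain ⟨h1, h2⟩ := cutChain_ne_zero hc
  exact ⟨c, h1.resolve_left hp, h2⟩

theorem bd_cutChain [Fintype V] {G : SimpleGraph V} {ρ : Fin 3 ⊕ Fin 3 → V}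
    {F : Fin 3 × Fin 3 → V → V → ZMod 2} (h : Scheme G ρ F) {C : Set V} {p q : V} (hpq : p ≠ q)
    (hp : p ∉ C) (hq : q ∉ C) (hN : ∀ x ∈ C, ∀ y, G.Adj x y → y ∈ C ∨ y = p ∨ y = q)
    (e : Fin 3 × Fin 3) (a : V) :
    bd (cutChain C (F e)) a =
      ind (ρ (Sum.inl e.1) ∈ C) * ptFn (ρ (Sum.inl e.1)) a +
      ind (ρ (Sum.inr e.2) ∈ C) * ptFn (ρ (Sum.inr e.2)) a +
      bd (cutChain C (F e)) p * ptFn p a + bd (cutChain C (F e)) q * ptFn q a := by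
  have hout : ∀ r, a ∉ C → ind (ρ r ∈ C) * ptFn (ρ r) a = 0 := by
    intro r ha
    by_cases hr : ρ r ∈ C
    · rw [ptFn_of_ne (by rintro rfl; exact ha hr), mul_zero]
    · rw [ind_false hr, zero_mul]
  have hin : ∀ r, a ∈ C → ind (ρ r ∈ C) * ptFn (ρ r) a = ptFn (ρ r) a := by
    intro r ha
    by_cases hr : ρ r ∈ C
    · rw [ind_true hr, one_mul]
    · rw [ptFn_of_ne (by rintro rfl; exact hr ha), mul_zero]
  by_cases ha : a ∈ C
  · rw [hin _ ha, hin _ ha, bd_cutChain_of_mem ha, h.boundary, ptFn_of_ne (a := a) (x := p),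
      ptFn_of_ne (a := a) (x := q)]
    · ring
    · rintro rfl
      exact hq ha
    · rintro rfl
      exact hp ha
  · rw [hout _ ha, hout _ ha]
    by_cases hap : a = p
    · subst hap
      rw [ptFn_self, ptFn_of_ne hpq]
      ring
    by_cases haq : a = q
    · subst haq
      rw [ptFn_self, ptFn_of_ne hpq.symm]
      ring
    rw [ptFn_of_ne hap, ptFn_of_ne haq]
    simp only [mul_zero, add_zero]
    refine Finset.sum_eq_zero fun b _ => ?_
    by_contra hne
    obtain ⟨h1, h2⟩ := cutChain_ne_zero hne
    have h3 := hN b (h1.resolve_left ha) a ((h.chain e).adj a b h2).symm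
    tauto

theorem bd_cutChain_add [Fintype V] {G : SimpleGraph V} {ρ : Fin 3 ⊕ Fin 3 → V}
    {F : Fin 3 × Fin 3 → V → V → ZMod 2} (h : Scheme G ρ F) {C : Set V} {p q : V} (hpq : p ≠ q)
    (hp : p ∉ C) (hq : q ∉ C) (hN : ∀ x ∈ C, ∀ y, G.Adj x y → y ∈ C ∨ y = p ∨ y = q)
    (e : Fin 3 × Fin 3) :
    ind (ρ (Sum.inl e.1) ∈ C) + ind (ρ (Sum.inr e.2) ∈ C) +
      bd (cutChain C (F e)) p + bd (cutChain C (F e)) q = 0 := by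
  have h1 : ∑ a, bd (cutChain C (F e)) a = 0 := sum_bd ((h.chain e).cut C) Finset.univ
  rw [Finset.sum_congr rfl fun a _ => bd_cutChain h hpq hp hq hN e a] at h1
  simpa only [Finset.sum_add_distrib, ← Finset.mul_sum, sum_ptFn, mul_one] using h1

theorem Reduced.cut_eq_zero [Fintype V] {G : SimpleGraph V} {ρ : Fin 3 ⊕ Fin 3 → V}
    {F : Fin 3 × Fin 3 → V → V → ZMod 2} (h : Reduced G ρ F) (C : Set V) (e : Fin 3 × Fin 3)
    (h0 : ∀ a, bd (cutChain C (F e)) a = 0) (a b : V) : cutChain C (F e) a b = 0 := by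
  let H : Fin 3 × Fin 3 → V → V → ZMod 2 := fun f => if f = e then cutChain C (F e) else 0
  have hH : ∀ f, EdgeChain G (H f) ∧ (∀ a, bd (H f) a = 0) ∧
      ∀ a b, H f a b = 0 ∨ H f a b = F f a b := by
    intro f
    by_cases hf : f = e
    · subst hf
      simp only [H, if_true]
      exact ⟨(h.chain f).cut C, h0, cutChain_eq C _⟩
    · simp only [H, if_neg hf]
      exact ⟨⟨by simp, by simp⟩, by simp [bd], by simp⟩
  have := h.minimal ρ H (h.toScheme.of_sub h.inj (fun f => (hH f).1) (fun f => (hH f).2.2) fun f a => by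
    rw [(hH f).2.1 a, add_zero, h.boundary]) (fun f => (hH f).2.2) e a b
  simpa [H] using this

theorem Reduced.not_adj [Fintype V] {G : SimpleGraph V} {ρ : Fin 3 ⊕ Fin 3 → V}
    {F : Fin 3 × Fin 3 → V → V → ZMod 2} (h : Reduced G ρ F) {u v : V} {r : Fin 3 ⊕ Fin 3}
    (hu : ∀ e, Lab F u e → Inc r e) (hv : ∀ e, Lab F v e → Inc r e) : ¬ G.Adj u v := by
  intro huv
  obtain ⟨e, f, he, hf, hne⟩ := h.adj_imp u v huv
  exact hne (Meet.of_inc (hu e he) (hv f hf))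

theorem Reduced.exists_of_lab [Fintype V] {G : SimpleGraph V} {ρ : Fin 3 ⊕ Fin 3 → V}
    {F : Fin 3 × Fin 3 → V → V → ZMod 2} (h : Reduced G ρ F) {C : Set V} {p q : V} (hpq : p ≠ q)
    (hp : p ∉ C) (hq : q ∉ C) (hN : ∀ x ∈ C, ∀ y, G.Adj x y → y ∈ C ∨ y = p ∨ y = q)
    {e : Fin 3 × Fin 3} {c : V} (hc : c ∈ C) (hce : Lab F c e) (he : ∀ r, Inc r e → ρ r ∉ C) :
    ∃ c' ∈ C, F e p c' ≠ 0 := by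
  refine lab_of_bd_cutChain hp fun h0 => ?_
  have h1 := bd_cutChain_add h.toScheme hpq hp hq hN e
  have h2 := bd_cutChain h.toScheme hpq hp hq hN e
  rw [ind_false (he _ (Or.inl rfl)), ind_false (he _ (Or.inr rfl)), h0, add_zero, zero_add,
    zero_add] at h1
  rw [ind_false (he _ (Or.inl rfl)), ind_false (he _ (Or.inr rfl)), h0, h1] at h2
  obtain ⟨z, hz⟩ := hce
  have := h.cut_eq_zero C e (fun a => by rw [h2]; ring) c z
  rw [cutChain_of_mem hc] at this
  exact hz this

/-- The case where exactly one of the roots lies in `C`. -/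
theorem Reduced.not_one_root [Fintype V] {G : SimpleGraph V} {ρ : Fin 3 ⊕ Fin 3 → V}
    {F : Fin 3 × Fin 3 → V → V → ZMod 2} (h : Reduced G ρ F) {C : Set V} {p q : V} (hpq : p ≠ q)
    (hp : p ∉ C) (hq : q ∉ C) (hN : ∀ x ∈ C, ∀ y, G.Adj x y → y ∈ C ∨ y = p ∨ y = q)
    {x : Fin 3 ⊕ Fin 3} (hx : ∀ e, Lab F p e → Inc x e) (hxC : ρ x ∈ C) :
    ∃ r, r ≠ x ∧ ρ r ∈ C := by
  by_contra! hr
  have hlab : ∀ c ∈ C, ∀ f, Lab F c f → Inc x f := by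
    intro c hc f hf
    by_contra hxf
    obtain ⟨c', -, hc'⟩ := h.exists_of_lab hpq hp hq hN hc hf fun r hrf =>
      hr r fun hrx => hxf (hrx ▸ hrf)
    exact hxf (hx f ⟨c', hc'⟩)
  have hxx := hlab _ hxC
  have hq' : ∀ e, Inc x e → G.Adj (ρ x) q ∧ Lab F q e := by
    intro e he
    obtain ⟨y, hy⟩ := h.lab_root he
    have hadj := (h.chain e).adj _ _ hy
    rcases hN _ hxC y hadj with hyC | rfl | rfl
    · exact absurd hadj (h.not_adj hxx (hlab y hyC))
    · exact absurd hadj (h.not_adj hxx hx)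
    · exact ⟨hadj, ρ x, by rwa [(h.chain e).symm]⟩
  obtain ⟨e, he⟩ := exists_inc x
  exact h.not_adj hxx (fun f => h.inc_of_lab_root fun e he => (hq' e he).2) (hq' e he).1

/-- The case where at most two of the roots lie in `C`, and these are not adjacent in `K₃,₃`. -/
theorem Reduced.not_two_roots [Fintype V] {G : SimpleGraph V} {ρ : Fin 3 ⊕ Fin 3 → V}
    {F : Fin 3 × Fin 3 → V → V → ZMod 2} (h : Reduced G ρ F) {C : Set V} {p q : V} (hpq : p ≠ q)
    (hp : p ∉ C) (hq : q ∉ C) (hN : ∀ x ∈ C, ∀ y, G.Adj x y → y ∈ C ∨ y = p ∨ y = q)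
    {x y : Fin 3 ⊕ Fin 3} (hx : ∀ e, Lab F p e → Inc x e) (hy : ∀ e, Lab F q e → Inc y e)
    (hxC : ρ x ∈ C) (hxy : ∀ e, Inc x e → ¬ Inc y e)
    (hr : ∀ r, r ≠ x → r ≠ y → ρ r ∉ C) : False := by
  have hend : ∀ e, Inc x e → ∀ s, Inc s e → s ≠ x → ρ s ∉ C := fun e he s hs hsx =>
    hr s hsx fun hsy => hxy e he (hsy ▸ hs)
  have hq0 : ∀ e, Inc x e → bd (cutChain C (F e)) q = 0 := by
    intro e he
    by_contra hne
    obtain ⟨c, -, hc⟩ := lab_of_bd_cutChain hq hne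
    exact hxy e he (hy e ⟨c, hc⟩)
  have hbd : ∀ e, Inc x e → ∀ a, bd (cutChain C (F e)) a = ptFn (ρ x) a + ptFn p a := by
    intro e he a
    have h1 := bd_cutChain_add h.toScheme hpq hp hq hN e
    have h2 := bd_cutChain h.toScheme hpq hp hq hN e a
    have h4 : ind (ρ (Sum.inl e.1) ∈ C) + ind (ρ (Sum.inr e.2) ∈ C) = 1 ∧
        ind (ρ (Sum.inl e.1) ∈ C) * ptFn (ρ (Sum.inl e.1)) a +
        ind (ρ (Sum.inr e.2) ∈ C) * ptFn (ρ (Sum.inr e.2)) a = ptFn (ρ x) a := by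
      rcases id he with hxe | hxe
      · rw [← hxe, ind_true hxC, ind_false (hend e he _ (Or.inr rfl) (by simp [hxe]))]
        simp
      · rw [← hxe, ind_true hxC, ind_false (hend e he _ (Or.inl rfl) (by simp [hxe]))]
        simp
    rw [h4.1, hq0 e he, add_zero, CharTwo.add_eq_zero] at h1
    rw [h2, h4.2, hq0 e he, ← h1]
    ring
  have hpρ : ∀ r, ρ r ≠ p := by
    intro r hrp
    have : r = x := eq_of_forall_inc r x fun e he => hx e (hrp ▸ h.lab_root he)
    exact hp (hrp ▸ this ▸ hxC)
  let H : Fin 3 × Fin 3 → V → V → ZMod 2 := fun e => if Inc x e then cutChain C (F e) else 0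
  have hH : ∀ e, EdgeChain G (H e) ∧ ∀ a b, H e a b = 0 ∨ H e a b = F e a b := by
    intro e
    by_cases he : Inc x e
    · simp only [H, if_pos he]
      exact ⟨(h.chain e).cut C, cutChain_eq C _⟩
    · simp only [H, if_neg he]
      exact ⟨⟨by simp, by simp⟩, by simp⟩
  have hzero := h.minimal (Function.update ρ x p) H (h.toScheme.of_sub ?_ (fun e => (hH e).1)
    (fun e => (hH e).2) ?_) fun e => (hH e).2
  · obtain ⟨e, he⟩ := exists_inc x
    have h1 := hbd e he p
    have h2 : bd (cutChain C (F e)) p = 0 := by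
      have h3 := hzero e
      simp only [H, if_pos he] at h3
      simp only [bd, h3, Finset.sum_const_zero]
    rw [h2, ptFn_self, ptFn_of_ne (hpρ x).symm] at h1
    exact absurd h1 (by decide)
  · intro r s hrs
    by_cases hrx : r = x <;> by_cases hsx : s = x
    · rw [hrx, hsx]
    · rw [hrx, Function.update_self, Function.update_of_ne hsx] at hrs
      exact absurd hrs.symm (hpρ s)
    · rw [hsx, Function.update_self, Function.update_of_ne hrx] at hrs
      exact absurd hrs (hpρ r)
    · rw [Function.update_of_ne hrx, Function.update_of_ne hsx] at hrs
      exact h.inj hrs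
  · intro e a
    rw [h.boundary]
    by_cases he : Inc x e
    · simp only [H, if_pos he]
      rw [hbd e he]
      have h0 := CharTwo.add_self_eq_zero (ptFn (ρ x) a)
      rcases he with rfl | rfl
      · rw [Function.update_self, Function.update_of_ne (by simp)]
        linear_combination h0
      · rw [Function.update_self, Function.update_of_ne (by simp)]
        linear_combination h0
    · simp only [H, if_neg he]
      rw [Function.update_of_ne fun hh => he (Or.inl hh.symm),
        Function.update_of_ne fun hh => he (Or.inr hh.symm)]
      simp [bd]

theorem Reduced.no_cut [Fintype V] {G : SimpleGraph V} {ρ : Fin 3 ⊕ Fin 3 → V}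
    {F : Fin 3 × Fin 3 → V → V → ZMod 2} (h : Reduced G ρ F) {C : Set V} {p q : V} (hpq : p ≠ q)
    (hp : p ∉ C) (hq : q ∉ C) (hN : ∀ x ∈ C, ∀ y, G.Adj x y → y ∈ C ∨ y = p ∨ y = q)
    (hC : C.Nonempty) {x y : Fin 3 ⊕ Fin 3} (hx : ∀ e, Lab F p e → Inc x e)
    (hy : ∀ e, Lab F q e → Inc y e) (hr : ∀ r, r ≠ x → r ≠ y → ρ r ∉ C) : False := by
  have hN' : ∀ x ∈ C, ∀ y, G.Adj x y → y ∈ C ∨ y = q ∨ y = p := fun x hx y hxy =>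
    (hN x hx y hxy).imp id Or.symm
  by_cases hxC : ρ x ∈ C
  · obtain ⟨r, hrx, hrC⟩ := h.not_one_root hpq hp hq hN hx hxC
    obtain rfl : r = y := by
      by_contra hry
      exact hr r hrx hry hrC
    rcases opposite_or_same x r hrx.symm with ⟨e, hxe, hre, he⟩ | hsame
    · obtain ⟨z, hz⟩ := h.lab_root hxe
      have hadj := (h.chain e).adj _ _ hz
      have hxx : ∀ f, Lab F (ρ x) f → Inc x f := fun f => h.inc_of_lab_root fun e => h.lab_root
      have hez : Lab F z e := ⟨ρ x, by rwa [(h.chain e).symm]⟩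
      rcases hN _ hxC z hadj with hzC | rfl | rfl
      · refine h.not_adj hxx (fun f hf => ?_) hadj
        by_contra hxf
        have hrf := he f (h.meet_of_lab f e hf hez) hxf
        obtain ⟨c', -, hc'⟩ := h.exists_of_lab hpq hp hq hN hzC hf fun s hsf =>
          hr s (fun hs => hxf (hs ▸ hsf)) fun hs => hrf (hs ▸ hsf)
        exact hxf (hx f ⟨c', hc'⟩)
      · exact h.not_adj hxx hx hadj
      · exact hre (hy e hez)
    · exact h.not_two_roots hpq hp hq hN hx hy hxC hsame hr
  · by_cases hyC : ρ y ∈ C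
    · obtain ⟨r, hry, hrC⟩ := h.not_one_root hpq.symm hq hp hN' hy hyC
      refine hr r ?_ hry hrC
      rintro rfl
      exact hxC hrC
    · have hr' : ∀ r, ρ r ∉ C := by
        intro r
        by_cases h1 : r = x
        · rwa [h1]
        by_cases h2 : r = y
        · rwa [h2]
        exact hr r h1 h2
      obtain ⟨c, hc⟩ := hC
      obtain ⟨e, he⟩ := h.exists_lab c
      obtain ⟨c', hc'C, hc'⟩ := h.exists_of_lab hpq hp hq hN hc he fun r _ => hr' r
      refine h.not_adj hx (fun f hf => ?_) ((h.chain e).adj _ _ hc')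
      obtain ⟨c'', -, hc''⟩ := h.exists_of_lab hpq hp hq hN hc'C hf fun r _ => hr' r
      exact hx f ⟨c'', hc''⟩

theorem Scheme.six_le_card [Fintype V] {G : SimpleGraph V} {ρ : Fin 3 ⊕ Fin 3 → V}
    {F : Fin 3 × Fin 3 → V → V → ZMod 2} (h : Scheme G ρ F) : 6 ≤ Fintype.card V := by
  simpa using Fintype.card_le_of_injective ρ h.inj

theorem Reduced.conn3 [Fintype V] {G : SimpleGraph V} {ρ : Fin 3 ⊕ Fin 3 → V}
    {F : Fin 3 × Fin 3 → V → V → ZMod 2} (h : Reduced G ρ F) : Conn3 G := by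
  have hcut : ∀ (p q : V) (C : Set V), p ≠ q → C.Nonempty → p ∉ C → q ∉ C →
      (∀ x ∈ C, ∀ y, G.Adj x y → y ∈ C ∨ y = p ∨ y = q) → ∀ y, y ∈ C ∨ y = p ∨ y = q := by
    intro p q C hpq hC hp hq hN
    by_contra! hD
    obtain ⟨x, hx⟩ := exists_center (h.meet_of_lab (a := p))
    obtain ⟨y, hy⟩ := exists_center (h.meet_of_lab (a := q))
    have hroot : ∀ r, r ≠ x → r ≠ y → ρ r ≠ p ∧ ρ r ≠ q := fun r hrx hry =>
      ⟨fun hr => hrx (eq_of_forall_inc r x fun e he => hx e (hr ▸ h.lab_root he)),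
        fun hr => hry (eq_of_forall_inc r y fun e he => hy e (hr ▸ h.lab_root he))⟩
    have hside : ∀ e, ¬ Inc x e → ¬ Inc y e →
        (ρ (Sum.inl e.1) ∈ C ↔ ρ (Sum.inr e.2) ∈ C) := by
      intro e hxe hye
      have h1 := bd_cutChain_add h.toScheme hpq hp hq hN e
      have h2 : bd (cutChain C (F e)) p = 0 := by
        by_contra hne
        obtain ⟨c, -, hc⟩ := lab_of_bd_cutChain hp hne
        exact hxe (hx e ⟨c, hc⟩)
      have h3 : bd (cutChain C (F e)) q = 0 := by
        by_contra hne
        obtain ⟨c, -, hc⟩ := lab_of_bd_cutChain hq hne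
        exact hye (hy e ⟨c, hc⟩)
      rw [h2, h3] at h1
      by_cases h4 : ρ (Sum.inl e.1) ∈ C <;> by_cases h5 : ρ (Sum.inr e.2) ∈ C <;>
        simp [h4, h5, ind_true, ind_false] at h1 ⊢
    rcases const_of_avoid (P := fun r => ρ r ∈ C) hside with hr | hr
    · refine h.no_cut (C := {z | z ∉ C ∧ z ≠ p ∧ z ≠ q}) hpq (by simp) (by simp)
        (fun z hz w hzw => ?_) hD hx hy fun r hrx hry hh => hh.1 (hr r hrx hry)
      by_contra! hw
      have hwC : w ∈ C := by
        by_contra hwC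
        exact hw.1 ⟨hwC, hw.2⟩
      exact (hN w hwC z hzw.symm).elim hz.1 fun hh => hh.elim hz.2.1 hz.2.2
    · exact h.no_cut hpq hp hq hN hC hx hy hr
  intro p q C hC hp hq hN
  by_cases hpq : p = q
  · subst hpq
    by_contra! hD
    obtain ⟨d, hdC, hdp, -⟩ := hD
    obtain ⟨c, hc⟩ := hC
    have h1 := hcut p d C (Ne.symm hdp) ⟨c, hc⟩ hp hdC fun x hx y hxy => by
      have := hN x hx y hxy
      tauto
    have h2 := hcut p c {d} (by rintro rfl; exact hp hc) ⟨d, rfl⟩ (Ne.symm hdp)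
      (by rintro rfl; exact hdC hc) (by
        rintro x rfl y hxy
        rcases h1 y with hy | rfl | rfl
        · have := hN y hy x hxy.symm
          tauto
        · exact Or.inr (Or.inl rfl)
        · exact Or.inl rfl)
    classical
    have h3 : (Finset.univ : Finset V) ⊆ {d, p, c} := fun y _ => by simpa using h2 y
    have h4 := (Finset.card_le_card h3).trans Finset.card_le_three
    have h5 := h.toScheme.six_le_card
    rw [Finset.card_univ] at h4
    omega
  · exact hcut p q C hpq hC hp hq hN

/-- The total number of edges in the chains `F e`. -/
noncomputable def size (F : Fin 3 × Fin 3 → V → V → ZMod 2) : ℕ :=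
  {x : (Fin 3 × Fin 3) × V × V | F x.1 x.2.1 x.2.2 ≠ 0}.ncard

theorem Scheme.exists_reduced (n : ℕ) : ∀ (V : Type) [Fintype V] (G : SimpleGraph V)
    (ρ : Fin 3 ⊕ Fin 3 → V) (F : Fin 3 × Fin 3 → V → V → ZMod 2), Fintype.card V = n →
    Scheme G ρ F → ¬ K33Minor G → ∃ (W : Type) (_ : Fintype W) (G' : SimpleGraph W)
      (ρ' : Fin 3 ⊕ Fin 3 → W) (F' : Fin 3 × Fin 3 → W → W → ZMod 2),
      Reduced G' ρ' F' ∧ ¬ K33Minor G' := by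
  classical
  induction n with
  | zero =>
    intro V _ G ρ F hV h
    have := h.six_le_card
    omega
  | succ n ih =>
    intro V _ G ρ F hV h hm
    by_contra hcon
    let S : Set ((Fin 3 ⊕ Fin 3 → V) × (Fin 3 × Fin 3 → V → V → ZMod 2)) :=
      {x | Scheme G x.1 x.2}
    obtain ⟨⟨ρ, F⟩, h, hmin⟩ := (measure fun x => size x.2).wf.has_min S ⟨(ρ, F), h⟩
    replace h : Scheme G ρ F := h
    have hmerge : ∀ {u v : V}, u ≠ v →
        (∀ {W : Type} {π : V → W}, IsMerge π u v → K33Minor (imageGraph G π) → K33Minor G) →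
        ∃ e f, Lab F u e ∧ Lab F v f ∧ ¬ Meet e f := by
      intro u v huv hlift
      by_contra! hmeet
      obtain ⟨π, hπ⟩ := exists_isMerge huv
      refine hcon (ih {x // x ≠ u} _ _ _ ?_ (h.push hπ hmeet) fun hK => hm (hlift hπ hK))
      rw [Fintype.card_subtype_compl, Fintype.card_subtype_eq, hV, Nat.add_sub_cancel]
    refine hcon ⟨V, _, G, ρ, F, ⟨h, ?_, ?_, ?_⟩, hm⟩
    · exact fun u v huv => hmerge huv.ne fun hπ => K33Minor.of_contract hπ huv
    · intro u
      by_cases hu : ∃ v, G.Adj u v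
      · obtain ⟨v, huv⟩ := hu
        obtain ⟨e, -, he, -⟩ := hmerge huv.ne fun hπ => K33Minor.of_contract hπ huv
        exact ⟨e, he⟩
      · push Not at hu
        obtain ⟨v, hv⟩ := Fintype.exists_ne_of_one_lt_card (by
          have := h.six_le_card
          omega) u
        obtain ⟨e, -, he, -⟩ := hmerge hv.symm fun hπ => K33Minor.of_delete hπ hv.symm hu
        exact ⟨e, he⟩
    · intro ρ' H hH hF e a b
      by_contra hne
      refine hmin (ρ', fun e => F e + H e) hH (Set.ncard_lt_ncard ⟨?_, fun hsub => ?_⟩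
        (Set.toFinite _))
      · rintro ⟨f, c, d⟩ hx h0
        refine hx ?_
        simp only [Pi.add_apply]
        rw [show F f c d = 0 from h0, zero_add]
        exact (hF f c d).elim id fun h1 => h1.trans h0
      · have h1 : H e a b = F e a b := (hF e a b).resolve_left hne
        refine hsub (a := (e, a, b)) (h1 ▸ hne : F e a b ≠ 0) ?_
        simp only [Pi.add_apply, h1]
        exact CharTwo.add_self_eq_zero _

theorem sum_not_meet (g : Fin 3 ⊕ Fin 3 → ZMod 2) (e : Fin 3 × Fin 3) :
    ∑ f with ¬ Meet e f, (g (Sum.inl f.1) + g (Sum.inr f.2)) = 0 := by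
  rw [Finset.sum_filter]
  fin_cases e <;> simp [Fintype.sum_prod_type, Fin.sum_univ_three, Meet] <;> ring_nf <;> reduce_mod_char

theorem sum_cross (l : Fin 3 ⊕ Fin 3 → Fin 3 ⊕ Fin 3 → ZMod 2)
    (hl : ∀ r s, r ≠ s → l r s + l s r = 1) :
    ∑ x : (Fin 3 × Fin 3) × Fin 3 × Fin 3 with ¬ Meet x.1 x.2 ∧ x.1.1 < x.2.1, 
      (l (Sum.inl x.1.1) (Sum.inl x.2.1) + l (Sum.inl x.1.1) (Sum.inr x.2.2) +
       l (Sum.inr x.1.2) (Sum.inl x.2.1) + l (Sum.inr x.1.2) (Sum.inr x.2.2)) = 1 := by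
  rw [Finset.sum_filter]
  have h := fun i j hij => eq_sub_of_add_eq (hl (Sum.inr i) (Sum.inr j) hij)
  simp [Fintype.sum_prod_type, Fin.sum_univ_three, Meet]
  rw [h 1 0 (by simp), h 2 0 (by simp), h 2 1 (by simp)]
  ring_nf
  reduce_mod_char

theorem sum_pairs {M : Type} [AddCommMonoid M] (T : Fin 3 × Fin 3 → Fin 3 × Fin 3 → M) :
    ∑ x : (Fin 3 × Fin 3) × Fin 3 × Fin 3 with ¬ Meet x.1 x.2, T x.1 x.2 =
      ∑ x : (Fin 3 × Fin 3) × Fin 3 × Fin 3 with ¬ Meet x.1 x.2 ∧ x.1.1 < x.2.1,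
        (T x.1 x.2 + T x.2 x.1) := by
  rw [Finset.sum_add_distrib, ← Finset.sum_filter_add_sum_filter_not _ fun x => x.1.1 < x.2.1,
    Finset.filter_filter, Finset.filter_filter]
  congr 1
  refine Finset.sum_nbij' Prod.swap Prod.swap ?_ ?_ (fun _ _ => rfl) (fun _ _ => rfl)
    fun _ _ => rfl
  all_goals
    rintro ⟨e, f⟩ hx
    simp only [Meet] at hx ⊢
    grind

theorem cr_sum [Fintype V] {ι : Type} (pos : V → ℕ) (s : Finset ι)
    (Z : ι → V → V → V → V → ZMod 2) : cr pos (∑ i ∈ s, Z i) = ∑ i ∈ s, cr pos (Z i) := by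
  classical
  induction s using Finset.induction_on with
  | empty => simp [cr]
  | insert i s hi ih => rw [Finset.sum_insert hi, Finset.sum_insert hi, cr_add, ih]

theorem sum_ind_ptFn [Fintype V] (P : V → V → Prop) (x y : V) :
    ∑ a, ∑ c, ind (P a c) * (ptFn x a * ptFn y c) = ind (P x y) := by
  classical
  simp [ptFn]

/-- The cycle of the deleted product of `G` spanned by the pairs of disjoint edges of `K₃,₃`. -/
def schemeCycle (F : Fin 3 × Fin 3 → V → V → ZMod 2) (a b c d : V) : ZMod 2 :=
  ∑ x : (Fin 3 × Fin 3) × Fin 3 × Fin 3 with ¬ Meet x.1 x.2, F x.1 a b * F x.2 c d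

theorem schemeCycle_eq (F : Fin 3 × Fin 3 → V → V → ZMod 2) : schemeCycle F =
    ∑ x : (Fin 3 × Fin 3) × Fin 3 × Fin 3 with ¬ Meet x.1 x.2 ∧ x.1.1 < x.2.1,
      torus (F x.1) (F x.2) := by
  funext a b c d
  rw [schemeCycle, sum_pairs fun e f => F e a b * F f c d]
  simp only [Finset.sum_apply, torus]

theorem Scheme.isZ [Fintype V] {G : SimpleGraph V} {ρ : Fin 3 ⊕ Fin 3 → V}
    {F : Fin 3 × Fin 3 → V → V → ZMod 2} (h : Scheme G ρ F) : IsZ G (schemeCycle F) := by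
  have hne : ∀ a b c d, schemeCycle F a b c d ≠ 0 →
      ∃ e f, ¬ Meet e f ∧ F e a b ≠ 0 ∧ F f c d ≠ 0 := by
    intro a b c d hZ
    obtain ⟨⟨e, f⟩, hef, hx⟩ := Finset.exists_ne_zero_of_sum_ne_zero hZ
    exact ⟨e, f, (Finset.mem_filter.1 hef).2, left_ne_zero_of_mul hx, right_ne_zero_of_mul hx⟩
  refine ⟨fun a b c d => ?_, fun a b c d => ?_, fun a b c d hZ => ?_, fun a b c d hZ => ?_,
    fun a b c => ?_⟩
  · simp only [schemeCycle, (h.chain _).symm a b]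
  · rw [schemeCycle_eq]
    simp only [Finset.sum_apply, torus]
    exact Finset.sum_congr rfl fun x _ => by ring
  · obtain ⟨e, f, -, he, -⟩ := hne a b c d hZ
    exact (h.chain e).adj a b he
  · rintro rfl
    obtain ⟨e, f, hef, he, hf⟩ := hne a b a d hZ
    exact hef (h.meet e f a b d he hf)
  · simp only [schemeCycle]
    rw [Finset.sum_comm]
    simp only [← Finset.mul_sum]
    rw [Finset.sum_filter, Fintype.sum_prod_type]
    refine Finset.sum_eq_zero fun e _ => ?_
    dsimp only
    rw [← Finset.sum_filter, ← Finset.mul_sum]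
    have h1 := sum_not_meet (fun r => ptFn (ρ r) c) e
    simp only [← h.boundary] at h1
    exact mul_eq_zero_of_right _ h1

theorem Scheme.cr_eq [Fintype V] {G : SimpleGraph V} {ρ : Fin 3 ⊕ Fin 3 → V}
    {F : Fin 3 × Fin 3 → V → V → ZMod 2} (h : Scheme G ρ F) {pos : V → ℕ}
    (hpos : Function.Injective pos) : cr pos (schemeCycle F) = 1 := by
  rw [schemeCycle_eq, cr_sum, ← sum_cross (fun r s => ind (pos (ρ r) < pos (ρ s)))]
  · refine Finset.sum_congr rfl fun x hx => ?_
    have hx' := (Finset.mem_filter.1 hx).2.1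
    rw [cr_torus (h.chain _) (h.chain _) (fun a b c hab => ?_) hpos]
    · simp only [h.boundary, add_mul, mul_add, Finset.sum_add_distrib, sum_ind_ptFn]
      ring
    · by_contra hac
      exact hx' (h.meet _ _ a b c hab hac)
  · intro r s hrs
    rcases lt_trichotomy (pos (ρ r)) (pos (ρ s)) with hlt | heq | hlt
    · rw [ind_true hlt, ind_false hlt.not_gt, add_zero]
    · exact absurd (h.inj (hpos heq)) hrs
    · rw [ind_true hlt, ind_false hlt.not_gt, zero_add]

theorem Scheme.k33Minor [Fintype V] {G : SimpleGraph V} {ρ : Fin 3 ⊕ Fin 3 → V}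
    {F : Fin 3 × Fin 3 → V → V → ZMod 2} (h : Scheme G ρ F) : K33Minor G := by
  by_contra hm
  obtain ⟨W, _, G', ρ', F', hR, hm'⟩ := h.exists_reduced _ V G ρ F rfl hm
  let pos : W → ℕ := fun w => Fintype.equivFin W w
  have hpos : Function.Injective pos := Fin.val_injective.comp (Fintype.equivFin W).injective
  have h1 := IsZ.complete_five _ W G' rfl hR.conn3 hm' _ hR.toScheme.isZ pos hpos (by
    rw [hR.toScheme.cr_eq hpos]
    exact one_ne_zero)
  have h2 := hR.toScheme.six_le_card
  omega

/-- The edges of a walk, counted modulo two. -/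
noncomputable def walkChain {G : SimpleGraph V} : ∀ {u v : V}, G.Walk u v → V → V → ZMod 2
  | _, _, .nil => 0
  | _, _, .cons (u := u) (v := w) _ p => edgeFn u w + walkChain p

theorem edgeChain_walkChain {G : SimpleGraph V} {u v : V} (p : G.Walk u v) :
    EdgeChain G (walkChain p) := by
  induction p with
  | nil => exact ⟨by simp [walkChain], by simp [walkChain]⟩
  | cons h p ih => exact (edgeFn_chain h).add ih

theorem bd_walkChain [Fintype V] {G : SimpleGraph V} {u v : V} (p : G.Walk u v) (a : V) :
    bd (walkChain p) a = ptFn u a + ptFn v a := by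
  induction p with
  | nil =>
    rw [CharTwo.add_self_eq_zero]
    simp [walkChain, bd]
  | @cons u w v h p ih =>
    rw [walkChain, bd_add, bd_edgeFn, ih]
    linear_combination CharTwo.add_self_eq_zero (ptFn w a)

theorem mem_support_of_walkChain {G : SimpleGraph V} {u v : V} (p : G.Walk u v) {a b : V}
    (h : walkChain p a b ≠ 0) : a ∈ p.support := by
  induction p with
  | nil => exact absurd rfl h
  | @cons u w v huw p ih =>
    rw [Walk.support_cons, List.mem_cons]
    by_cases h1 : walkChain p a b = 0
    · have h2 : edgeFn u w a b ≠ 0 := fun h2 => h (by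
        rw [walkChain, Pi.add_apply, Pi.add_apply, h1, h2, add_zero])
      rcases edgeFn_ne_zero h2 with ⟨rfl, -⟩ | ⟨rfl, -⟩
      · exact Or.inl rfl
      · exact Or.inr p.start_mem_support
    · exact Or.inr (ih h1)

theorem scheme_of_hScheme [Fintype V] {G : SimpleGraph V} {f : Fin 3 ⊕ Fin 3 ↪ V}
    (S : HScheme (completeBipartiteGraph (Fin 3) (Fin 3)) G f) :
    ∃ F, Scheme G f F := by
  have hadj : ∀ i j, (completeBipartiteGraph (Fin 3) (Fin 3)).Adj (Sum.inl i) (Sum.inr j) := by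
    simp
  refine ⟨fun e => walkChain (S.path _ _ (hadj e.1 e.2)), f.injective,
    fun e => edgeChain_walkChain _, fun e a => bd_walkChain _ a, fun e g a b c he hg => ?_⟩
  have he' := mem_support_of_walkChain _ he
  have hg' := mem_support_of_walkChain _ hg
  obtain ⟨z, hz⟩ := S.common_endpoint a ⟨_, _, _, he'⟩
  exact Meet.of_inc (hz _ _ _ he') (hz _ _ _ hg')

end K33Scheme

/-- `K_{3,3}` is weakly rooted-contractible. -/
theorem K33_weakly_rooted_contractible :
    IsWeaklyRootedContractible (completeBipartiteGraph (Fin 3) (Fin 3)) := by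
  rintro V _ G f ⟨S⟩
  obtain ⟨F, hF⟩ := K33Scheme.scheme_of_hScheme S
  exact hF.k33Minor.hasMinor
end

section
/- If a graph H is rooted-contractible, then H is 6-colorable, i.e., its chromatic number is at most 6. -/
open SimpleGraph

/-- The graph on two copies of the vertex set of `H` in which every edge `uv` of `F` is replaced
by the path `u, v', u', v`, where primes mark the second copy. -/
def crossedGraph {α : Type} (H F : SimpleGraph α) : SimpleGraph (α ⊕ α) where
  Adj x y := match x, y with
    | .inl u, .inl v => H.Adj u v ∧ ¬ F.Adj u v
    | .inl u, .inr v => F.Adj u v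
    | .inr u, .inl v => F.Adj u v
    | .inr u, .inr v => F.Adj u v
  symm := ⟨by
    rintro (u | u) (v | v) h
    · exact ⟨h.1.symm, fun h' => h.2 h'.symm⟩
    all_goals exact SimpleGraph.Adj.symm (G := F) h⟩
  loopless := ⟨by
    rintro (u | u) h
    · exact H.loopless.irrefl u h.1
    · exact F.loopless.irrefl u h⟩

open Classical in
/-- The path of `crossedGraph H F` representing the edge `uv` of `H`. -/
noncomputable def crossedPath {α : Type} (H F : SimpleGraph α) (u v : α) (h : H.Adj u v) :
    (crossedGraph H F).Walk (Sum.inl u) (Sum.inl v) :=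
  if hF : F.Adj u v then
    .cons (show (crossedGraph H F).Adj (Sum.inl u) (Sum.inr v) from hF) <|
      .cons (show (crossedGraph H F).Adj (Sum.inr v) (Sum.inr u) from hF.symm) <|
        .cons (show (crossedGraph H F).Adj (Sum.inr u) (Sum.inl v) from hF) .nil
  else .cons (show (crossedGraph H F).Adj (Sum.inl u) (Sum.inl v) from ⟨h, hF⟩) .nil

theorem mem_support_crossedPath {α : Type} {H F : SimpleGraph α} {u v : α} {h : H.Adj u v}
    {x : α ⊕ α} (hx : x ∈ (crossedPath H F u v h).support) :
    x.elim id id = u ∨ x.elim id id = v := by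
  unfold crossedPath at hx
  split_ifs at hx <;> simp at hx <;> grind

theorem crossedPath_symm {α : Type} {H F : SimpleGraph α} {u v : α} (h : H.Adj u v) :
    crossedPath H F v u h.symm = (crossedPath H F u v h).reverse := by
  by_cases hF : F.Adj u v
  · simp [crossedPath, hF, hF.symm]
  · have hF' : ¬ F.Adj v u := fun h' => hF h'.symm
    simp [crossedPath, hF, hF']

theorem isPath_crossedPath {α : Type} {H F : SimpleGraph α} {u v : α} (h : H.Adj u v) :
    (crossedPath H F u v h).IsPath := by
  have := h.ne
  unfold crossedPath
  split_ifs <;> simp [this, this.symm]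

/-- The `H`-scheme formed by the paths `crossedPath`. -/
noncomputable def crossedScheme {α : Type} (H F : SimpleGraph α) :
    HScheme H (crossedGraph H F) Function.Embedding.inl where
  path := crossedPath H F
  path_symm _ _ h := crossedPath_symm h
  path_isPath _ _ h := isPath_crossedPath h
  root_mem _ _ _ _ hw := mem_support_crossedPath hw
  common_endpoint x _ := ⟨x.elim id id, fun _ _ _ hx => mem_support_crossedPath hx⟩

/-- A rooted minor of `crossedGraph H F` described by the sets of non-root vertices in its
branch sets. -/
theorem IsRootedContractible.exists_branch {α : Type} [Fintype α] {H : SimpleGraph α}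
    (h : IsRootedContractible H) (F : SimpleGraph α) (hFH : F ≤ H) :
    ∃ S : α → Set α, (Pairwise fun u v => Disjoint (S u) (S v)) ∧
      (∀ u, (S u).Nonempty → ∃ j ∈ S u, F.Adj u j) ∧
      (∀ u v, F.Adj u v → (∃ j ∈ S u, F.Adj j v) ∨ (∃ j ∈ S v, F.Adj j u) ∨
        ∃ i ∈ S u, ∃ j ∈ S v, F.Adj i j) := by
  obtain ⟨C, hroot, hconn, hdisj, hadj⟩ := h _ _ _ ⟨crossedScheme H F⟩
  have hinl : ∀ u w, Sum.inl w ∈ C u → w = u := by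
    intro u w hw
    by_contra hne
    exact Set.disjoint_left.1 (hdisj hne) (hroot w) hw
  refine ⟨fun u => {v | Sum.inr v ∈ C u}, ?_, ?_, ?_⟩
  · intro u v huv
    exact Set.disjoint_left.2 fun x hx hx' => Set.disjoint_left.1 (hdisj huv) hx hx'
  · rintro u ⟨v, hv⟩
    obtain ⟨p⟩ := (hconn u).preconnected ⟨Sum.inl u, hroot u⟩ ⟨Sum.inr v, hv⟩
    cases p with
    | @cons _ y _ hy _ =>
      obtain ⟨y | y, hyC⟩ := y
      · obtain rfl := hinl _ _ hyC
        exact absurd hy (SimpleGraph.irrefl _)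
      · exact ⟨y, hyC, hy⟩
  · intro u v huv
    obtain ⟨x, hx, y, hy, hxy⟩ := hadj u v (hFH huv)
    rcases x with x | x <;> rcases y with y | y
    · obtain rfl := hinl _ _ hx
      obtain rfl := hinl _ _ hy
      exact absurd huv hxy.2
    · obtain rfl := hinl _ _ hx
      exact Or.inr (Or.inl ⟨y, hy, SimpleGraph.Adj.symm (G := F) hxy⟩)
    · obtain rfl := hinl _ _ hy
      exact Or.inl ⟨x, hx, hxy⟩
    · exact Or.inr (Or.inr ⟨x, hx, y, hy, hxy⟩)

/-- Let `F` be a triangle-free subgraph of a rooted-contractible graph. If a permutation of odd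
order moves each vertex of `F` to a neighbor, then so does an injective endomorphism of `F`. -/
theorem IsRootedContractible.exists_adj_automorphism {α ι : Type} [Fintype α] [Fintype ι]
    {H : SimpleGraph α} (h : IsRootedContractible H) (F : SimpleGraph ι) (g : ι ↪ α)
    (hg : ∀ i j, F.Adj i j → H.Adj (g i) (g j))
    (htri : ∀ i j k, F.Adj i j → F.Adj j k → ¬ F.Adj i k)
    (σ : Equiv.Perm ι) (hσ : ∀ i, F.Adj i (σ i)) (m : ℕ) (hm : σ ^ (2 * m + 1) = 1) :
    ∃ π : ι → ι, Function.Injective π ∧ (∀ i, F.Adj i (π i)) ∧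
      ∀ i j, F.Adj i j → F.Adj (π i) (π j) := by
  classical
  obtain ⟨S', hdisj', hne', hadj'⟩ := h.exists_branch (F.map g) (by
    intro u v huv
    obtain ⟨i, j, hij, rfl, rfl⟩ := (SimpleGraph.map_adj _ _ _ _).1 huv
    exact hg i j hij)
  obtain ⟨S, hdisj, hne, hadj⟩ : ∃ S : ι → Finset ι,
      (∀ u v, u ≠ v → Disjoint (S u) (S v)) ∧
      (∀ u, (∃ j ∈ S u, F.Adj u j) ∨ S u = ∅) ∧
      (∀ u v, F.Adj u v → (∃ j ∈ S u, F.Adj j v) ∨ (∃ j ∈ S v, F.Adj j u) ∨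
        ∃ i ∈ S u, ∃ j ∈ S v, F.Adj i j) := by
    refine ⟨fun u => Finset.univ.filter fun j => g j ∈ S' (g u), ?_, ?_, ?_⟩
    · intro u v huv
      refine Finset.disjoint_left.2 fun x hx hx' => ?_
      simp only [Finset.mem_filter, Finset.mem_univ, true_and] at hx hx'
      exact Set.disjoint_left.1 (hdisj' (g.injective.ne huv)) hx hx'
    · intro u
      rcases Finset.eq_empty_or_nonempty (Finset.univ.filter fun j => g j ∈ S' (g u)) with
        h0 | ⟨j, hj⟩
      · exact Or.inr h0
      · left
        obtain ⟨k, hk, hkF⟩ := hne' (g u) ⟨g j, by simpa using hj⟩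
        obtain ⟨i, l, hil, hiu, rfl⟩ := (SimpleGraph.map_adj _ _ _ _).1 hkF
        obtain rfl := g.injective hiu
        exact ⟨l, by simpa using hk, hil⟩
    · intro u v huv
      rcases hadj' (g u) (g v) (by simpa using huv) with ⟨j, hj, hjF⟩ | ⟨j, hj, hjF⟩ |
        ⟨i, hi, j, hj, hijF⟩
      · obtain ⟨a, b, hab, rfl, hb⟩ := (SimpleGraph.map_adj _ _ _ _).1 hjF
        obtain rfl := g.injective hb
        exact Or.inl ⟨a, by simpa using hj, hab⟩
      · obtain ⟨a, b, hab, rfl, hb⟩ := (SimpleGraph.map_adj _ _ _ _).1 hjF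
        obtain rfl := g.injective hb
        exact Or.inr (Or.inl ⟨a, by simpa using hj, hab⟩)
      · obtain ⟨a, b, hab, rfl, rfl⟩ := (SimpleGraph.map_adj _ _ _ _).1 hijF
        exact Or.inr (Or.inr ⟨a, by simpa using hi, b, by simpa using hj, hab⟩)
  have hsum : ∑ i, (S i).card ≤ Fintype.card ι := by
    rw [← Finset.card_biUnion fun i _ j _ hij => hdisj i j hij]
    exact Finset.card_le_univ _
  have hempty : ∀ u v, F.Adj u v → S u = ∅ → 2 ≤ (S v).card := by
    intro u v huv hu
    have hex : ∃ j ∈ S v, F.Adj j u := by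
      rcases hadj u v huv with ⟨j, hj, _⟩ | hv | ⟨i, hi, _⟩
      · simp [hu] at hj
      · exact hv
      · simp [hu] at hi
    obtain ⟨j, hj, hju⟩ := hex
    rcases hne v with ⟨k, hk, hvk⟩ | h0
    · refine Finset.one_lt_card.2 ⟨j, hj, k, hk, ?_⟩
      rintro rfl
      exact htri u v j huv hvk hju.symm
    · simp [h0] at hj
  have hedge : ∀ u v, F.Adj u v → 2 ≤ (S u).card + (S v).card := by
    intro u v huv
    rcases Finset.eq_empty_or_nonempty (S u) with hu | hu
    · have := hempty u v huv hu
      lia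
    · rcases Finset.eq_empty_or_nonempty (S v) with hv | hv
      · have := hempty v u huv.symm hv
        lia
      · have := hu.card_pos
        have := hv.card_pos
        lia
  have heq : ∀ i, (S i).card + (S (σ i)).card = 2 := by
    have hle : ∑ i, ((S i).card + (S (σ i)).card) ≤ ∑ _i : ι, 2 := by
      rw [Finset.sum_add_distrib, Equiv.sum_comp σ fun i => (S i).card]
      simp
      lia
    have hge : ∀ i ∈ Finset.univ, 2 ≤ (S i).card + (S (σ i)).card :=
      fun i _ => hedge _ _ (hσ i)
    intro i
    exact ((Finset.sum_eq_sum_iff_of_le hge).1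
      (le_antisymm (Finset.sum_le_sum hge) hle) i (Finset.mem_univ i)).symm
  have hone : ∀ i, (S i).card = 1 := by
    have hpow : ∀ k i, (S ((σ ^ (2 * k)) i)).card = (S i).card := by
      intro k
      induction k with
      | zero => simp
      | succ k ih =>
        intro i
        have e : (σ ^ (2 * (k + 1))) i = (σ ^ (2 * k)) (σ (σ i)) := by
          rw [show 2 * (k + 1) = 2 * k + 1 + 1 by ring, pow_succ, pow_succ]
          rfl
        have := heq i
        have := heq (σ i)
        rw [e, ih]
        lia
    intro i
    have e : (σ ^ (2 * m)) (σ i) = i := by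
      have := congrArg (fun τ : Equiv.Perm ι => τ i) hm
      simpa [pow_succ] using this
    have := hpow m (σ i)
    rw [e] at this
    have := heq i
    lia
  choose π hπ using fun i => Finset.card_eq_one.1 (hone i)
  have hπadj : ∀ i, F.Adj i (π i) := by
    intro i
    rcases hne i with ⟨j, hj, hij⟩ | h0
    · rw [hπ, Finset.mem_singleton] at hj
      exact hj ▸ hij
    · simp [hπ] at h0
  refine ⟨π, ?_, hπadj, ?_⟩
  · intro i j hij
    by_contra hne
    have := hdisj i j hne
    simp [hπ, hij] at this
  · intro i j hij
    have := hadj i j hij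
    simp only [hπ, Finset.mem_singleton, exists_eq_left] at this
    rcases this with h1 | h1 | h1
    · exact absurd h1.symm (htri _ _ _ hij.symm (hπadj i))
    · exact absurd h1.symm (htri _ _ _ hij (hπadj j))
    · exact h1

/-- The cycle `0, 1, …, c` with the additional chord joining `0` and `b`. -/
def chordedCycle (b c : ℕ) : SimpleGraph (Fin (c + 1)) :=
  SimpleGraph.fromRel fun i j =>
    i.val + 1 = j.val ∨ (i.val = 0 ∧ (j.val = b ∨ j.val = c))

theorem chordedCycle_adj {b c : ℕ} (hb : 0 < b) (hc : 0 < c) (i j : Fin (c + 1)) :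
    (chordedCycle b c).Adj i j ↔
      (i.val + 1 = j.val ∨ (i.val = 0 ∧ (j.val = b ∨ j.val = c))) ∨
      (j.val + 1 = i.val ∨ (j.val = 0 ∧ (i.val = b ∨ i.val = c))) := by
  rw [chordedCycle, SimpleGraph.fromRel_adj]
  have : i ≠ j ↔ i.val ≠ j.val := by rw [Ne, Fin.ext_iff]
  rw [this]
  lia

/-- In a rooted-contractible graph, the first vertex of a path is not adjacent to two vertices
at even positions from `4` on. -/
theorem IsRootedContractible.not_adj_and_adj {α : Type} [Fintype α] {H : SimpleGraph α}
    (h : IsRootedContractible H) {b c : ℕ} (hb : Even b) (hc : Even c) (hb4 : 4 ≤ b)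
    (hbc : b < c) (p : ℕ → α) (hinj : Set.InjOn p (Set.Iic c))
    (hp : ∀ i < c, H.Adj (p i) (p (i + 1))) (h0b : H.Adj (p 0) (p b)) :
    ¬ H.Adj (p 0) (p c) := by
  intro h0c
  have hbc2 : b + 2 ≤ c := by grind
  obtain ⟨m, hm⟩ := hc
  have hadj := chordedCycle_adj (b := b) (c := c) (by lia) (by lia)
  obtain ⟨π, hπinj, hπ, hπhom⟩ := h.exists_adj_automorphism (chordedCycle b c)
    ⟨fun i => p i.val, fun i j hij => Fin.ext
      (hinj (Set.mem_Iic.2 (by lia)) (Set.mem_Iic.2 (by lia)) hij)⟩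
    (by
      intro i j hij
      change H.Adj (p i) (p j)
      rcases (hadj i j).1 hij with (e | ⟨e, e' | e'⟩) | (e | ⟨e, e' | e'⟩)
      · rw [← e]; exact hp _ (by lia)
      · rw [e, e']; exact h0b
      · rw [e, e']; exact h0c
      · rw [← e]; exact (hp _ (by lia)).symm
      · rw [e, e']; exact h0b.symm
      · rw [e, e']; exact h0c.symm)
    (by
      intro i j k
      rw [hadj, hadj, hadj]
      clear hadj
      obtain ⟨l, hl⟩ := hb
      intro h1 h2 h3
      omega)
    (finRotate (c + 1))
    (by
      intro i
      rw [hadj, coe_finRotate]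
      split_ifs with hi
      · simp [hi]
      · simp)
    m (by
      rw [← two_mul] at hm
      rw [← hm]
      have hcyc := isCycle_finRotate_of_le (n := c + 1) (by lia)
      have := pow_orderOf_eq_one (finRotate (c + 1))
      rwa [hcyc.orderOf, support_finRotate_of_le (by lia), Finset.card_univ,
        Fintype.card_fin] at this)
  let v (i : ℕ) (hi : i ≤ c) : Fin (c + 1) := ⟨i, by lia⟩
  have e0 := hπ (v 0 (by lia))
  have eb := hπ (v b (by lia))
  have e1 := hπ (v 1 (by lia))
  have f01 := hπhom (v 0 (by lia)) (v 1 (by lia)) (by rw [hadj]; simp [v])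
  have f0b := hπhom (v 0 (by lia)) (v b (by lia)) (by rw [hadj]; simp [v])
  have f0c := hπhom (v 0 (by lia)) (v c (by lia)) (by rw [hadj]; simp [v])
  have fb := hπhom (v b (by lia)) (v (b + 1) (by lia)) (by rw [hadj]; simp [v])
  have fb' := hπhom (v b (by lia)) (v (b - 1) (by lia)) (by rw [hadj]; simp [v]; lia)
  have ninj : ∀ i j (hi : i ≤ c) (hj : j ≤ c), i ≠ j → (π (v i hi)).val ≠ (π (v j hj)).val := by
    intro i j hi hj hij e
    exact hij (Fin.mk.inj_iff.1 (hπinj (Fin.ext e)))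
  have n1 := ninj 1 b (by lia) (by lia) (by lia)
  have n2 := ninj 1 c (by lia) (by lia) (by lia)
  have n3 := ninj b c (by lia) (by lia) (by lia)
  have n4 := ninj (b + 1) (b - 1) (by lia) (by lia) (by lia)
  have n5 := ninj 0 (b - 1) (by lia) (by lia) (by lia)
  have n6 := ninj 0 (b + 1) (by lia) (by lia) (by lia)
  rw [hadj] at e0 eb e1 f01 f0b f0c fb fb'
  have hv : ∀ i hi, (v i hi).val = i := fun _ _ => rfl
  simp only [hv] at e0 eb e1
  have k0 : (π (v 0 (by lia))).val = b := by lia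
  have kb : (π (v b (by lia))).val = 0 := by lia
  lia

/-- Depth-first coloring: `P` is the stack of active vertices and `U` the set of vertices still to
be colored.  The first components of the colors alternate along `P`. -/
theorem exists_extend_coloring {α : Type} [DecidableEq α] (H : SimpleGraph α)
    (hno : ∀ Q : List α, Q.Nodup → Q.IsChain H.Adj → ∀ j k (hj : j < Q.length)
      (hk : k < Q.length), Even j → Even k → 4 ≤ j → j < k →
      H.Adj Q[0] Q[j] → ¬ H.Adj Q[0] Q[k])
    (n : ℕ) (U : Finset α) (P : List α) (hn : 2 * U.card + P.length = n)
    (col : α → Bool × Fin 3) (hP : P.Nodup) (hPU : ∀ w ∈ P, w ∉ U)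
    (hchain : P.IsChain fun a b => H.Adj a b ∧ (col a).1 ≠ (col b).1) :
    ∃ col' : α → Bool × Fin 3, (∀ w ∉ U, col' w = col w) ∧
      ∀ u ∈ U, ∀ w, w ∈ U ∨ w ∈ P → H.Adj u w → col' u ≠ col' w := by
  induction n using Nat.strong_induction_on generalizing U P col with
  | _ n ih =>
  rcases U.eq_empty_or_nonempty with rfl | ⟨u₀, hu₀⟩
  · exact ⟨col, by simp, by simp⟩
  by_cases hpush : ∃ u ∈ U, ∀ v ∈ P.head?, H.Adj u v
  · obtain ⟨u, hu, huP⟩ := hpush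
    have huP' : u ∉ P := fun h => hPU u h hu
    have hQnodup : (u :: P).Nodup := List.nodup_cons.2 ⟨huP', hP⟩
    have hupd : ∀ x, ∀ w ∈ P, Function.update col u x w = col w := fun x w hw =>
      Function.update_of_ne (ne_of_mem_of_not_mem hw huP') _ _
    obtain ⟨β, hβ⟩ : ∃ β : Bool, ∀ v ∈ P.head?, β ≠ (col v).1 := by
      cases P with
      | nil => exact ⟨true, by simp⟩
      | cons v P => exact ⟨!(col v).1, by simp⟩
    have hQchain : ∀ x, (u :: P).IsChain fun a b =>
        H.Adj a b ∧ (Function.update col u (β, x) a).1 ≠ (Function.update col u (β, x) b).1 := by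
      intro x
      rw [List.isChain_cons]
      refine ⟨fun v hv => ⟨huP v hv, ?_⟩, ?_⟩
      · rw [Function.update_self, hupd _ v (List.mem_of_mem_head? hv)]
        exact hβ v hv
      · refine hchain.imp_of_mem_imp fun a b ha hb hab => ?_
        rw [hupd _ a ha, hupd _ b hb]
        exact hab
    have hQadj : (u :: P).IsChain H.Adj := (hQchain 0).imp fun _ _ hab => hab.1
    have hparity : ∀ i (hi : i < (u :: P).length),
        (Function.update col u (β, 0) (u :: P)[i]).1 = β ↔ Even i := by
      intro i
      induction i with
      | zero => simp
      | succ i ihi =>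
        intro hi
        have h1 := ihi (by lia)
        have h2 := ((List.isChain_iff_getElem.1 (hQchain 0)) i hi).2
        rw [Nat.even_add_one, ← h1]
        revert h2
        generalize (Function.update col u (β, 0) (u :: P)[i]).1 = s
        generalize (Function.update col u (β, 0) (u :: P)[i + 1]).1 = t
        cases s <;> cases t <;> cases β <;> simp
    obtain ⟨x, hx⟩ : ∃ x : Fin 3, ∀ w ∈ P, H.Adj u w → (β, x) ≠ col w := by
      have hthree : ∀ y z : Fin 3, ∃ x, x ≠ y ∧ x ≠ z := by decide
      obtain ⟨w₀, hw₀⟩ : ∃ w₀, ∀ k (hk : k < (u :: P).length), Even k → 4 ≤ k →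
          H.Adj u (u :: P)[k] → (u :: P)[k] = w₀ := by
        by_cases hex : ∃ j, ∃ hj : j < (u :: P).length, Even j ∧ 4 ≤ j ∧ H.Adj u (u :: P)[j]
        · obtain ⟨j, hj, hje, hj4, hju⟩ := hex
          refine ⟨(u :: P)[j], fun k hk hke hk4 hku => ?_⟩
          rcases lt_trichotomy j k with hjk | rfl | hjk
          · exact absurd hku (hno _ hQnodup hQadj j k hj hk hje hke hj4 hjk hju)
          · rfl
          · exact absurd hju (hno _ hQnodup hQadj k j hk hj hke hje hk4 hjk hku)
        · exact ⟨u, fun k hk hke hk4 hku => absurd ⟨k, hk, hke, hk4, hku⟩ hex⟩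
      obtain ⟨x, hx2, hx0⟩ := hthree (col ((u :: P).getD 2 u)).2 (col w₀).2
      refine ⟨x, fun w hw huw hcol => ?_⟩
      obtain ⟨k, hk, rfl⟩ := List.mem_iff_getElem.1 (List.mem_cons_of_mem u hw)
      have hke : Even k := by
        rw [← hparity k hk, hupd _ _ hw, ← hcol]
      have hk0 : k ≠ 0 := by
        rintro rfl
        exact H.loopless.irrefl u huw
      by_cases hk4 : 4 ≤ k
      · apply hx0
        rw [← hw₀ k hk hke hk4 huw, ← hcol]
      · have hk2 : k = 2 := by grind
        subst hk2
        apply hx2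
        rw [List.getD_eq_getElem _ _ hk, ← hcol]
    have hcard := Finset.card_erase_add_one hu
    obtain ⟨col', hcol', hprop⟩ := ih _ (by simp; lia) (U.erase u) (u :: P) rfl
      (Function.update col u (β, x)) hQnodup
      (by
        intro w hw
        rcases List.mem_cons.1 hw with rfl | hw
        · simp
        · exact fun h' => hPU w hw (Finset.mem_of_mem_erase h'))
      (hQchain x)
    have hu' : col' u = (β, x) := by
      rw [hcol' u (by simp), Function.update_self]
    refine ⟨col', ?_, ?_⟩
    · intro w hw
      have hwu : w ≠ u := fun e => hw (e ▸ hu)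
      rw [hcol' w (fun h' => hw (Finset.mem_of_mem_erase h')), Function.update_of_ne hwu]
    · intro a ha w hw haw
      by_cases hau : a = u
      · subst hau
        rcases hw with hw | hw
        · exact (hprop w (Finset.mem_erase.2 ⟨haw.ne', hw⟩) a (by simp) haw.symm).symm
        · rw [hu', hcol' w (fun h' => hPU w hw (Finset.mem_of_mem_erase h')), hupd _ w hw]
          exact hx w hw haw
      · refine hprop a (Finset.mem_erase.2 ⟨hau, ha⟩) w ?_ haw
        by_cases hwu : w = u
        · simp [hwu]
        · rcases hw with hw | hw
          · exact Or.inl (Finset.mem_erase.2 ⟨hwu, hw⟩)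
          · exact Or.inr (List.mem_cons_of_mem u hw)
  · cases P with
    | nil => exact absurd ⟨u₀, hu₀, by simp⟩ hpush
    | cons v P =>
      obtain ⟨col', hcol', hprop⟩ := ih _ (by rw [← hn, List.length_cons]; lia) U P rfl col
        (List.nodup_cons.1 hP).2 (fun w hw => hPU w (List.mem_cons_of_mem v hw)) hchain.tail
      refine ⟨col', hcol', fun a ha w hw haw => hprop a ha w ?_ haw⟩
      rcases hw with hw | hw
      · exact Or.inl hw
      · rcases List.mem_cons.1 hw with rfl | hw
        · exact absurd ⟨a, ha, by simpa using haw⟩ hpush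
        · exact Or.inr hw

/-- Every rooted-contractible graph is 6-colorable. -/
theorem rooted_contractible_colorable {α : Type} [Fintype α] (H : SimpleGraph α)
    (h : IsRootedContractible H) : H.Colorable 6 := by
  classical
  obtain ⟨col, -, hcol⟩ := exists_extend_coloring H (by
    intro Q hQ hchain j k hj hk hje hke hj4 hjk h0j h0k
    have hget : ∀ i, (hi : i < Q.length) → Q.getD i Q[0] = Q[i] := fun i hi =>
      List.getD_eq_getElem _ _ hi
    refine h.not_adj_and_adj hje hke hj4 hjk (fun i => Q.getD i Q[0]) ?_ ?_ ?_ ?_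
    · intro a ha b hb hab
      rw [Set.mem_Iic] at ha hb
      simp only [hget a (by lia), hget b (by lia)] at hab
      exact (hQ.getElem_inj_iff).1 hab
    · intro i hi
      simp only [hget i (by lia), hget (i + 1) (by lia)]
      exact List.isChain_iff_getElem.1 hchain i (by lia)
    · simpa only [hget j hj, hget 0 (by lia)] using h0j
    · simpa only [hget k hk, hget 0 (by lia)] using h0k)
    _ Finset.univ [] rfl (fun _ => (true, 0)) (by simp) (by simp) (by simp)
  have hC : H.Colorable (Fintype.card (Bool × Fin 3)) :=
    (SimpleGraph.Coloring.mk col fun {u v} huv =>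
      hcol u (Finset.mem_univ u) v (Or.inl (Finset.mem_univ v)) huv).colorable
  simpa using hC
end
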